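/- arXiv:2305.04960 — 14 statements merged into one kernel-verified Lean document; each statement's English description precedes it below -/
import Mathlib

section
/- Let r ≥ 2, let F be the free monoid on the alphabet {1,…,r}, and let d_1,…,d_r be real numbers each strictly greater than 1. Let ρ be the unique positive real with d_1^{−ρ}+⋯+d_r^{−ρ} = 1. Then there exist positive constants c_1, c_2 and a real X_0 such that for all X ≥ X_0, c_1·X^ρ ≤ #{ω ∈ F : |ω| ≤ X} ≤ c_2·X^ρ (in particular these sets are finite). -/
theorem aux_ind {r : ℕ} (hr : 2 ≤ r) (d : Fin r → ℝ) (hd : ∀ i, 1 < d i) (P : ℝ → Prop)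
    (h0 : ∀ X < 1, P X) (h1 : ∀ X ≥ 1, (∀ i, P (X / d i)) → P X) (X : ℝ) : P X := by
  haveI : Nonempty (Fin r) := ⟨⟨0, by omega⟩⟩
  obtain ⟨j, hj⟩ := Finite.exists_min d
  have key : ∀ n : ℕ, ∀ X < d j ^ n, P X := by
    intro n
    induction n with
    | zero => intro X hX; exact h0 X (by simpa using hX)
    | succ n ih =>
      intro X hX
      rcases lt_or_ge X 1 with h | h
      · exact h0 X h
      · refine h1 X h fun i => ih _ ?_
        have := hd i
        have := hd j
        rw [div_lt_iff₀ (by linarith)]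
        refine hX.trans_le ?_
        rw [pow_succ]
        exact mul_le_mul_of_nonneg_left (hj i) (by positivity)
  obtain ⟨n, hn⟩ := pow_unbounded_of_one_lt X (hd j)
  exact key n X hn

theorem aux_one_le {r : ℕ} (d : Fin r → ℝ) (hd : ∀ i, 1 < d i) (ω : List (Fin r)) :
    1 ≤ (ω.map d).prod := by
  induction ω with
  | nil => simp
  | cons i t ih =>
    rw [List.map_cons, List.prod_cons]
    nlinarith [hd i]

theorem aux_empty {r : ℕ} (d : Fin r → ℝ) (hd : ∀ i, 1 < d i) (X : ℝ) (hX : X < 1) :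
    IsEmpty {ω : List (Fin r) // (ω.map d).prod ≤ X} :=
  ⟨fun ω => by have := aux_one_le d hd ω.1; linarith [ω.2]⟩

def auxEquiv {r : ℕ} (d : Fin r → ℝ) (hd : ∀ i, 1 < d i) (X : ℝ) (hX : X ≥ 1) :
    Option (Σ i, {ω : List (Fin r) // (ω.map d).prod ≤ X / d i}) ≃
      {ω : List (Fin r) // (ω.map d).prod ≤ X} where
  toFun o := match o with
    | none => ⟨[], by simpa using hX⟩
    | some ⟨i, ω⟩ => ⟨i :: ω.1, by
        have h := ω.2
        have := hd i
        rw [le_div_iff₀ (by linarith)] at h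
        rw [List.map_cons, List.prod_cons, mul_comm]
        exact h⟩
  invFun o := match o with
    | ⟨[], _⟩ => none
    | ⟨i :: t, h⟩ => some ⟨i, t, by
        have := hd i
        rw [le_div_iff₀ (by linarith), mul_comm]
        simpa using h⟩
  left_inv o := by
    rcases o with _ | ⟨i, ω, h⟩ <;> rfl
  right_inv o := by
    rcases o with ⟨_ | ⟨i, t⟩, h⟩ <;> rfl

theorem aux_finite {r : ℕ} (hr : 2 ≤ r) (d : Fin r → ℝ) (hd : ∀ i, 1 < d i) (X : ℝ) :
    Finite {ω : List (Fin r) // (ω.map d).prod ≤ X} := by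
  refine aux_ind hr d hd (fun X => Finite {ω : List (Fin r) // (ω.map d).prod ≤ X}) ?_ ?_ X
  · intro X hX
    haveI := aux_empty d hd X hX
    infer_instance
  · intro X hX ih
    haveI := ih
    exact Finite.of_equiv _ (auxEquiv d hd X hX)

theorem aux_rec {r : ℕ} (hr : 2 ≤ r) (d : Fin r → ℝ) (hd : ∀ i, 1 < d i) (X : ℝ) (hX : X ≥ 1) :
    (Nat.card {ω : List (Fin r) // (ω.map d).prod ≤ X} : ℝ) =
      1 + ∑ i, (Nat.card {ω : List (Fin r) // (ω.map d).prod ≤ X / d i} : ℝ) := by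
  haveI := aux_finite hr d hd
  rw [← Nat.card_congr (auxEquiv d hd X hX), Finite.card_option, Nat.card_sigma]
  push_cast
  ring

/-- counting words of bounded multiplicative weight in the free monoid on
`{1,…,r}` (modelled as `List (Fin r)`, with weight the product of the `d i`). -/
theorem stmt_1 (r : ℕ) (hr : 2 ≤ r) (d : Fin r → ℝ) (hd : ∀ i, 1 < d i)
    (ρ : ℝ) (hρ : 0 < ρ) (hsum : ∑ i, d i ^ (-ρ) = 1) :
    ∃ c₁ c₂ : ℝ, 0 < c₁ ∧ 0 < c₂ ∧ ∃ X₀ : ℝ, ∀ X ≥ X₀,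
      {ω : List (Fin r) | (ω.map d).prod ≤ X}.Finite ∧
      c₁ * X ^ ρ ≤ (Nat.card {ω : List (Fin r) // (ω.map d).prod ≤ X} : ℝ) ∧
      (Nat.card {ω : List (Fin r) // (ω.map d).prod ≤ X} : ℝ) ≤ c₂ * X ^ ρ := by
  haveI : Nonempty (Fin r) := ⟨⟨0, by omega⟩⟩
  obtain ⟨j, hj⟩ := Finite.exists_max d
  have hD := hd j
  have hD0 : 0 < d j := by linarith
  have hs : ∀ c X : ℝ, 0 ≤ X → ∑ i, c * (X / d i) ^ ρ = c * X ^ ρ := by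
    intro c X hX
    rw [← mul_one (c * X ^ ρ), ← hsum, Finset.mul_sum]
    refine Finset.sum_congr rfl fun i _ => ?_
    have h0 : 0 ≤ d i := by linarith [hd i]
    rw [Real.div_rpow hX h0, Real.rpow_neg h0, div_eq_mul_inv, mul_assoc]
  have hlow : ∀ X : ℝ, 1 ≤ X → (d j ^ ρ)⁻¹ * X ^ ρ ≤
      (Nat.card {ω : List (Fin r) // (ω.map d).prod ≤ X} : ℝ) := by
    refine aux_ind hr d hd _ (fun X h h' => by linarith) ?_
    intro X hX ih _
    rw [aux_rec hr d hd X hX]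
    rcases le_or_gt X (d j) with h | h
    · have h1 : X ^ ρ ≤ d j ^ ρ := Real.rpow_le_rpow (by linarith) h hρ.le
      have h2 : (d j ^ ρ)⁻¹ * X ^ ρ ≤ 1 := by
        rw [inv_mul_le_iff₀ (by positivity)]; linarith
      have h3 : (0:ℝ) ≤ ∑ i, (Nat.card {ω : List (Fin r) // (ω.map d).prod ≤ X / d i} : ℝ) :=
        Finset.sum_nonneg fun i _ => by positivity
      linarith
    · rw [← hs _ X (by linarith)]
      have := Finset.sum_le_sum fun i (_ : i ∈ Finset.univ) => ih i (by
        have := hd i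
        rw [le_div_iff₀ (by linarith)]; linarith [hj i])
      linarith
  have hup : ∀ X : ℝ, 1 / d j ≤ X →
      (Nat.card {ω : List (Fin r) // (ω.map d).prod ≤ X} : ℝ) ≤ d j ^ ρ * X ^ ρ - 1 := by
    refine aux_ind hr d hd _ ?_ ?_
    · intro X h h'
      haveI := aux_empty d hd X h
      have hX : 0 < X := lt_of_lt_of_le (by positivity) h'
      rw [Nat.card_of_isEmpty, ← Real.mul_rpow hD0.le hX.le]
      rw [div_le_iff₀ hD0] at h'
      have := Real.one_le_rpow (x := d j * X) (by linarith) hρ.le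
      push_cast
      linarith
    · intro X hX ih _
      rw [aux_rec hr d hd X hX]
      have := Finset.sum_le_sum fun i (_ : i ∈ Finset.univ) => ih i (by
        have := hd i
        exact div_le_div₀ (by linarith) hX (by linarith) (hj i))
      rw [Finset.sum_sub_distrib, hs _ X (by linarith)] at this
      have hr' : (2:ℝ) ≤ r := by exact_mod_cast hr
      simp only [Finset.sum_const, Finset.card_univ, Fintype.card_fin, nsmul_eq_mul, mul_one]
        at this
      linarith
  refine ⟨(d j ^ ρ)⁻¹, d j ^ ρ, by positivity, by positivity, 1, fun X hX => ⟨?_, hlow X hX, ?_⟩⟩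
  · exact Set.finite_coe_iff.mp (aux_finite hr d hd X)
  · have := hup X (le_trans (by rw [div_le_one hD0]; exact hD.le) hX)
    linarith
end

section
/- Let r ≥ 2 and let d_1,…,d_r be integers each at least 2 such that the tuple (d_1,…,d_r) is acyclic, and let ρ be the unique positive real with d_1^{−ρ}+⋯+d_r^{−ρ} = 1. If s is a complex number with Re(s) = ρ and d_1^{−s}+⋯+d_r^{−s} = 1, then s = ρ. -/
/-- A tuple of positive integers is cyclic if all entries are positive powers of a
single positive integer. -/
def IsCyclicTuple (r : ℕ) (d : Fin r → ℕ) : Prop :=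
  ∃ b : ℕ, 0 < b ∧ ∃ n : Fin r → ℕ, ∀ i, 0 < n i ∧ d i = b ^ n i

lemma aux_dvd {c : ℝ} (hc : 0 < c) {x y k m : ℕ} (hx : 2 ≤ x) (hxy : x ≤ y)
    (hk : Real.log x = k * c) (hm : Real.log y = m * c) : x ∣ y ∧ k ≤ m := by
  have hx0 : (0 : ℝ) < x := by positivity
  have hy0 : (0 : ℝ) < y := by
    have : 0 < y := by omega
    positivity
  have hlx : 0 < Real.log x := Real.log_pos (by exact_mod_cast hx)
  have hle : Real.log x ≤ Real.log y := Real.log_le_log hx0 (by exact_mod_cast hxy)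
  have hkm : k ≤ m := by
    rw [hk, hm] at hle
    exact_mod_cast le_of_mul_le_mul_right hle hc
  have hk0 : k ≠ 0 := by
    rintro rfl
    simp [hk] at hlx
  refine ⟨?_, hkm⟩
  have heq : x ^ m = y ^ k := by
    have : Real.log ((x : ℝ) ^ m) = Real.log ((y : ℝ) ^ k) := by
      rw [Real.log_pow, Real.log_pow, hk, hm]; ring
    have := Real.log_injOn_pos (Set.mem_Ioi.2 (by positivity)) (Set.mem_Ioi.2 (by positivity)) this
    exact_mod_cast this
  have : x ^ k ∣ y ^ k := heq ▸ pow_dvd_pow x hkm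
  exact (Nat.pow_dvd_pow_iff hk0).1 this

lemma aux_pow {c : ℝ} (hc : 0 < c) {b : ℕ} (hb : 2 ≤ b)
    (hbS : ∃ k : ℕ, Real.log b = k * c)
    (hmin : ∀ x : ℕ, 2 ≤ x → (∃ k : ℕ, Real.log x = k * c) → b ≤ x) :
    ∀ x : ℕ, 2 ≤ x → (∃ k : ℕ, Real.log x = k * c) → ∃ n : ℕ, 0 < n ∧ x = b ^ n := by
  intro x
  induction x using Nat.strong_induction_on with
  | _ x ih =>
    rintro hx ⟨m, hm⟩
    obtain ⟨k, hk⟩ := hbS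
    obtain ⟨⟨q, rfl⟩, hkm⟩ := aux_dvd hc hb (hmin x hx ⟨m, hm⟩) hk hm
    have hq0 : q ≠ 0 := by rintro rfl; simp at hx
    by_cases hq : q = 1
    · exact ⟨1, one_pos, by simp [hq]⟩
    · obtain ⟨n, hn, hqn⟩ := ih q (by nlinarith [Nat.pos_of_ne_zero hq0]) (by omega) ⟨m - k, by
        rw [Nat.cast_sub hkm, sub_mul, ← hm, ← hk]
        push_cast
        rw [Real.log_mul (by positivity) (by positivity)]; ring⟩
      exact ⟨n + 1, by omega, by rw [pow_succ', ← hqn]⟩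

/-- for acyclic degree tuples, `ρ` is the only zero of `1 - ∑ d_i^{-s}`
on the line `Re s = ρ`. -/
theorem stmt_3 (r : ℕ) (hr : 2 ≤ r) (d : Fin r → ℕ) (hd : ∀ i, 2 ≤ d i)
    (hacyclic : ¬ IsCyclicTuple r d)
    (ρ : ℝ) (hρ : 0 < ρ) (hsum : ∑ i, (d i : ℝ) ^ (-ρ) = 1)
    (s : ℂ) (hre : s.re = ρ) (hs : ∑ i, (d i : ℂ) ^ (-s) = 1) :
    s = (ρ : ℂ) := by
  by_contra hne
  have ht : s.im ≠ 0 := fun h => hne (Complex.ext (by simpa using hre) (by simpa using h))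
  have hpos : ∀ i, 0 < d i := fun i => by have := hd i; omega
  have hnorm : ∀ i, ‖(d i : ℂ) ^ (-s)‖ = (d i : ℝ) ^ (-ρ) := fun i => by
    rw [Complex.norm_natCast_cpow_of_pos (hpos i), Complex.neg_re, hre]
  have hresum : ∑ i, ((d i : ℂ) ^ (-s)).re = ∑ i, (d i : ℝ) ^ (-ρ) := by
    rw [hsum, ← Complex.re_sum, hs, Complex.one_re]
  have hrei : ∀ i, ((d i : ℂ) ^ (-s)).re = (d i : ℝ) ^ (-ρ) := by
    have := (Finset.sum_eq_sum_iff_of_le (s := Finset.univ) (fun i _ => by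
      rw [← hnorm i]; exact Complex.re_le_norm _)).1 hresum
    exact fun i => this i (Finset.mem_univ i)
  have hcpos : 0 < 2 * Real.pi / |s.im| := by positivity
  have hS : ∀ i, ∃ k : ℕ, Real.log (d i) = k * (2 * Real.pi / |s.im|) := by
    intro i
    have h0 : (0 : ℝ) < d i := by exact_mod_cast hpos i
    have h1 := hrei i
    rw [Complex.cpow_def_of_ne_zero (by exact_mod_cast h0.ne'), ← Complex.natCast_log,
      Complex.exp_re, Real.rpow_def_of_pos h0] at h1
    simp only [Complex.re_ofReal_mul, Complex.im_ofReal_mul, Complex.neg_re, Complex.neg_im,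
      hre] at h1
    have h2 : Real.cos (Real.log (d i) * -s.im) = 1 :=
      mul_left_cancel₀ (Real.exp_pos _).ne' (h1.trans (mul_one _).symm)
    obtain ⟨n, hn⟩ := (Real.cos_eq_one_iff _).1 h2
    have hl : 0 ≤ Real.log (d i) := Real.log_natCast_nonneg _
    refine ⟨n.natAbs, ?_⟩
    have h3 := congrArg abs hn
    rw [abs_mul, abs_mul (Real.log _), abs_neg, abs_of_nonneg hl, abs_of_pos Real.two_pi_pos] at h3
    rw [Nat.cast_natAbs, Int.cast_abs]
    field_simp
    linarith
  classical
  have hex : ∃ x : ℕ, 2 ≤ x ∧ ∃ k : ℕ, Real.log x = k * (2 * Real.pi / |s.im|) :=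
    ⟨d ⟨0, by omega⟩, hd _, hS _⟩
  obtain ⟨hb, hbS⟩ := Nat.find_spec hex
  have key := aux_pow hcpos hb hbS (fun x hx hxS => Nat.find_min' hex ⟨hx, hxS⟩)
  choose n hn using fun i => key (d i) (hd i) (hS i)
  exact hacyclic ⟨Nat.find hex, by omega, n, hn⟩
end

section
/- Let r ≥ 2, let F be the free monoid on {1,…,r}, let d_1,…,d_r be integers each at least 2 such that the tuple (d_1,…,d_r) is acyclic, and let ρ be the unique positive real with d_1^{−ρ}+⋯+d_r^{−ρ} = 1. Then, as the real number X tends to infinity, #{ω ∈ F : |ω| ≤ X} / X^ρ tends to the constant 1/(ρ·∑_{i=1}^r d_i^{−ρ}·log d_i). Equivalently, #{ω ∈ F : |ω| ≤ X} = (−1/(ρ·G'(ρ)))·X^ρ + o(X^ρ), where G(s) = d_1^{−s}+⋯+d_r^{−s}. -/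
open Filter

/-- Maximum principle step for the renewal equation. -/
lemma renewal_step {ι : Type*} [Fintype ι] (a p : ι → ℝ) (hp : ∀ i, 0 < p i)
    (hs : ∑ i, p i = 1) (Z z : ℝ → ℝ) (hz : Tendsto z atTop (nhds 0))
    (hZ : ∀ x, Z x = z x + ∑ i, p i * Z (x - a i)) (L : ℝ)
    (hL : ∀ ε > 0, ∀ᶠ x in atTop, Z x ≤ L + ε) (F : Filter ℝ) (hF : F ≤ atTop)
    (hT : Tendsto Z F (nhds L)) (i : ι) : Tendsto (fun x => Z (x - a i)) F (nhds L) := by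
  rw [Metric.tendsto_nhds]
  intro ε hε
  have hδ : 0 < p i * ε / 4 := by have := hp i; positivity
  have hp1 : p i ≤ 1 := by
    rw [← hs]; exact Finset.single_le_sum (fun j _ => (hp j).le) (Finset.mem_univ i)
  obtain ⟨δ, hδe⟩ : ∃ δ, δ = p i * ε / 4 := ⟨_, rfl⟩
  rw [← hδe] at hδ
  have h1 := (Metric.tendsto_nhds.1 hT) δ hδ
  have h2 := hF ((Metric.tendsto_nhds.1 hz) δ hδ)
  have h3 : ∀ᶠ x in F, ∀ j, Z (x - a j) ≤ L + δ := by
    rw [eventually_all]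
    intro j
    exact hF ((tendsto_atTop_add_const_right atTop (-a j) tendsto_id).eventually (hL δ hδ))
  filter_upwards [h1, h2, h3] with x h1 h2 h3
  rw [Real.dist_eq, abs_lt] at *
  have h4 : p i * (L + δ - Z (x - a i)) ≤ ∑ j, p j * (L + δ - Z (x - a j)) :=
    Finset.single_le_sum (f := fun j => p j * (L + δ - Z (x - a j)))
      (fun j _ => mul_nonneg (hp j).le (by linarith [h3 j])) (Finset.mem_univ i)
  have h5 : ∑ j, p j * (L + δ - Z (x - a j)) = L + δ - ∑ j, p j * Z (x - a j) := by
    simp only [mul_sub, Finset.sum_sub_distrib, ← Finset.sum_mul, hs, one_mul]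
  have h6 := hZ x
  have h7 : p i * (L + δ - Z (x - a i)) < p i * ε := by nlinarith
  have h8 := lt_of_mul_lt_mul_left h7 (hp i).le
  have h9 := h3 i
  have : δ < ε := by nlinarith [hp i]
  constructor <;> linarith

lemma renewal_semigroup {ι : Type*} [Fintype ι] (a p : ι → ℝ) (hp : ∀ i, 0 < p i)
    (hs : ∑ i, p i = 1) (Z z : ℝ → ℝ) (hz : Tendsto z atTop (nhds 0))
    (hZ : ∀ x, Z x = z x + ∑ i, p i * Z (x - a i)) (L : ℝ)
    (hL : ∀ ε > 0, ∀ᶠ x in atTop, Z x ≤ L + ε) (s : ℝ)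
    (hmem : s ∈ AddSubmonoid.closure (Set.range a)) : ∀ (F : Filter ℝ) (_ : F ≤ atTop)
    (_ : Tendsto Z F (nhds L)), Tendsto (fun x => Z (x - s)) F (nhds L) := by
  induction hmem using AddSubmonoid.closure_induction with
  | mem x hx =>
    obtain ⟨i, rfl⟩ := hx
    intro F hF hT
    exact renewal_step a p hp hs Z z hz hZ L hL F hF hT i
  | zero => intro F hF hT; simpa using hT
  | add x y _ _ hx hy =>
    intro F hF hT
    have h1 := hx F hF hT
    have h2 := hy (F.map (fun t => t - x))
      ((map_mono hF).trans (tendsto_atTop_add_const_right atTop (-x) tendsto_id)) h1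
    have h3 := tendsto_map'_iff.1 h2
    refine h3.congr fun t => ?_
    simp [sub_sub]

/-- Elements of the subgroup are differences of elements of the semigroup. -/
lemma group_diff {A : Set ℝ} {g : ℝ} (hg : g ∈ AddSubgroup.closure A) :
    ∃ s ∈ AddSubmonoid.closure A, ∃ t ∈ AddSubmonoid.closure A, g = s - t := by
  induction hg using AddSubgroup.closure_induction with
  | mem x hx => exact ⟨x, AddSubmonoid.subset_closure hx, 0, zero_mem _, by simp⟩
  | zero => exact ⟨0, zero_mem _, 0, zero_mem _, by simp⟩
  | add x y _ _ hx hy =>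
    obtain ⟨s, hs, t, ht, rfl⟩ := hx
    obtain ⟨s', hs', t', ht', rfl⟩ := hy
    exact ⟨s + s', add_mem hs hs', t + t', add_mem ht ht', by ring⟩
  | neg x _ hx =>
    obtain ⟨s, hs, t, ht, rfl⟩ := hx
    exact ⟨t, ht, s, hs, by ring⟩

/-- Acyclic tuples have dense group of logarithms. -/
lemma acyclic_dense (r : ℕ) (d : Fin r → ℕ) (hd : ∀ i, 2 ≤ d i)
    (hacyclic : ¬ IsCyclicTuple r d) :
    Dense (AddSubgroup.closure (Set.range fun i => Real.log (d i)) : Set ℝ) := by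
  refine (AddSubgroup.dense_or_cyclic _).resolve_right ?_
  rintro ⟨g, hg⟩
  apply hacyclic
  obtain ⟨g, hg0, hg⟩ : ∃ g : ℝ, 0 ≤ g ∧
      AddSubgroup.closure (Set.range fun i => Real.log (d i)) = AddSubgroup.closure {g} := by
    rcases le_total 0 g with h | h
    · exact ⟨g, h, hg⟩
    · refine ⟨-g, by linarith, ?_⟩
      rw [hg]
      ext x
      simp only [AddSubgroup.mem_closure_singleton]
      constructor
      · rintro ⟨n, rfl⟩; exact ⟨-n, by simp⟩
      · rintro ⟨n, rfl⟩; exact ⟨-n, by simp⟩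
  have hrat : ∀ x ∈ AddSubgroup.closure (Set.range fun i => Real.log (d i)),
      ∃ q : ℚ, Real.exp x = q := by
    intro x hx
    induction hx using AddSubgroup.closure_induction with
    | mem x hx =>
      obtain ⟨i, rfl⟩ := hx
      refine ⟨d i, ?_⟩
      have : (0 : ℝ) < d i := by have := hd i; exact_mod_cast (by omega : 0 < d i)
      simp [Real.exp_log this]
    | zero => exact ⟨1, by simp⟩
    | add x y _ _ hx hy =>
      obtain ⟨q, hq⟩ := hx
      obtain ⟨q', hq'⟩ := hy
      exact ⟨q * q', by rw [Real.exp_add, hq, hq']; push_cast; rfl⟩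
    | neg x _ hx =>
      obtain ⟨q, hq⟩ := hx
      exact ⟨q⁻¹, by rw [Real.exp_neg, hq]; push_cast; rfl⟩
  obtain ⟨q, hq⟩ := hrat g (by rw [hg]; exact AddSubgroup.subset_closure rfl)
  have hn : ∀ i, ∃ n : ℕ, 0 < n ∧ (d i : ℚ) = q ^ n := by
    intro i
    have hd2 : (2 : ℝ) ≤ d i := by exact_mod_cast hd i
    have hlog : 0 < Real.log (d i) := Real.log_pos (by linarith)
    have : Real.log (d i) ∈ AddSubgroup.closure {g} := by
      rw [← hg]; exact AddSubgroup.subset_closure ⟨i, rfl⟩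
    obtain ⟨n, hn⟩ := AddSubgroup.mem_closure_singleton.1 this
    rw [zsmul_eq_mul] at hn
    have hnpos : 0 < n := by
      by_contra h
      have : (n : ℝ) ≤ 0 := by exact_mod_cast not_lt.1 h
      nlinarith
    lift n to ℕ using hnpos.le
    refine ⟨n, by exact_mod_cast hnpos, ?_⟩
    have : (d i : ℝ) = (q : ℝ) ^ n := by
      rw [← hq, ← Real.exp_nat_mul, ← Real.exp_log (by linarith : (0 : ℝ) < d i), ← hn]
      simp
    exact_mod_cast this
  choose n hn0 hn using hn
  have hq0 : 0 < q := by
    have := Real.exp_pos g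
    rw [hq] at this
    exact_mod_cast this
  by_cases hr : Nonempty (Fin r)
  · obtain ⟨i⟩ := hr
    have hden : q.den = 1 := by
      have h := congrArg Rat.den (hn i)
      rw [Rat.den_pow, Rat.den_natCast] at h
      exact (pow_eq_one_iff.1 h.symm).resolve_right (hn0 i).ne'
    have hnum : 0 < q.num := Rat.num_pos.2 hq0
    have hqn : q = (q.num.toNat : ℚ) := by
      conv_lhs => rw [← Rat.num_div_den q, hden]
      rw [Nat.cast_one, div_one]
      have : ((q.num.toNat : ℤ) : ℚ) = (q.num : ℚ) := by rw [Int.toNat_of_nonneg hnum.le]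
      rw [← this, Int.cast_natCast]
    refine ⟨q.num.toNat, by omega, n, fun i => ⟨hn0 i, ?_⟩⟩
    have := hn i
    rw [hqn] at this
    exact_mod_cast this
  · exact ⟨1, one_pos, n, fun i => (hr ⟨i⟩).elim⟩

/-- The counting function of words. -/
noncomputable def wordCount (r : ℕ) (d : Fin r → ℕ) (X : ℝ) : ℕ :=
  Nat.card {ω : List (Fin r) // ((ω.map d).prod : ℝ) ≤ X}

lemma word_finite (r : ℕ) (d : Fin r → ℕ) (hd : ∀ i, 2 ≤ d i) (X : ℝ) :
    {ω : List (Fin r) | ((ω.map d).prod : ℝ) ≤ X}.Finite := by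
  refine (List.finite_length_le (Fin r) ⌊X⌋₊).subset ?_
  intro ω hω
  have h : ∀ ω : List (Fin r), ω.length ≤ (ω.map d).prod ∧ 1 ≤ (ω.map d).prod := by
    intro ω
    induction ω with
    | nil => simp
    | cons i l ih =>
      simp only [List.length_cons, List.map_cons, List.prod_cons]
      have := hd i
      constructor <;> nlinarith [ih.1, ih.2]
  exact (h ω).1.trans (Nat.le_floor hω)

lemma wordCount_mono (r : ℕ) (d : Fin r → ℕ) (hd : ∀ i, 2 ≤ d i) :
    Monotone (wordCount r d) := by
  intro X Y h
  exact Nat.card_mono (word_finite r d hd Y) fun ω hω => le_trans hω h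

lemma wordCount_zero (r : ℕ) (d : Fin r → ℕ) (hd : ∀ i, 2 ≤ d i) (X : ℝ) (hX : X < 1) :
    wordCount r d X = 0 := by
  have : IsEmpty {ω : List (Fin r) // ((ω.map d).prod : ℝ) ≤ X} := by
    constructor
    rintro ⟨ω, hω⟩
    have : 1 ≤ (ω.map d).prod := by
      refine List.one_le_prod_of_one_le ?_
      intro x hx
      obtain ⟨i, _, rfl⟩ := List.mem_map.1 hx
      have := hd i
      omega
    have : (1 : ℝ) ≤ ((ω.map d).prod : ℕ) := by exact_mod_cast this
    linarith
  unfold wordCount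
  exact Nat.card_of_isEmpty

lemma wordCount_rec (r : ℕ) (d : Fin r → ℕ) (hd : ∀ i, 2 ≤ d i) (X : ℝ) :
    wordCount r d X = (if 1 ≤ X then 1 else 0) + ∑ i, wordCount r d (X / d i) := by
  have hpos : ∀ i, (0 : ℝ) < d i := fun i => by
    have := hd i; exact_mod_cast (by omega : 0 < d i)
  have hc : ∀ i (l : List (Fin r)), ((((i :: l).map d).prod : ℕ) : ℝ) ≤ X ↔
      (((l.map d).prod : ℕ) : ℝ) ≤ X / d i := by
    intro i l
    rw [le_div_iff₀ (hpos i)]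
    simp [mul_comm]
  let e : {ω : List (Fin r) // ((ω.map d).prod : ℝ) ≤ X} ≃
      {_u : Unit // 1 ≤ X} ⊕ Σ i, {ω : List (Fin r) // ((ω.map d).prod : ℝ) ≤ X / d i} :=
    { toFun := fun ω => match ω with
        | ⟨[], h⟩ => Sum.inl ⟨(), by simpa using h⟩
        | ⟨i :: l, h⟩ => Sum.inr ⟨i, l, (hc i l).1 h⟩
      invFun := fun s => match s with
        | Sum.inl ⟨_, h⟩ => ⟨[], by simpa using h⟩
        | Sum.inr ⟨i, l, h⟩ => ⟨i :: l, (hc i l).2 h⟩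
      left_inv := by rintro ⟨_ | ⟨i, l⟩, h⟩ <;> rfl
      right_inv := by rintro (⟨_, h⟩ | ⟨i, l, h⟩) <;> rfl }
  have hfin : ∀ i, Finite {ω : List (Fin r) // ((ω.map d).prod : ℝ) ≤ X / d i} := fun i =>
    (word_finite r d hd (X / d i)).to_subtype
  unfold wordCount
  rw [Nat.card_congr e, Nat.card_sum, Nat.card_sigma]
  congr 1
  split_ifs with h <;> simp [h]


lemma exists_limsup_filter (W : ℝ → ℝ) (M : ℝ) (hM : ∀ x, |W x| ≤ M) :
    ∃ L, (∀ ε > 0, ∀ᶠ x in atTop, W x ≤ L + ε) ∧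
      ∃ F : Filter ℝ, F.NeBot ∧ F ≤ atTop ∧ Tendsto W F (nhds L) := by
  have hb : IsBoundedUnder (· ≤ ·) atTop W :=
    isBoundedUnder_of ⟨M, fun x => (abs_le.1 (hM x)).2⟩
  have hb' : IsBoundedUnder (· ≥ ·) atTop W :=
    isBoundedUnder_of ⟨-M, fun x => (abs_le.1 (hM x)).1⟩
  have hc : IsCoboundedUnder (· ≤ ·) atTop W := hb'.isCoboundedUnder_le
  have hup : ∀ ε > 0, ∀ᶠ x in atTop, W x < limsup W atTop + ε := fun ε hε =>
    eventually_lt_of_limsup_lt (by linarith) hb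
  refine ⟨limsup W atTop, fun ε hε => (hup ε hε).mono fun x h => h.le, ?_⟩
  have : MapClusterPt (limsup W atTop) atTop W := by
    rw [mapClusterPt_iff_frequently]
    intro s hs
    obtain ⟨ε, hε, hs⟩ := Metric.mem_nhds_iff.1 hs
    have h1 : ∃ᶠ x in atTop, limsup W atTop - ε < W x :=
      frequently_lt_of_lt_limsup hc (by linarith)
    refine (h1.and_eventually (hup ε hε)).mono ?_
    rintro x ⟨h1, h2⟩
    apply hs
    rw [Metric.mem_ball, Real.dist_eq, abs_lt]
    constructor <;> linarith
  obtain ⟨U, hU, hT⟩ := mapClusterPt_iff_ultrafilter.1 this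
  exact ⟨U, inferInstance, hU, hT⟩

lemma renewal_limit {ι : Type*} [Fintype ι] (a p : ι → ℝ) (ha : ∀ i, 0 < a i)
    (hp : ∀ i, 0 < p i) (ρ : ℝ) (hρ : 0 < ρ) (Z : ℝ → ℝ) (hZ0 : ∀ x, 0 ≤ Z x)
    (hreg : ∀ u y, u ≤ y → Real.exp (-(ρ * (y - u))) * Z u ≤ Z y)
    (hint : ∀ u v, IntervalIntegrable Z MeasureTheory.volume u v)
    (hΦ : Tendsto (fun x => ∑ i, p i * ∫ t in (x - a i)..x, Z t) atTop (nhds (1 / ρ)))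
    (hdense : Dense (AddSubgroup.closure (Set.range a) : Set ℝ))
    (F : Filter ℝ) [F.NeBot] (hF : F ≤ atTop) (L : ℝ)
    (hS : ∀ s ∈ AddSubmonoid.closure (Set.range a), Tendsto (fun x => Z (x - s)) F (nhds L)) :
    L * ∑ i, p i * a i = 1 / ρ := by
  have key : ∀ ε > 0, Real.exp (-(ρ * ε)) * (L - ε) * ∑ i, p i * a i ≤ 1 / ρ ∧
      1 / ρ ≤ Real.exp (ρ * ε) * (L + ε) * ∑ i, p i * a i := by
    intro ε hε
    obtain ⟨g, hgG, hg0, hgε⟩ := hdense.exists_between hε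
    obtain ⟨s, hs, t, ht, hgst⟩ := group_diff hgG
    obtain ⟨K, hK⟩ := exists_nat_ge ((∑ i, a i) / g)
    have hK : ∑ i, a i ≤ K * g := (div_le_iff₀ hg0).1 hK
    have haK : ∀ i, a i ≤ K * g := fun i =>
      (Finset.single_le_sum (fun j _ => (ha j).le) (Finset.mem_univ i)).trans hK
    have hmem : ∀ k ∈ Finset.range (K + 1),
        (K * t + k * g : ℝ) ∈ AddSubmonoid.closure (Set.range a) := by
      intro k hk
      have hk : k ≤ K := by simpa [Nat.lt_succ_iff] using hk
      have : (K * t + k * g : ℝ) = k • s + (K - k) • t := by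
        rw [nsmul_eq_mul, nsmul_eq_mul, Nat.cast_sub hk, hgst]; ring
      rw [this]
      exact add_mem (nsmul_mem hs _) (nsmul_mem ht _)
    have hev : ∀ᶠ x in F, ∀ k ∈ Finset.range (K + 1), dist (Z (x - (K * t + k * g))) L < ε := by
      rw [eventually_all_finset]
      intro k hk
      exact Metric.tendsto_nhds.1 (hS _ (hmem k hk)) ε hε
    have hΦ' : Tendsto (fun x => ∑ i, p i * ∫ u in (x - K * t - a i)..(x - K * t), Z u) F
        (nhds (1 / ρ)) :=
      hΦ.comp ((tendsto_atTop_add_const_right atTop (-(K * t)) tendsto_id).mono_left hF)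
    have hbd : ∀ᶠ x in F, ∀ y ∈ Set.Icc (x - K * t - K * g) (x - K * t),
        Real.exp (-(ρ * ε)) * (L - ε) ≤ Z y ∧ Z y ≤ Real.exp (ρ * ε) * (L + ε) := by
      filter_upwards [hev] with x hx y hy
      have hw0 : 0 ≤ (x - K * t - y) / g := div_nonneg (by linarith [hy.2]) hg0.le
      have hwK : (x - K * t - y) / g ≤ K := (div_le_iff₀ hg0).2 (by linarith [hy.1])
      obtain ⟨w, hw⟩ : ∃ w, w = (x - K * t - y) / g := ⟨_, rfl⟩
      have hwg : w * g = x - K * t - y := by rw [hw]; field_simp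
      rw [← hw] at hw0 hwK
      constructor
      · have hk : ⌈w⌉₊ ≤ K := Nat.ceil_le.2 hwK
        have h1 := hx ⌈w⌉₊ (Finset.mem_range.2 (by omega))
        rw [Real.dist_eq, abs_lt] at h1
        have h2 := Nat.le_ceil w
        have h3 := Nat.ceil_lt_add_one hw0
        have h4 := hreg (x - (K * t + ⌈w⌉₊ * g)) y (by nlinarith)
        refine le_trans ?_ h4
        have h5 : y - (x - (K * t + ⌈w⌉₊ * g)) ≤ ε := by nlinarith
        calc Real.exp (-(ρ * ε)) * (L - ε)
            ≤ Real.exp (-(ρ * ε)) * Z (x - (K * t + ⌈w⌉₊ * g)) := by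
              gcongr; linarith
          _ ≤ _ := by
              have := hZ0 (x - (K * t + ⌈w⌉₊ * g))
              gcongr
      · have hk : ⌊w⌋₊ ≤ K := Nat.floor_le_of_le hwK
        have h1 := hx ⌊w⌋₊ (Finset.mem_range.2 (by omega))
        rw [Real.dist_eq, abs_lt] at h1
        have h2 := Nat.floor_le hw0
        have h3 := Nat.lt_floor_add_one w
        have h4 := hreg y (x - (K * t + ⌊w⌋₊ * g)) (by nlinarith)
        have h5 : (x - (K * t + ⌊w⌋₊ * g)) - y ≤ ε := by nlinarith
        have h6 : Real.exp (-(ρ * ε)) * Z y ≤ L + ε := by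
          calc Real.exp (-(ρ * ε)) * Z y
              ≤ Real.exp (-(ρ * ((x - (K * t + ⌊w⌋₊ * g)) - y))) * Z y := by
                have := hZ0 y
                gcongr
            _ ≤ L + ε := by linarith
        calc Z y = Real.exp (ρ * ε) * (Real.exp (-(ρ * ε)) * Z y) := by
              rw [← mul_assoc, ← Real.exp_add]; simp
          _ ≤ _ := by gcongr
    have hconst : ∀ (c x : ℝ) i, ∫ _u in (x - a i)..x, c = c * a i := by
      intro c x i
      rw [intervalIntegral.integral_const, smul_eq_mul]; ring
    constructor
    · refine ge_of_tendsto hΦ' ?_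
      filter_upwards [hbd] with x hx
      rw [Finset.mul_sum]
      refine Finset.sum_le_sum fun i _ => ?_
      rw [mul_left_comm]
      refine mul_le_mul_of_nonneg_left ?_ (hp i).le
      rw [← hconst _ (x - K * t) i]
      refine intervalIntegral.integral_mono_on (by linarith [ha i]) (by simp) (hint _ _) ?_
      intro y hy
      exact (hx y ⟨by linarith [hy.1, haK i], hy.2⟩).1
    · refine le_of_tendsto hΦ' ?_
      filter_upwards [hbd] with x hx
      rw [Finset.mul_sum]
      refine Finset.sum_le_sum fun i _ => ?_
      rw [mul_left_comm (Real.exp (ρ * ε) * (L + ε))]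
      refine mul_le_mul_of_nonneg_left ?_ (hp i).le
      rw [← hconst _ (x - K * t) i]
      refine intervalIntegral.integral_mono_on (by linarith [ha i]) (hint _ _) (by simp) ?_
      intro y hy
      exact (hx y ⟨by linarith [hy.1, haK i], hy.2⟩).2
  have hself : ∀ᶠ ε : ℝ in nhdsWithin 0 (Set.Ioi 0), 0 < ε := self_mem_nhdsWithin
  apply le_antisymm
  · have h : Tendsto (fun ε => Real.exp (-(ρ * ε)) * (L - ε) * ∑ i, p i * a i)
        (nhdsWithin 0 (Set.Ioi 0)) (nhds (L * ∑ i, p i * a i)) := by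
      have : Continuous (fun ε => Real.exp (-(ρ * ε)) * (L - ε) * ∑ i, p i * a i) := by fun_prop
      simpa using (this.tendsto 0).mono_left nhdsWithin_le_nhds
    exact le_of_tendsto h (hself.mono fun ε hε => (key ε hε).1)
  · have h : Tendsto (fun ε => Real.exp (ρ * ε) * (L + ε) * ∑ i, p i * a i)
        (nhdsWithin 0 (Set.Ioi 0)) (nhds (L * ∑ i, p i * a i)) := by
      have : Continuous (fun ε => Real.exp (ρ * ε) * (L + ε) * ∑ i, p i * a i) := by fun_prop
      simpa using (this.tendsto 0).mono_left nhdsWithin_le_nhds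
    exact ge_of_tendsto h (hself.mono fun ε hε => (key ε hε).2)

/-- The integrated renewal identity. -/
lemma renewal_integral {ι : Type*} [Fintype ι] (a p : ι → ℝ) (ha : ∀ i, 0 < a i)
    (hs : ∑ i, p i = 1) (ρ : ℝ) (hρ : 0 < ρ) (Z : ℝ → ℝ)
    (hneg : ∀ x < 0, Z x = 0)
    (hint : ∀ u v, IntervalIntegrable Z MeasureTheory.volume u v)
    (hZ : ∀ x, 0 ≤ x → Z x = Real.exp (-(ρ * x)) + ∑ i, p i * Z (x - a i)) (x : ℝ) (hx : 0 ≤ x) :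
    ∑ i, p i * ∫ t in (x - a i)..x, Z t = (1 - Real.exp (-(ρ * x))) / ρ := by
  have hE : ∫ t in (0 : ℝ)..x, Real.exp (-(ρ * t)) = (1 - Real.exp (-(ρ * x))) / ρ := by
    have : ∀ t ∈ Set.uIcc 0 x, HasDerivAt (fun t => -Real.exp (-(ρ * t)) / ρ)
        (Real.exp (-(ρ * t))) t := by
      intro t _
      have h := (((hasDerivAt_id t).const_mul ρ).neg.exp.neg).div_const ρ
      refine HasDerivAt.congr_deriv (f := fun t => -Real.exp (-(ρ * t)) / ρ) h ?_
      simp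
      field_simp
    rw [intervalIntegral.integral_eq_sub_of_hasDerivAt this
      (Continuous.intervalIntegrable (by fun_prop) _ _)]
    simp; ring
  have hzero : ∀ i, ∫ t in (-a i)..0, Z t = 0 := by
    intro i
    apply intervalIntegral.integral_zero_ae
    filter_upwards [MeasureTheory.Measure.ae_ne MeasureTheory.volume (0 : ℝ)] with t ht h
    rw [Set.uIoc_of_le (by linarith [ha i])] at h
    exact hneg t (lt_of_le_of_ne h.2 ht)
  have hshift : ∀ i, ∫ t in (0 : ℝ)..x, Z (t - a i) =
      (∫ t in (0 : ℝ)..x, Z t) - ∫ t in (x - a i)..x, Z t := by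
    intro i
    rw [intervalIntegral.integral_comp_sub_right, zero_sub]
    have h1 := intervalIntegral.integral_add_adjacent_intervals (hint (-a i) 0) (hint 0 x)
    have h2 := intervalIntegral.integral_add_adjacent_intervals (hint (-a i) (x - a i))
      (hint (x - a i) x)
    rw [hzero] at h1
    linarith
  have hsint : ∀ i, IntervalIntegrable (fun t => p i * Z (t - a i)) MeasureTheory.volume 0 x := by
    intro i
    have := (hint (0 - a i) (x - a i)).comp_sub_right (a i)
    simpa using this.const_mul (p i)
  have hI : ∫ t in (0 : ℝ)..x, Z t = (∫ t in (0 : ℝ)..x, Real.exp (-(ρ * t))) +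
      ∑ i, p i * ∫ t in (0 : ℝ)..x, Z (t - a i) := by
    have : ∫ t in (0 : ℝ)..x, Z t =
        ∫ t in (0 : ℝ)..x, (Real.exp (-(ρ * t)) + ∑ i, p i * Z (t - a i)) := by
      apply intervalIntegral.integral_congr
      intro t ht
      rw [Set.uIcc_of_le hx] at ht
      exact hZ t ht.1
    rw [this, intervalIntegral.integral_add (Continuous.intervalIntegrable (by fun_prop) _ _)
      (by simpa [Finset.sum_fn] using IntervalIntegrable.sum Finset.univ (fun i _ => hsint i)),
      intervalIntegral.integral_finsetSum (fun i _ => hsint i)]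
    simp only [intervalIntegral.integral_const_mul]
  simp only [hshift, mul_sub, Finset.sum_sub_distrib, ← Finset.sum_mul, hs, one_mul, hE] at hI
  linarith

/-- The renewal theorem in the form we need. -/
lemma renewal_main {ι : Type*} [Fintype ι] [Nonempty ι] (a p : ι → ℝ) (ha : ∀ i, 0 < a i)
    (hp : ∀ i, 0 < p i) (hs : ∑ i, p i = 1) (ρ : ℝ) (hρ : 0 < ρ) (Z : ℝ → ℝ)
    (hZ0 : ∀ x, 0 ≤ Z x)
    (hreg : ∀ u y, u ≤ y → Real.exp (-(ρ * (y - u))) * Z u ≤ Z y)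
    (hint : ∀ u v, IntervalIntegrable Z MeasureTheory.volume u v)
    (hneg : ∀ x < 0, Z x = 0)
    (hZ : ∀ x, Z x = (if 0 ≤ x then Real.exp (-(ρ * x)) else 0) + ∑ i, p i * Z (x - a i))
    (hdense : Dense (AddSubgroup.closure (Set.range a) : Set ℝ)) :
    Tendsto Z atTop (nhds (1 / (ρ * ∑ i, p i * a i))) := by
  have hμ : 0 < ∑ i, p i * a i :=
    Finset.sum_pos (fun i _ => mul_pos (hp i) (ha i)) Finset.univ_nonempty
  have hexp : Tendsto (fun x : ℝ => Real.exp (-(ρ * x))) atTop (nhds 0) :=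
    Real.tendsto_exp_neg_atTop_nhds_zero.comp (tendsto_id.const_mul_atTop hρ)
  have hz : Tendsto (fun x : ℝ => if 0 ≤ x then Real.exp (-(ρ * x)) else 0) atTop (nhds 0) := by
    refine hexp.congr' ?_
    filter_upwards [eventually_ge_atTop 0] with x hx
    simp [hx]
  have hid := renewal_integral a p ha hs ρ hρ Z hneg hint
    (fun x hx => by have := hZ x; rwa [if_pos hx] at this)
  have hΦ : Tendsto (fun x => ∑ i, p i * ∫ t in (x - a i)..x, Z t) atTop (nhds (1 / ρ)) := by
    have : Tendsto (fun x : ℝ => (1 - Real.exp (-(ρ * x))) / ρ) atTop (nhds ((1 - 0) / ρ)) :=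
      (hexp.const_sub 1).div_const ρ
    rw [sub_zero] at this
    refine this.congr' ?_
    filter_upwards [eventually_ge_atTop 0] with x hx
    exact (hid x hx).symm
  obtain ⟨i0⟩ := ‹Nonempty ι›
  have hbound : ∃ M, ∀ x, |Z x| ≤ M := by
    refine ⟨1 / ρ / (p i0 * a i0 * Real.exp (-(ρ * a i0))), fun x => ?_⟩
    have hpos : 0 < p i0 * a i0 * Real.exp (-(ρ * a i0)) :=
      mul_pos (mul_pos (hp i0) (ha i0)) (Real.exp_pos _)
    rw [abs_of_nonneg (hZ0 x)]
    rcases lt_or_ge x 0 with hx | hx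
    · rw [hneg x hx]; positivity
    rw [le_div_iff₀ hpos]
    have h1 := hid (x + a i0) (by linarith [ha i0])
    have h2 : p i0 * ∫ t in (x + a i0 - a i0)..(x + a i0), Z t ≤
        ∑ i, p i * ∫ t in (x + a i0 - a i)..(x + a i0), Z t :=
      Finset.single_le_sum (f := fun i => p i * ∫ t in (x + a i0 - a i)..(x + a i0), Z t)
        (fun i _ => mul_nonneg (hp i).le
          (intervalIntegral.integral_nonneg (by linarith [ha i]) fun t _ => hZ0 t))
        (Finset.mem_univ i0)
    have h3 : (1 - Real.exp (-(ρ * (x + a i0)))) / ρ ≤ 1 / ρ := by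
      gcongr; linarith [Real.exp_pos (-(ρ * (x + a i0)))]
    have h4 : a i0 * (Real.exp (-(ρ * a i0)) * Z x) ≤
        ∫ t in (x + a i0 - a i0)..(x + a i0), Z t := by
      have : ∫ _t in (x + a i0 - a i0)..(x + a i0), (Real.exp (-(ρ * a i0)) * Z x) =
          a i0 * (Real.exp (-(ρ * a i0)) * Z x) := by
        rw [intervalIntegral.integral_const, smul_eq_mul]; ring
      rw [← this]
      refine intervalIntegral.integral_mono_on (by linarith [ha i0]) (by simp) (hint _ _) ?_
      intro t ht
      refine le_trans ?_ (hreg x t (by linarith [ht.1]))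
      have := hZ0 x
      have : t - x ≤ a i0 := by linarith [ht.2]
      gcongr
    have h5 := mul_le_mul_of_nonneg_left h4 (hp i0).le
    calc Z x * (p i0 * a i0 * Real.exp (-(ρ * a i0)))
        = p i0 * (a i0 * (Real.exp (-(ρ * a i0)) * Z x)) := by ring
      _ ≤ 1 / ρ := by linarith
  obtain ⟨M, hM⟩ := hbound
  have hc : ∀ L, L * ∑ i, p i * a i = 1 / ρ → L = 1 / (ρ * ∑ i, p i * a i) := by
    intro L h
    field_simp at h ⊢
    linarith
  obtain ⟨L, hL, F, hFn, hF, hT⟩ := exists_limsup_filter Z M hM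
  obtain ⟨L', hL', F', hFn', hF', hT'⟩ := exists_limsup_filter (fun x => -Z x) M
    (fun x => by simpa using hM x)
  have e1 := hc _ (renewal_limit a p ha hp ρ hρ Z hZ0 hreg hint hΦ hdense F hF L fun s hsm =>
    renewal_semigroup a p hp hs Z _ hz hZ L hL s hsm F hF hT)
  have e2 := hc _ (renewal_limit a p ha hp ρ hρ Z hZ0 hreg hint hΦ hdense F' hF' (-L')
    fun s hsm => by
      have := renewal_semigroup a p hp hs (fun x => -Z x) _ (by simpa using hz.neg)
        (fun x => by
          have h := hZ x
          simp only [mul_neg, Finset.sum_neg_distrib]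
          rw [h, neg_add]) L' hL' s hsm F' hF' hT'
      simpa using this.neg)
  rw [← e1] at e2 ⊢
  rw [Metric.tendsto_nhds]
  intro ε hε
  filter_upwards [hL (ε / 2) (by linarith), hL' (ε / 2) (by linarith)] with x h1 h2
  rw [Real.dist_eq, abs_lt]
  constructor <;> linarith

/-- in the acyclic case, the number of words (elements of `List (Fin r)`,
with weight the product of the `d i`) of weight at most `X` is asymptotic to
`X ^ ρ / (ρ * ∑ i, d i ^ (-ρ) * log (d i))`. -/
theorem stmt_4 (r : ℕ) (hr : 2 ≤ r) (d : Fin r → ℕ) (hd : ∀ i, 2 ≤ d i)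
    (hacyclic : ¬ IsCyclicTuple r d)
    (ρ : ℝ) (hρ : 0 < ρ) (hsum : ∑ i, (d i : ℝ) ^ (-ρ) = 1) :
    Tendsto (fun X : ℝ =>
        (Nat.card {ω : List (Fin r) // ((ω.map d).prod : ℝ) ≤ X} : ℝ) / X ^ ρ)
      atTop (nhds (1 / (ρ * ∑ i, (d i : ℝ) ^ (-ρ) * Real.log (d i)))) := by
  have hd2 : ∀ i, (2 : ℝ) ≤ d i := fun i => by exact_mod_cast hd i
  have hpos : ∀ i, (0 : ℝ) < d i := fun i => by linarith [hd2 i]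
  have : Nonempty (Fin r) := ⟨⟨0, by omega⟩⟩
  have hmono : Monotone fun x : ℝ => (wordCount r d (Real.exp x) : ℝ) := by
    intro x y h
    exact Nat.cast_le.2 <| wordCount_mono r d hd (Real.exp_le_exp.2 h)
  have main := renewal_main (fun i => Real.log (d i)) (fun i => (d i : ℝ) ^ (-ρ))
    (fun i => Real.log_pos (by linarith [hd2 i])) (fun i => Real.rpow_pos_of_pos (hpos i) _)
    hsum ρ hρ (fun x => Real.exp (-(ρ * x)) * wordCount r d (Real.exp x))
    (fun x => by positivity)
    (by
      intro u y h
      rw [← mul_assoc, ← Real.exp_add]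
      rw [show -(ρ * (y - u)) + -(ρ * u) = -(ρ * y) by ring]
      exact mul_le_mul_of_nonneg_left (hmono h) (Real.exp_pos _).le)
    (by
      intro u v
      exact hmono.intervalIntegrable.continuousOn_mul (by fun_prop))
    (by
      intro x hx
      simp [wordCount_zero r d hd (Real.exp x) (by simpa using hx)])
    (by
      intro x
      rw [wordCount_rec r d hd]
      push_cast
      rw [mul_add, Finset.mul_sum]
      congr 1
      · simp
      · refine Finset.sum_congr rfl fun i _ => ?_
        rw [Real.exp_sub, Real.exp_log (hpos i), ← mul_assoc, Real.rpow_def_of_pos (hpos i),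
          ← Real.exp_add]
        congr 2
        ring)
    (acyclic_dense r d hd hacyclic)
  refine (main.comp Real.tendsto_log_atTop).congr' ?_
  filter_upwards [eventually_gt_atTop 0] with X hX
  simp only [Function.comp, Real.exp_log hX, wordCount]
  rw [Real.rpow_def_of_pos hX, Real.exp_neg, mul_comm ρ, div_eq_inv_mul]
end

section
/- Let d_1,…,d_r be integers each at least 2 such that log(d_i)/log(d_j) is rational for all i, j. Then there exist a positive integer d and positive integers n_1,…,n_r such that d_i = d^{n_i} for all i. -/
theorem pair_pow {a b : ℕ} (ha : 2 ≤ a) (hb : 2 ≤ b)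
    (h : ∃ q : ℚ, Real.log a / Real.log b = (q : ℝ)) :
    ∃ m n : ℕ, 0 < m ∧ 0 < n ∧ a ^ m = b ^ n := by
  obtain ⟨q, hq⟩ := h
  have hla : 0 < Real.log a := Real.log_pos (by exact_mod_cast ha)
  have hlb : 0 < Real.log b := Real.log_pos (by exact_mod_cast hb)
  have hq0 : 0 < q := by
    have : (0 : ℝ) < q := hq ▸ div_pos hla hlb
    exact_mod_cast this
  have hnum : 0 < q.num := Rat.num_pos.2 hq0
  have hcast : ((q.num.toNat : ℕ) : ℝ) = (q.num : ℝ) := by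
    exact_mod_cast congrArg (Int.cast : ℤ → ℝ) (Int.toNat_of_nonneg hnum.le)
  refine ⟨q.den, q.num.toNat, q.den_pos, by omega, ?_⟩
  have hden : (q.den : ℝ) ≠ 0 := by exact_mod_cast q.den_nz
  rw [Rat.cast_def, div_eq_div_iff hlb.ne' hden] at hq
  have key : Real.log ((a : ℝ) ^ q.den) = Real.log ((b : ℝ) ^ q.num.toNat) := by
    rw [Real.log_pow, Real.log_pow, hcast]; linarith
  have ha' : (0 : ℝ) < a := by exact_mod_cast (by omega : 0 < a)
  have hb' : (0 : ℝ) < b := by exact_mod_cast (by omega : 0 < b)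
  have := Real.log_injOn_pos (Set.mem_Ioi.2 (pow_pos ha' _)) (Set.mem_Ioi.2 (pow_pos hb' _)) key
  exact_mod_cast this

theorem common_base (r : ℕ) (d : Fin (r + 1) → ℕ) (hd : ∀ i, 2 ≤ d i)
    (h : ∀ i j, ∃ m n : ℕ, 0 < m ∧ 0 < n ∧ d i ^ m = d j ^ n) :
    ∃ b : ℕ, 0 < b ∧ ∃ n : Fin (r + 1) → ℕ, ∀ i, 0 < n i ∧ d i = b ^ n i := by
  induction r with
  | zero =>
    refine ⟨d 0, by have := hd 0; omega, fun _ => 1, fun i => ?_⟩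
    have hi : i = 0 := by ext; omega
    subst hi; simp
  | succ r ih =>
    obtain ⟨b, hb, n, hn⟩ := ih (fun i => d i.castSucc) (fun i => hd _) (fun i j => h _ _)
    obtain ⟨m, k, hm, hk, e⟩ := h (Fin.last _) (Fin.castSucc 0)
    have h0 := hn 0
    rw [h0.2, ← pow_mul] at e
    obtain ⟨c, h1, h2⟩ := Nat.exists_eq_pow_of_pow_eq_pow (Or.inl hm.ne') e
    generalize n 0 * k / Nat.gcd m (n 0 * k) = x at h1
    generalize m / Nat.gcd m (n 0 * k) = y at h2
    have hx : 0 < x := by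
      rcases Nat.eq_zero_or_pos x with rfl | hx
      · have := hd (Fin.last _); rw [h1] at this; simp at this
      · exact hx
    have hy : 0 < y := by
      rcases Nat.eq_zero_or_pos y with rfl | hy
      · have := hd (Fin.castSucc 0); rw [h0.2, h2] at this; simp at this
      · exact hy
    have hc : 0 < c := by
      rcases Nat.eq_zero_or_pos c with rfl | hc
      · rw [zero_pow hy.ne'] at h2; omega
      · exact hc
    refine ⟨c, hc, Fin.lastCases x (fun i => y * n i), fun i => ?_⟩
    induction i using Fin.lastCases with
    | last => simpa using ⟨hx, h1⟩
    | cast i =>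
      have := hn i
      simp only [Fin.lastCases_castSucc]
      exact ⟨Nat.mul_pos hy this.1, by rw [pow_mul, ← h2]; exact this.2⟩

/-- if `log (d i) / log (d j)` is rational for all `i, j`, where each
`d i ≥ 2`, then all the `d i` are positive powers of a single positive integer. -/
theorem stmt_6 (r : ℕ) (d : Fin r → ℕ) (hd : ∀ i, 2 ≤ d i)
    (hrat : ∀ i j, ∃ q : ℚ, Real.log (d i) / Real.log (d j) = (q : ℝ)) :
    ∃ b : ℕ, 0 < b ∧ ∃ n : Fin r → ℕ, ∀ i, 0 < n i ∧ d i = b ^ n i := by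
  cases r with
  | zero => exact ⟨1, one_pos, fun _ => 1, fun i => i.elim0⟩
  | succ r => exact common_base r d hd fun i j => pair_pow (hd i) (hd j) (hrat i j)
end

section
/- Let r ≥ 2, let a_1,…,a_r be positive integers with gcd(a_1,…,a_r) = 1, and let θ be the unique real number in (0,1) with θ^{a_1}+⋯+θ^{a_r} = 1. For a nonnegative integer L, let N(L) be the number of words ω = i_1⋯i_m in the free monoid on {1,…,r} with a_{i_1}+⋯+a_{i_m} ≤ L (the empty word having additive weight 0). Then there exists a positive constant C such that N(L)·θ^{L} tends to C as L → ∞; that is, N(L) is asymptotic to C·θ^{−L}. -/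
open Filter

theorem persist_aux {r : ℕ} (a : Fin r → ℕ) (ha : ∀ i, 0 < a i) (A : ℕ) (hA : ∀ i, a i ≤ A)
    (p : Fin r → ℝ) (hp : ∀ i, 0 < p i) (hps : ∑ i, p i = 1) (y : ℕ → ℝ)
    (hy : ∀ L, A ≤ L → y L = ∑ i, p i * y (L - a i)) (t : ℕ) (c : ℝ)
    (hc : ∀ L, t ≤ L → L < t + A → c ≤ y L) : ∀ L, t ≤ L → c ≤ y L := by
  intro L
  induction L using Nat.strong_induction_on with
  | _ L ih =>
    intro hL
    by_cases h : L < t + A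
    · exact hc L hL h
    · rw [hy L (by omega)]
      calc c = ∑ i, p i * c := by rw [← Finset.sum_mul, hps, one_mul]
        _ ≤ _ := by
          apply Finset.sum_le_sum
          intro i _
          have h1 := ha i
          have h2 := hA i
          exact mul_le_mul_of_nonneg_left (ih _ (by omega) (by omega)) (hp i).le

theorem propagate_aux {r : ℕ} (a : Fin r → ℕ) (A : ℕ) (hA : ∀ i, a i ≤ A)
    (p : Fin r → ℝ) (hp : ∀ i, 0 < p i) (hps : ∑ i, p i = 1) (y : ℕ → ℝ)
    (hy : ∀ L, A ≤ L → y L = ∑ i, p i * y (L - a i)) (s : ℕ)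
    (hs : s ∈ AddSubmonoid.closure (Set.range a)) :
    ∃ ε : ℝ, 0 < ε ∧ ∀ (n : ℕ) (c : ℝ) (k : ℕ), (∀ L, n ≤ L → c ≤ y L) → n + A ≤ k →
      ε * (y k - c) ≤ y (k + s) - c := by
  induction hs using AddSubmonoid.closure_induction with
  | mem x hx =>
    obtain ⟨i, rfl⟩ := hx
    refine ⟨p i, hp i, fun n c k hn hk => ?_⟩
    have e : y (k + a i) - c = ∑ j, p j * (y (k + a i - a j) - c) := by
      simp only [mul_sub, Finset.sum_sub_distrib]
      rw [← Finset.sum_mul, hps, one_mul, hy _ (by omega)]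
    rw [e]
    have := Finset.single_le_sum (f := fun j => p j * (y (k + a i - a j) - c))
      (s := Finset.univ) (fun j _ => by
        have := hA j
        exact mul_nonneg (hp j).le (sub_nonneg.2 (hn _ (by omega)))) (Finset.mem_univ i)
    simpa using this
  | zero => exact ⟨1, one_pos, fun n c k hn hk => by simp⟩
  | add s1 s2 _ _ h1 h2 =>
    obtain ⟨e1, he1, h1⟩ := h1
    obtain ⟨e2, he2, h2⟩ := h2
    refine ⟨e2 * e1, mul_pos he2 he1, fun n c k hn hk => ?_⟩
    have := h1 n c k hn hk
    have h3 := h2 n c (k + s1) hn (by omega)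
    rw [← add_assoc, mul_assoc]
    exact (mul_le_mul_of_nonneg_left this he2.le).trans h3

theorem renewal_aux {r : ℕ} (a : Fin r → ℕ) (ha : ∀ i, 0 < a i)
    (hgcd : Finset.univ.gcd a = 1) (A : ℕ) (hA : ∀ i, a i ≤ A)
    (p : Fin r → ℝ) (hp : ∀ i, 0 < p i) (hps : ∑ i, p i = 1) (y : ℕ → ℝ)
    (hy : ∀ L, A ≤ L → y L = ∑ i, p i * y (L - a i)) (hpos : ∀ L, 0 < y L) :
    ∃ C : ℝ, 0 < C ∧ Tendsto y atTop (nhds C) := by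
  -- lower bound
  obtain ⟨b, hb0, hb⟩ : ∃ b : ℝ, 0 < b ∧ ∀ L, b ≤ y L := by
    obtain ⟨k, hk⟩ := (Set.finite_Iic A).exists_minimalFor y _ ⟨0, by simp⟩
    refine ⟨y k, hpos k, fun L => persist_aux a ha A hA p hp hps y hy 0 (y k) ?_ L (by omega)⟩
    intro L _ hL
    by_contra hlt
    exact hlt (hk.2 (show L ∈ Set.Iic A by simp; omega) (not_le.1 hlt).le)
  obtain ⟨B, hB⟩ : ∃ B : ℝ, ∀ L, y L ≤ B := by
    obtain ⟨B, hB⟩ := ((Set.finite_Iic A).image y).bddAbove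
    refine ⟨B, fun L => ?_⟩
    have := persist_aux a ha A hA p hp hps (fun L => - y L)
      (fun L hL => by simp [hy L hL]) 0 (-B) ?_ L (by omega)
    · linarith
    · intro L _ hL
      exact neg_le_neg (hB ⟨L, by simp; omega, rfl⟩)
  have bA : IsBoundedUnder (· ≤ ·) atTop y := isBoundedUnder_of ⟨B, hB⟩
  have bB : IsBoundedUnder (· ≥ ·) atTop y := isBoundedUnder_of ⟨b, hb⟩
  set I := liminf y atTop with hI
  set S := limsup y atTop with hS
  have hIS : I ≤ S := liminf_le_limsup bA bB
  have hbI : b ≤ I := le_liminf_of_le bA.isCoboundedUnder_ge (Eventually.of_forall hb)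
  -- all large integers are representable
  obtain ⟨K, hK⟩ : ∃ K, ∀ s ≥ K, s ∈ AddSubmonoid.closure (Set.range a) := by
    obtain ⟨K, hK⟩ := Nat.exists_mem_closure_of_ge (Set.range a)
    refine ⟨K, fun s hs => hK s hs ?_⟩
    have : Nat.setGcd (Set.range a) ∣ Finset.univ.gcd a :=
      Finset.dvd_gcd fun i _ => Nat.setGcd_dvd_of_mem ⟨i, rfl⟩
    rw [hgcd] at this
    exact this.trans (one_dvd _)
  have hε : ∃ ε : ℝ, 0 < ε ∧ ∀ s, K ≤ s → s < K + A →
      ∀ (n : ℕ) (c : ℝ) (k : ℕ), (∀ L, n ≤ L → c ≤ y L) → n + A ≤ k →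
      ε * (y k - c) ≤ y (k + s) - c := by
    choose! f hf0 hf using fun s (hs : s ≥ K) => propagate_aux a A hA p hp hps y hy s (hK s hs)
    obtain ⟨k, hk⟩ := (Set.finite_Icc K (K + A)).exists_minimalFor f _ ⟨K, by simp⟩
    refine ⟨f k, hf0 k hk.1.1, fun s h1 h2 n c q hn hq => ?_⟩
    refine le_trans (mul_le_mul_of_nonneg_right ?_ (sub_nonneg.2 (hn _ (by omega)))) (hf s h1 n c q hn hq)
    rcases le_total (f s) (f k) with h | h
    · exact hk.2 (show s ∈ Set.Icc K (K + A) from ⟨h1, h2.le⟩) h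
    · exact h
  obtain ⟨ε, hε0, hε⟩ := hε
  have key : ∀ δ : ℝ, 0 < δ → (I - δ) + ε * ((S - δ) - (I - δ)) ≤ I := by
    intro δ hδ
    have h1 : ∀ᶠ L in atTop, I - δ < y L := eventually_lt_of_lt_liminf (by linarith) bB
    obtain ⟨n, hn⟩ := eventually_atTop.1 h1
    have h2 : ∃ᶠ L in atTop, S - δ < y L := frequently_lt_of_lt_limsup bB.isCoboundedUnder_le (by linarith)
    obtain ⟨k, hk, hk2⟩ := frequently_atTop.1 h2 (n + A)
    refine le_liminf_of_le bA.isCoboundedUnder_ge ?_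
    refine eventually_atTop.2 ⟨k + K, ?_⟩
    refine persist_aux a ha A hA p hp hps y hy (k + K) _ ?_
    intro L hL1 hL2
    have h3 := hε (L - k) (by omega) (by omega) n (I - δ) k (fun L hL => (hn L hL).le) hk
    rw [show k + (L - k) = L by omega] at h3
    have := mul_le_mul_of_nonneg_left (show (S - δ) - (I - δ) ≤ y k - (I - δ) by linarith) hε0.le
    linarith
  have hSI : S ≤ I := by
    by_contra hlt
    have hlt := not_le.1 hlt
    have h4 : 0 < ε * (S - I) := mul_pos hε0 (by linarith)
    have := key (ε * (S - I) / 2) (by linarith)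
    have e : (S - ε * (S - I) / 2) - (I - ε * (S - I) / 2) = S - I := by ring
    rw [e] at this
    linarith
  exact ⟨I, by linarith, tendsto_of_liminf_eq_limsup rfl (le_antisymm hSI hIS) bA bB⟩

theorem finite_aux {r : ℕ} (a : Fin r → ℕ) (ha : ∀ i, 0 < a i) (L : ℕ) :
    Finite {ω : List (Fin r) // (ω.map a).sum ≤ L} := by
  have : {ω : List (Fin r) | (ω.map a).sum ≤ L} ⊆ {ω | ω.length ≤ L} := by
    intro ω hω
    have : ω.length ≤ (ω.map a).sum := by
      clear hω
      induction ω with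
      | nil => simp
      | cons i t ih => have := ha i; simp; omega
    exact this.trans hω
  exact ((List.finite_length_le (Fin r) L).subset this).to_subtype

/-- Splitting a word as empty or first letter followed by the rest. -/
def splitEquiv_aux {r : ℕ} (a : Fin r → ℕ) (L : ℕ) (hL : ∀ i, a i ≤ L) :
    {ω : List (Fin r) // (ω.map a).sum ≤ L} ≃
      Option (Σ i : Fin r, {ω : List (Fin r) // (ω.map a).sum ≤ L - a i}) where
  toFun
    | ⟨[], _⟩ => none
    | ⟨i :: t, h⟩ => some ⟨i, t, by simp at h; omega⟩
  invFun
    | none => ⟨[], by simp⟩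
    | some ⟨i, t, h⟩ => ⟨i :: t, by have := hL i; simp; omega⟩
  left_inv := by rintro ⟨_ | ⟨i, t⟩, h⟩ <;> rfl
  right_inv := by rintro (_ | ⟨i, t, h⟩) <;> rfl

theorem rec_aux {r : ℕ} (a : Fin r → ℕ) (ha : ∀ i, 0 < a i) (L : ℕ) (hL : ∀ i, a i ≤ L) :
    Nat.card {ω : List (Fin r) // (ω.map a).sum ≤ L} =
      1 + ∑ i, Nat.card {ω : List (Fin r) // (ω.map a).sum ≤ L - a i} := by
  have := finite_aux a ha
  rw [Nat.card_congr (splitEquiv_aux a L hL), Finite.card_option, Nat.card_sigma, add_comm]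

/-- the number `N L` of words in the free monoid on `{1,…,r}`
(modelled as `List (Fin r)`) of additive weight `(ω.map a).sum` at most `L`
satisfies `N L * θ ^ L → C` for some constant `C > 0`. -/
theorem stmt_8 (r : ℕ) (hr : 2 ≤ r) (a : Fin r → ℕ) (ha : ∀ i, 0 < a i)
    (hgcd : Finset.univ.gcd a = 1)
    (θ : ℝ) (hθ : θ ∈ Set.Ioo (0 : ℝ) 1) (hθsum : ∑ i, θ ^ a i = 1) :
    ∃ C : ℝ, 0 < C ∧
      Tendsto (fun L : ℕ =>
          (Nat.card {ω : List (Fin r) // (ω.map a).sum ≤ L} : ℝ) * θ ^ L)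
        atTop (nhds C) := by
  obtain ⟨h0, h1⟩ := hθ
  have hr' : (0 : ℝ) < r - 1 := by
    have : (2 : ℝ) ≤ r := by exact_mod_cast hr
    linarith
  have hA : ∀ i, a i ≤ ∑ j, a j := fun i =>
    Finset.single_le_sum (f := a) (fun _ _ => Nat.zero_le _) (Finset.mem_univ i)
  obtain ⟨C, hC, hT⟩ := renewal_aux a ha hgcd (∑ j, a j) hA (fun i => θ ^ a i)
    (fun i => pow_pos h0 _) hθsum
    (fun L => ((Nat.card {ω : List (Fin r) // (ω.map a).sum ≤ L} : ℝ) + 1 / (r - 1)) * θ ^ L)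
    (by
      intro L hL
      have hL' : ∀ i, a i ≤ L := fun i => (hA i).trans hL
      have e : ∀ i, θ ^ a i * (((Nat.card {ω : List (Fin r) // (ω.map a).sum ≤ L - a i} : ℝ)
          + 1 / (r - 1)) * θ ^ (L - a i)) =
          ((Nat.card {ω : List (Fin r) // (ω.map a).sum ≤ L - a i} : ℝ) + 1 / (r - 1)) * θ ^ L := by
        intro i
        rw [mul_left_comm, ← pow_add, Nat.add_sub_cancel' (hL' i)]
      simp only [e]
      rw [← Finset.sum_mul, Finset.sum_add_distrib, rec_aux a ha L hL']
      congr 1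
      push_cast
      simp only [Finset.sum_const, Finset.card_univ, Fintype.card_fin, nsmul_eq_mul]
      field_simp
      ring)
    (fun L => by positivity)
  refine ⟨C, hC, ?_⟩
  have hz : Tendsto (fun L : ℕ => 1 / ((r : ℝ) - 1) * θ ^ L) atTop (nhds 0) := by
    simpa using (tendsto_pow_atTop_nhds_zero_of_lt_one h0.le h1).const_mul (1 / ((r : ℝ) - 1))
  have := hT.sub hz
  simp only [sub_zero] at this
  refine this.congr fun L => ?_
  ring
end

section
/- In the abstract polarized setting, for every word ω in the free monoid on {1,…,r} and every P ∈ V, one has |h(eval(ω)(P))/deg(ω) − h(P)| ≤ C_S/(d_S − 1). -/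
/-- Evaluation of a word `ω = i₁⋯iₘ` as the composite `φ i₁ ∘ ⋯ ∘ φ iₘ`;
the empty word evaluates to the identity. -/
def evalWord {V : Type*} {r : ℕ} (φ : Fin r → V → V) : List (Fin r) → V → V
  | [], x => x
  | i :: ω, x => φ i (evalWord φ ω x)

/-- telescoping estimate: in the abstract polarized setting,
`|h(eval ω P) / deg ω - h P| ≤ C_S / (d_S - 1)` for every word `ω` and point `P`. -/
theorem stmt_10 {V : Type*} (r : ℕ) (hr : 2 ≤ r) (φ : Fin r → V → V)
    (h : V → ℝ) (hh : ∀ x, 0 ≤ h x)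
    (d : Fin r → ℝ) (hd : ∀ i, 2 ≤ d i)
    (C : Fin r → ℝ) (hC : ∀ i, 0 ≤ C i)
    (hpol : ∀ i x, |h (φ i x) - d i * h x| ≤ C i)
    (dS CS : ℝ) (hdS : IsLeast (Set.range d) dS) (hCS : IsGreatest (Set.range C) CS)
    (ω : List (Fin r)) (P : V) :
    |h (evalWord φ ω P) / (ω.map d).prod - h P| ≤ CS / (dS - 1) := by
  obtain ⟨⟨i0, hi0⟩, hdl⟩ := hdS
  obtain ⟨⟨j0, hj0⟩, hCl⟩ := hCS
  have h2 : 2 ≤ dS := hi0 ▸ hd i0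
  have hC0 : 0 ≤ CS := hj0 ▸ hC j0
  have hle : ∀ i, dS ≤ d i := fun i => hdl ⟨i, rfl⟩
  have hCle : ∀ i, C i ≤ CS := fun i => hCl ⟨i, rfl⟩
  obtain ⟨B, hB⟩ : ∃ B, B = CS / (dS - 1) := ⟨_, rfl⟩
  rw [← hB]
  have hB0 : 0 ≤ B := by rw [hB]; exact div_nonneg hC0 (by linarith)
  have hBC : B * (dS - 1) = CS := by
    rw [hB]; exact div_mul_cancel₀ _ (by linarith)
  have key : 1 ≤ (ω.map d).prod ∧
      |h (evalWord φ ω P) - (ω.map d).prod * h P| ≤ B * ((ω.map d).prod - 1) := by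
    induction ω with
    | nil => simp [evalWord]
    | cons i ω ih =>
      obtain ⟨h1, ih⟩ := ih
      simp only [List.map_cons, List.prod_cons, evalWord]
      generalize (ω.map d).prod = D at *
      have hdi := hd i
      refine ⟨by nlinarith, ?_⟩
      have hp := abs_le.1 (hpol i (evalWord φ ω P))
      have hb : C i ≤ B * (d i - 1) := by
        have := mul_le_mul_of_nonneg_left (hle i) hB0
        linarith [hCle i]
      have ih' := abs_le.1 ih
      have e1 := mul_le_mul_of_nonneg_left ih'.1 (show 0 ≤ d i by linarith)
      have e2 := mul_le_mul_of_nonneg_left ih'.2 (show 0 ≤ d i by linarith)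
      rw [abs_le]
      constructor <;> nlinarith [hp.1, hp.2]
  obtain ⟨h1, hk⟩ := key
  have hpos : 0 < (ω.map d).prod := by linarith
  have e : h (evalWord φ ω P) / (ω.map d).prod - h P
      = (h (evalWord φ ω P) - (ω.map d).prod * h P) / (ω.map d).prod := by
    field_simp
  rw [e, abs_div, abs_of_pos hpos, div_le_iff₀ hpos]
  linarith
end

section
/- In the abstract polarized setting, suppose P ∈ V is preperiodic, i.e. there exist a nonempty word u and a (possibly empty) word v in the free monoid on {1,…,r} such that eval(u)(eval(v)(P)) = eval(v)(P). Then h(P) ≤ 2·C_S/(d_S − 1). -/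
/-- A point of height above `b` strictly gains height under every map, so also under words. -/
theorem evalWord_height_mono {V : Type*} {r : ℕ} (φ : Fin r → V → V) (h : V → ℝ) (b : ℝ)
    (H : ∀ i x, b < h x → h x < h (φ i x)) (x : V) (hx : b < h x) (w : List (Fin r)) :
    h x ≤ h (evalWord φ w x) ∧ (w ≠ [] → h x < h (evalWord φ w x)) := by
  induction w with
  | nil => simp [evalWord]
  | cons i w ih =>
    have h1 := H i (evalWord φ w x) (lt_of_lt_of_le hx ih.1)
    have h2 : h x < h (evalWord φ (i :: w) x) := lt_of_le_of_lt ih.1 h1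
    exact ⟨h2.le, fun _ => h2⟩

/-- in the abstract polarized setting, a preperiodic point has height
at most `2 C_S / (d_S - 1)`. -/
theorem stmt_11 {V : Type*} (r : ℕ) (hr : 2 ≤ r) (φ : Fin r → V → V)
    (h : V → ℝ) (hh : ∀ x, 0 ≤ h x)
    (d : Fin r → ℝ) (hd : ∀ i, 2 ≤ d i)
    (C : Fin r → ℝ) (hC : ∀ i, 0 ≤ C i)
    (hpol : ∀ i x, |h (φ i x) - d i * h x| ≤ C i)
    (dS CS : ℝ) (hdS : IsLeast (Set.range d) dS) (hCS : IsGreatest (Set.range C) CS)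
    (P : V)
    (hpre : ∃ u v : List (Fin r), u ≠ [] ∧
      evalWord φ u (evalWord φ v P) = evalWord φ v P) :
    h P ≤ 2 * CS / (dS - 1) := by
  obtain ⟨u, v, hu, huv⟩ := hpre
  have hdS2 : 2 ≤ dS := by
    obtain ⟨i, hi⟩ := hdS.1
    exact hi ▸ hd i
  have hCS0 : 0 ≤ CS := by
    obtain ⟨i, hi⟩ := hCS.1
    exact hi ▸ hC i
  have hpos : 0 < dS - 1 := by linarith
  have H : ∀ i x, CS / (dS - 1) < h x → h x < h (φ i x) := by
    intro i x hx
    rw [div_lt_iff₀ hpos] at hx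
    have h1 := (abs_le.mp (hpol i x)).1
    have h2 : dS ≤ d i := hdS.2 ⟨i, rfl⟩
    have h3 : C i ≤ CS := hCS.2 ⟨i, rfl⟩
    have h4 := mul_le_mul_of_nonneg_right h2 (hh x)
    linarith
  have hb : 0 ≤ CS / (dS - 1) := div_nonneg hCS0 hpos.le
  rw [mul_div_assoc]
  by_contra hcon
  have hP : CS / (dS - 1) < h P := by linarith
  have h1 := (evalWord_height_mono φ h _ H P hP v).1
  have h2 := (evalWord_height_mono φ h _ H _ (lt_of_lt_of_le hP h1) u).2 hu
  rw [huv] at h2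
  exact lt_irrefl _ h2
end

section
/- In the abstract polarized setting, suppose the Northcott property holds at P ∈ V and P is not preperiodic. Then for every real B > 0 there exists a natural number N such that h(eval(ω)(P)) > B for every word ω of length greater than N. -/
/-- The semigroup orbit of `P`: images of `P` under all nonempty words. -/
def orbS {V : Type*} {r : ℕ} (φ : Fin r → V → V) (P : V) : Set V :=
  {Q | ∃ ω : List (Fin r), ω ≠ [] ∧ evalWord φ ω P = Q}

theorem evalWord_append_aux {V : Type*} {r : ℕ} (φ : Fin r → V → V) (a b : List (Fin r)) (x : V) :
    evalWord φ (a ++ b) x = evalWord φ a (evalWord φ b x) := by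
  induction a with
  | nil => rfl
  | cons i a ih => simp only [List.cons_append, evalWord, ih]

/-- in the abstract polarized setting, if the Northcott property holds
at a non-preperiodic point `P`, then for every `B > 0` all sufficiently long words
send `P` to a point of height greater than `B`. -/
theorem stmt_13 {V : Type*} (r : ℕ) (hr : 2 ≤ r) (φ : Fin r → V → V)
    (h : V → ℝ) (hh : ∀ x, 0 ≤ h x)
    (d : Fin r → ℝ) (hd : ∀ i, 2 ≤ d i)
    (C : Fin r → ℝ) (hC : ∀ i, 0 ≤ C i)
    (hpol : ∀ i x, |h (φ i x) - d i * h x| ≤ C i)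
    (P : V)
    (hNorth : ∀ B : ℝ, {Q : V | Q ∈ orbS φ P ∧ h Q ≤ B}.Finite)
    (hnotpre : ¬ ∃ u v : List (Fin r), u ≠ [] ∧
      evalWord φ u (evalWord φ v P) = evalWord φ v P) :
    ∀ B : ℝ, 0 < B → ∃ N : ℕ, ∀ ω : List (Fin r), N < ω.length →
      B < h (evalWord φ ω P) := by
  intro B hB
  set M : ℝ := B + ∑ i, C i with hM
  have hCM : ∀ i, C i ≤ M := by
    intro i
    have := Finset.single_le_sum (f := C) (fun i _ => hC i) (Finset.mem_univ i)
    linarith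
  have hBM : B ≤ M := by
    have := Finset.sum_nonneg (s := Finset.univ) (f := C) (fun i _ => hC i)
    linarith
  have key : ∀ (a : List (Fin r)) (x : V), h (evalWord φ a x) ≤ M → h x ≤ M := by
    intro a x
    induction a with
    | nil => exact fun hx => hx
    | cons i a ih =>
      intro hx
      apply ih
      by_contra hlt
      push Not at hlt
      have h1 := (abs_le.mp (hpol i (evalWord φ a x))).1
      have h2 := mul_le_mul_of_nonneg_right (hd i) (hh (evalWord φ a x))
      have h3 := hCM i
      simp only [evalWord] at hx
      linarith
  refine ⟨(hNorth M).toFinset.card, fun ω hω => ?_⟩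
  by_contra hle
  push Not at hle
  have hmaps : ∀ k ∈ Finset.range ω.length,
      evalWord φ (ω.drop k) P ∈ (hNorth M).toFinset := by
    intro k hk
    rw [Finset.mem_range] at hk
    rw [Set.Finite.mem_toFinset]
    refine ⟨⟨ω.drop k, ?_, rfl⟩, ?_⟩
    · intro h0
      rw [List.drop_eq_nil_iff] at h0
      omega
    · apply key (ω.take k)
      rw [← evalWord_append_aux, List.take_append_drop]
      linarith
  have hne : ∀ j k, j < k → k < ω.length →
      evalWord φ (ω.drop j) P ≠ evalWord φ (ω.drop k) P := by
    intro j k hjk hk heq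
    apply hnotpre
    refine ⟨(ω.drop j).take (k - j), ω.drop k, ?_, ?_⟩
    · intro h0
      have := congrArg List.length h0
      simp only [List.length_take, List.length_drop, List.length_nil] at this
      omega
    · rw [← evalWord_append_aux]
      have : ω.drop k = (ω.drop j).drop (k - j) := by
        rw [List.drop_drop]
        congr 1
        omega
      conv_lhs => rw [this, List.take_append_drop]
      exact heq
  obtain ⟨j, hj, k, hk, hjk, heq⟩ := Finset.exists_ne_map_eq_of_card_lt_of_maps_to
    (by rw [Finset.card_range]; exact hω) hmaps
  rw [Finset.mem_range] at hj hk
  rcases lt_or_gt_of_ne hjk with hlt | hlt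
  · exact hne j k hlt hk heq
  · exact hne k j hlt hj heq.symm
end

section
/- In the abstract polarized setting, let ρ be the unique positive real with d_1^{−ρ}+⋯+d_r^{−ρ} = 1, and suppose P ∈ V satisfies h(P) > 2·C_S. Then there exists a real number β > 0 such that the sequence β_n := ∑_{ω of length n} h(eval(ω)(P))^{−ρ}, where the sum is over all words of length n in the free monoid on {1,…,r}, converges to β as n → ∞. -/
open Filter

lemma step_bound {a b c e ρ : ℝ} (ha : 0 < a) (he0 : 0 ≤ e) (he : e ≤ 1 / 2) (hρ : 0 < ρ)
    (hc : c ≤ e * a) (hab : |b - a| ≤ c) :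
    0 < b ∧ Real.exp (-(2 * e * ρ)) * a ^ (-ρ) ≤ b ^ (-ρ) ∧
      b ^ (-ρ) ≤ Real.exp (2 * e * ρ) * a ^ (-ρ) := by
  obtain ⟨h1, h2⟩ := abs_le.mp hab
  have e1 : 1 + 2 * e ≤ Real.exp (2 * e) := by
    have := Real.add_one_le_exp (2 * e); linarith
  have hlo : Real.exp (-(2 * e)) ≤ 1 - e := by
    rw [Real.exp_neg]
    apply inv_le_of_inv_le₀ (by linarith)
    refine le_trans ?_ e1
    rw [inv_le_iff_one_le_mul₀ (by linarith)]
    nlinarith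
  have hbl : Real.exp (-(2 * e)) * a ≤ b := by nlinarith
  have hbu : b ≤ Real.exp (2 * e) * a := by nlinarith
  have hb : 0 < b := lt_of_lt_of_le (by positivity) hbl
  refine ⟨hb, ?_, ?_⟩
  · have := Real.rpow_le_rpow_of_nonpos hb hbu (by linarith : -ρ ≤ 0)
    rw [Real.mul_rpow (Real.exp_pos _).le ha.le, ← Real.exp_mul] at this
    convert this using 3
    ring
  · have := Real.rpow_le_rpow_of_nonpos (by positivity) hbl (by linarith : -ρ ≤ 0)
    rw [Real.mul_rpow (Real.exp_pos _).le ha.le, ← Real.exp_mul] at this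
    convert this using 3
    ring

lemma sum_succ_words {r n : ℕ} (F : List (Fin r) → ℝ) :
    ∑ f : Fin (n + 1) → Fin r, F (List.ofFn f)
      = ∑ f : Fin n → Fin r, ∑ i, F (i :: List.ofFn f) := by
  rw [← (Fin.consEquiv (fun _ : Fin (n + 1) => Fin r)).sum_comp, Fintype.sum_prod_type,
    Finset.sum_comm]
  simp [Fin.consEquiv, List.ofFn_succ]

/-- in the abstract polarized setting, if `h P > 2 C_S` then the sums
`β_n = ∑_{|ω| = n} h(eval ω P)^{-ρ}` (over words of length `n`, encoded as tuples
`Fin n → Fin r`) converge to a positive limit. -/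
theorem stmt_14 {V : Type*} (r : ℕ) (hr : 2 ≤ r) (φ : Fin r → V → V)
    (h : V → ℝ) (hh : ∀ x, 0 ≤ h x)
    (d : Fin r → ℝ) (hd : ∀ i, 2 ≤ d i)
    (C : Fin r → ℝ) (hC : ∀ i, 0 ≤ C i)
    (hpol : ∀ i x, |h (φ i x) - d i * h x| ≤ C i)
    (dS CS : ℝ) (hdS : IsLeast (Set.range d) dS) (hCS : IsGreatest (Set.range C) CS)
    (ρ : ℝ) (hρ : 0 < ρ) (hsum : ∑ i, d i ^ (-ρ) = 1)
    (P : V) (hP : 2 * CS < h P) :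
    ∃ β : ℝ, 0 < β ∧
      Tendsto (fun n : ℕ =>
          ∑ f : Fin n → Fin r, h (evalWord φ (List.ofFn f) P) ^ (-ρ))
        atTop (nhds β) := by
  have hCle : ∀ i, C i ≤ CS := fun i => hCS.2 ⟨i, rfl⟩
  have hCS0 : 0 ≤ CS := by obtain ⟨i, hi⟩ := hCS.1; rw [← hi]; exact hC i
  obtain ⟨K, hK⟩ : ∃ K, K = h P - CS := ⟨_, rfl⟩
  have hKC : CS < K := by linarith
  have hgrow : ∀ ω : List (Fin r), 2 ^ ω.length * K + CS ≤ h (evalWord φ ω P) := by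
    intro ω
    induction ω with
    | nil => simp [evalWord, hK]
    | cons i ω ih =>
      have h1 := (abs_le.mp (hpol i (evalWord φ ω P))).1
      have h2 := hCle i
      have h3 := mul_le_mul_of_nonneg_right (hd i) (hh (evalWord φ ω P))
      simp only [evalWord, List.length_cons, pow_succ]
      linarith
  have hpos : ∀ ω : List (Fin r), 0 < h (evalWord φ ω P) := by
    intro ω
    have : 0 < 2 ^ ω.length * K := mul_pos (by positivity) (by linarith)
    linarith [hgrow ω]
  have hstep : ∀ (n : ℕ) (ω : List (Fin r)) (i : Fin r), ω.length = n →
      0 < h (evalWord φ (i :: ω) P) ∧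
      Real.exp (-(2 * (1 / 2 * (1 / 2) ^ n) * ρ)) * (d i * h (evalWord φ ω P)) ^ (-ρ)
        ≤ h (evalWord φ (i :: ω) P) ^ (-ρ) ∧
      h (evalWord φ (i :: ω) P) ^ (-ρ) ≤
        Real.exp (2 * (1 / 2 * (1 / 2) ^ n) * ρ) * (d i * h (evalWord φ ω P)) ^ (-ρ) := by
    rintro n ω i rfl
    have h3 := mul_le_mul_of_nonneg_right (hd i) (hh (evalWord φ ω P))
    have hp := hpos ω
    apply step_bound (c := C i) (by linarith) (by positivity) _ hρ _ (hpol i _)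
    · have : ((1 : ℝ) / 2) ^ ω.length ≤ 1 := pow_le_one₀ (by norm_num) (by norm_num)
      linarith
    · have h4 : 2 * (2 ^ ω.length * K) ≤ d i * h (evalWord φ ω P) := by
        linarith [hgrow ω]
      have h5 : 1 / 2 * (1 / 2 : ℝ) ^ ω.length * (2 * (2 ^ ω.length * K)) = K := by
        have : (1 / 2 : ℝ) ^ ω.length * 2 ^ ω.length = 1 := by
          rw [← mul_pow]; norm_num
        linear_combination K * this
      have h6 := mul_le_mul_of_nonneg_left h4
        (by positivity : 0 ≤ 1 / 2 * (1 / 2 : ℝ) ^ ω.length)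
      linarith [hCle i]
  set b : ℕ → ℝ := fun n => ∑ f : Fin n → Fin r, h (evalWord φ (List.ofFn f) P) ^ (-ρ) with hb
  have : Nonempty (Fin r) := ⟨⟨0, by omega⟩⟩
  have hbpos : ∀ n, 0 < b n := fun n =>
    Finset.sum_pos (fun f _ => Real.rpow_pos_of_pos (hpos _) _) Finset.univ_nonempty
  have hsuc : ∀ n, b (n + 1) =
      ∑ f : Fin n → Fin r, ∑ i, h (evalWord φ (i :: List.ofFn f) P) ^ (-ρ) := fun n =>
    sum_succ_words (fun ω => h (evalWord φ ω P) ^ (-ρ))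
  have hmid : ∀ n (t : ℝ), t * b n =
      ∑ f : Fin n → Fin r, ∑ i, t * (d i * h (evalWord φ (List.ofFn f) P)) ^ (-ρ) := by
    intro n t
    simp only [hb]
    rw [Finset.mul_sum]
    refine Finset.sum_congr rfl fun f _ => ?_
    have : ∀ i, t * (d i * h (evalWord φ (List.ofFn f) P)) ^ (-ρ)
        = d i ^ (-ρ) * (t * h (evalWord φ (List.ofFn f) P) ^ (-ρ)) := by
      intro i
      rw [Real.mul_rpow (by linarith [hd i]) (hh _)]; ring
    simp only [this]
    rw [← Finset.sum_mul, hsum, one_mul]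
  have hlog : ∀ n, dist (Real.log (b n)) (Real.log (b (n + 1))) ≤ ρ * (1 / 2) ^ n := by
    intro n
    have hl : Real.exp (-(2 * (1 / 2 * (1 / 2) ^ n) * ρ)) * b n ≤ b (n + 1) := by
      rw [hmid, hsuc]
      exact Finset.sum_le_sum fun f _ => Finset.sum_le_sum fun i _ =>
        (hstep n (List.ofFn f) i (by simp)).2.1
    have hu : b (n + 1) ≤ Real.exp (2 * (1 / 2 * (1 / 2) ^ n) * ρ) * b n := by
      rw [hmid, hsuc]
      exact Finset.sum_le_sum fun f _ => Finset.sum_le_sum fun i _ =>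
        (hstep n (List.ofFn f) i (by simp)).2.2
    have hl' := Real.log_le_log (mul_pos (Real.exp_pos _) (hbpos n)) hl
    have hu' := Real.log_le_log (hbpos (n + 1)) hu
    rw [Real.log_mul (Real.exp_pos _).ne' (hbpos n).ne', Real.log_exp] at hl' hu'
    rw [Real.dist_eq, abs_le]
    constructor <;> linarith
  obtain ⟨L, hL⟩ := cauchySeq_tendsto_of_complete
    (cauchySeq_of_le_geometric (1 / 2) ρ (by norm_num) hlog)
  refine ⟨Real.exp L, Real.exp_pos _, ?_⟩
  have := (Real.continuous_exp.tendsto L).comp hL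
  refine this.congr fun n => ?_
  exact Real.exp_log (hbpos n)
end

section
/- In the abstract polarized setting, let ρ be the unique positive real with d_1^{−ρ}+⋯+d_r^{−ρ} = 1, and suppose P ∈ V satisfies h(P) > b_S. Then there exist positive constants c_1, c_2 and a real X_0 such that for all X ≥ X_0, c_1·X^ρ ≤ #{ω a word in the free monoid on {1,…,r} : h(eval(ω)(P)) ≤ X} ≤ c_2·X^ρ (in particular these sets are finite). -/
def wdeg {r : ℕ} (d : Fin r → ℝ) : List (Fin r) → ℝ
  | [] => 1
  | i :: ω => d i * wdeg d ω

theorem wdeg_ge {r : ℕ} (d : Fin r → ℝ) (hd : ∀ i, 2 ≤ d i) (ω : List (Fin r)) :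
    (2:ℝ) ^ ω.length ≤ wdeg d ω := by
  induction ω with
  | nil => simp [wdeg]
  | cons i ω ih =>
    simp only [wdeg, List.length_cons, pow_succ']
    exact mul_le_mul (hd i) ih (by positivity) (by linarith [hd i])

theorem wdeg_finite {r : ℕ} (d : Fin r → ℝ) (hd : ∀ i, 2 ≤ d i) (T : ℝ) :
    {ω : List (Fin r) | wdeg d ω ≤ T}.Finite := by
  obtain ⟨n, hn⟩ := pow_unbounded_of_one_lt T (by norm_num : (1:ℝ) < 2)
  refine (List.finite_length_le (Fin r) n).subset ?_
  intro ω hω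
  have h1 := wdeg_ge d hd ω
  have h2 : (2:ℝ) ^ ω.length < 2 ^ n := lt_of_le_of_lt (h1.trans hω) hn
  have := (pow_lt_pow_iff_right₀ (by norm_num : (1:ℝ) < 2)).1 h2
  exact this.le

def wEquiv {r : ℕ} (d : Fin r → ℝ) (hd : ∀ i, 2 ≤ d i) (T : ℝ) (hT : 1 ≤ T) :
    {ω : List (Fin r) // wdeg d ω ≤ T} ≃
      Option (Σ i : Fin r, {ω : List (Fin r) // wdeg d ω ≤ T / d i}) where
  toFun
    | ⟨[], _⟩ => none
    | ⟨i :: ω, hw⟩ => some ⟨i, ω, by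
        rw [le_div_iff₀ (by linarith [hd i]), mul_comm]; exact hw⟩
  invFun
    | none => ⟨[], hT⟩
    | some ⟨i, ω, hw⟩ => ⟨i :: ω, by
        rw [le_div_iff₀ (by linarith [hd i]), mul_comm] at hw; exact hw⟩
  left_inv := by rintro ⟨_ | ⟨i, ω⟩, hw⟩ <;> rfl
  right_inv := by rintro (_ | ⟨i, ω, hw⟩) <;> rfl

theorem wcard_rec {r : ℕ} (d : Fin r → ℝ) (hd : ∀ i, 2 ≤ d i) (T : ℝ) (hT : 1 ≤ T) :
    (Nat.card {ω : List (Fin r) // wdeg d ω ≤ T} : ℝ) =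
      ∑ i, (Nat.card {ω : List (Fin r) // wdeg d ω ≤ T / d i} : ℝ) + 1 := by
  have : ∀ S : ℝ, Finite {ω : List (Fin r) // wdeg d ω ≤ S} := fun S => wdeg_finite d hd S
  rw [Nat.card_congr (wEquiv d hd T hT), Finite.card_option, Nat.card_sigma]
  push_cast
  rfl

theorem wcard_zero {r : ℕ} (d : Fin r → ℝ) (hd : ∀ i, 2 ≤ d i) (T : ℝ) (hT : T < 1) :
    Nat.card {ω : List (Fin r) // wdeg d ω ≤ T} = 0 := by
  have : IsEmpty {ω : List (Fin r) // wdeg d ω ≤ T} := ⟨fun ⟨ω, hw⟩ => by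
    have := wdeg_ge d hd ω
    have h1 : (1:ℝ) ≤ 2 ^ ω.length := one_le_pow₀ (by norm_num)
    linarith⟩
  exact Nat.card_of_isEmpty

theorem sum_scale {r : ℕ} (d : Fin r → ℝ) (hd : ∀ i, 2 ≤ d i) (ρ : ℝ)
    (hsum : ∑ i, d i ^ (-ρ) = 1) (T : ℝ) (hT : 0 < T) (a : ℝ) :
    ∑ i, a * (T / d i) ^ ρ = a * T ^ ρ := by
  rw [← Finset.mul_sum]
  congr 1
  rw [← mul_one (T ^ ρ), ← hsum, Finset.mul_sum]
  refine Finset.sum_congr rfl fun i _ => ?_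
  have : 0 < d i := by linarith [hd i]
  rw [Real.div_rpow hT.le this.le, Real.rpow_neg this.le, div_eq_mul_inv]

theorem wbounds {r : ℕ} (hr : 2 ≤ r) (d : Fin r → ℝ) (hd : ∀ i, 2 ≤ d i) (ρ : ℝ) (hρ : 0 < ρ)
    (hsum : ∑ i, d i ^ (-ρ) = 1) (D : ℝ) (hD : ∀ i, d i ≤ D) (hD1 : 0 < D) (n : ℕ) :
    ∀ T : ℝ, 1 / D ≤ T → T < 2 ^ n →
      1 / ((r:ℝ) - 1) * T ^ ρ ≤
        (Nat.card {ω : List (Fin r) // wdeg d ω ≤ T} : ℝ) + 1 / ((r:ℝ) - 1) ∧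
      (Nat.card {ω : List (Fin r) // wdeg d ω ≤ T} : ℝ) + 1 / ((r:ℝ) - 1) ≤
        D ^ ρ / ((r:ℝ) - 1) * T ^ ρ := by
  have hr' : (2:ℝ) ≤ r := by exact_mod_cast hr
  have hr1 : 0 < (r:ℝ) - 1 := by linarith
  have base : ∀ T : ℝ, 1 / D ≤ T → T < 1 →
      1 / ((r:ℝ) - 1) * T ^ ρ ≤
        (Nat.card {ω : List (Fin r) // wdeg d ω ≤ T} : ℝ) + 1 / ((r:ℝ) - 1) ∧
      (Nat.card {ω : List (Fin r) // wdeg d ω ≤ T} : ℝ) + 1 / ((r:ℝ) - 1) ≤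
        D ^ ρ / ((r:ℝ) - 1) * T ^ ρ := by
    intro T h1 h2
    have hT0 : 0 < T := lt_of_lt_of_le (by positivity) h1
    rw [wcard_zero d hd T h2]
    have e1 : T ^ ρ ≤ 1 := Real.rpow_le_one hT0.le h2.le hρ.le
    have e2 : 1 ≤ D ^ ρ * T ^ ρ := by
      rw [← Real.mul_rpow hD1.le hT0.le]
      refine Real.one_le_rpow ?_ hρ.le
      rw [div_le_iff₀ hD1] at h1
      linarith
    have e3 : 0 < 1 / ((r:ℝ) - 1) := by positivity
    constructor
    · push_cast
      nlinarith
    · have : D ^ ρ / ((r:ℝ) - 1) * T ^ ρ = 1 / ((r:ℝ) - 1) * (D ^ ρ * T ^ ρ) := by ring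
      rw [this]
      push_cast
      nlinarith
  induction n with
  | zero => intro T h1 h2; exact base T h1 (by simpa using h2)
  | succ n ih =>
    intro T h1 h2
    by_cases hT : T < 1
    · exact base T h1 hT
    push Not at hT
    have hT0 : 0 < T := by linarith
    have key : ∀ i, _ := fun i => ih (T / d i)
      (by
        have := hd i
        exact div_le_div₀ hT0.le hT (by linarith) (hD i))
      (by
        have := hd i
        rw [div_lt_iff₀ (by linarith)]
        rw [pow_succ] at h2
        have : (0:ℝ) < 2 ^ n := by positivity
        nlinarith)
    have hM : (Nat.card {ω : List (Fin r) // wdeg d ω ≤ T} : ℝ) + 1 / ((r:ℝ) - 1) =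
        ∑ i, ((Nat.card {ω : List (Fin r) // wdeg d ω ≤ T / d i} : ℝ) + 1 / ((r:ℝ) - 1)) := by
      rw [wcard_rec d hd T hT, Finset.sum_add_distrib]
      simp only [Finset.sum_const, Finset.card_univ, Fintype.card_fin, nsmul_eq_mul]
      field_simp
      ring
    rw [hM, ← sum_scale d hd ρ hsum T hT0, ← sum_scale d hd ρ hsum T hT0]
    exact ⟨Finset.sum_le_sum fun i _ => (key i).1, Finset.sum_le_sum fun i _ => (key i).2⟩

/-- in the abstract polarized setting, if `h P > b_S = C_S/(d_S - 1)`
then the number of words `ω` with `h(eval ω P) ≤ X` is bounded above and below by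
positive multiples of `X ^ ρ`. -/
theorem stmt_15 {V : Type*} (r : ℕ) (hr : 2 ≤ r) (φ : Fin r → V → V)
    (h : V → ℝ) (hh : ∀ x, 0 ≤ h x)
    (d : Fin r → ℝ) (hd : ∀ i, 2 ≤ d i)
    (C : Fin r → ℝ) (hC : ∀ i, 0 ≤ C i)
    (hpol : ∀ i x, |h (φ i x) - d i * h x| ≤ C i)
    (dS CS : ℝ) (hdS : IsLeast (Set.range d) dS) (hCS : IsGreatest (Set.range C) CS)
    (ρ : ℝ) (hρ : 0 < ρ) (hsum : ∑ i, d i ^ (-ρ) = 1)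
    (P : V) (hP : CS / (dS - 1) < h P) :
    ∃ c₁ c₂ : ℝ, 0 < c₁ ∧ 0 < c₂ ∧ ∃ X₀ : ℝ, ∀ X ≥ X₀,
      {ω : List (Fin r) | h (evalWord φ ω P) ≤ X}.Finite ∧
      c₁ * X ^ ρ ≤ (Nat.card {ω : List (Fin r) // h (evalWord φ ω P) ≤ X} : ℝ) ∧
      (Nat.card {ω : List (Fin r) // h (evalWord φ ω P) ≤ X} : ℝ) ≤ c₂ * X ^ ρ := by
  have hr' : (2:ℝ) ≤ r := by exact_mod_cast hr
  have hr1 : 0 < (r:ℝ) - 1 := by linarith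
  have hdS2 : 2 ≤ dS := by obtain ⟨i, hi⟩ := hdS.1; rw [← hi]; exact hd i
  have hCS0 : 0 ≤ CS := by obtain ⟨i, hi⟩ := hCS.1; rw [← hi]; exact hC i
  have hdi : ∀ i, dS ≤ d i := fun i => hdS.2 ⟨i, rfl⟩
  have hCi : ∀ i, C i ≤ CS := fun i => hCS.2 ⟨i, rfl⟩
  obtain ⟨b, hb⟩ : ∃ b, b = CS / (dS - 1) := ⟨_, rfl⟩
  rw [← hb] at hP
  have hb0 : 0 ≤ b := by rw [hb]; exact div_nonneg hCS0 (by linarith)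
  have hbC : b * (dS - 1) = CS := by rw [hb]; exact div_mul_cancel₀ _ (by linarith)
  have hbi : ∀ i, C i + b ≤ d i * b := fun i => by nlinarith [hdi i, hCi i]
  have lo : ∀ ω, wdeg d ω * (h P - b) ≤ h (evalWord φ ω P) - b := by
    intro ω
    induction ω with
    | nil => simp [wdeg, evalWord]
    | cons i ω ih =>
      simp only [wdeg, evalWord]
      have h1 := (abs_le.1 (hpol i (evalWord φ ω P))).1
      have h2 := mul_le_mul_of_nonneg_left ih (by linarith [hd i] : 0 ≤ d i)
      nlinarith [hbi i]
  have up : ∀ ω, h (evalWord φ ω P) + b ≤ wdeg d ω * (h P + b) := by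
    intro ω
    induction ω with
    | nil => simp [wdeg, evalWord]
    | cons i ω ih =>
      simp only [wdeg, evalWord]
      have h1 := (abs_le.1 (hpol i (evalWord φ ω P))).2
      have h2 := mul_le_mul_of_nonneg_left ih (by linarith [hd i] : 0 ≤ d i)
      nlinarith [hbi i]
  have hA : 0 < h P - b := by linarith
  have hB : 0 < h P + b := by linarith
  obtain ⟨D, hDdef⟩ : ∃ D, D = ∑ i, d i := ⟨_, rfl⟩
  have hD : ∀ i, d i ≤ D := fun i => by
    rw [hDdef]
    exact Finset.single_le_sum (f := d) (fun j _ => by linarith [hd j]) (Finset.mem_univ i)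
  have hD2 : 2 ≤ D := (hd ⟨0, by omega⟩).trans (hD _)
  have hD0 : 0 < D := by linarith
  have bnd : ∀ T : ℝ, 1 / D ≤ T → _ := fun T hT =>
     wbounds hr d hd ρ hρ hsum D hD hD0 _ T hT
      (pow_unbounded_of_one_lt T (by norm_num : (1:ℝ) < 2)).choose_spec
  refine ⟨1 / ((r:ℝ) - 1) / 2 / (h P + b) ^ ρ, D ^ ρ / ((r:ℝ) - 1) / (h P - b) ^ ρ,
    by positivity, by positivity, (h P + b) * 2 ^ (1 / ρ), fun X hX => ?_⟩
  have h2ρ : (1:ℝ) ≤ 2 ^ (1 / ρ) := Real.one_le_rpow (by norm_num) (by positivity)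
  have hT1 : (2:ℝ) ^ (1 / ρ) ≤ X / (h P + b) := by
    rw [le_div_iff₀ hB]; linarith
  have hX0 : 0 < X := lt_of_lt_of_le (by positivity) hX
  have hTT : X / (h P + b) ≤ X / (h P - b) := div_le_div_of_nonneg_left hX0.le hA (by linarith)
  have hD1 : 1 / D ≤ 1 := by rw [div_le_one hD0]; linarith
  have sub1 : {ω : List (Fin r) | wdeg d ω ≤ X / (h P + b)} ⊆
      {ω : List (Fin r) | h (evalWord φ ω P) ≤ X} := by
    intro ω hω
    simp only [Set.mem_setOf_eq] at hω ⊢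
    rw [le_div_iff₀ hB] at hω
    linarith [up ω]
  have sub2 : {ω : List (Fin r) | h (evalWord φ ω P) ≤ X} ⊆
      {ω : List (Fin r) | wdeg d ω ≤ X / (h P - b)} := by
    intro ω hω
    simp only [Set.mem_setOf_eq] at hω ⊢
    rw [le_div_iff₀ hA]
    linarith [lo ω]
  have fin := (wdeg_finite d hd (X / (h P - b))).subset sub2
  have c1 : (Nat.card {ω : List (Fin r) // wdeg d ω ≤ X / (h P + b)} : ℝ) ≤
      (Nat.card {ω : List (Fin r) // h (evalWord φ ω P) ≤ X} : ℝ) := by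
    exact_mod_cast Nat.card_mono fin sub1
  have c2 : (Nat.card {ω : List (Fin r) // h (evalWord φ ω P) ≤ X} : ℝ) ≤
      (Nat.card {ω : List (Fin r) // wdeg d ω ≤ X / (h P - b)} : ℝ) := by
    exact_mod_cast Nat.card_mono (wdeg_finite d hd (X / (h P - b))) sub2
  have e3 : 0 < 1 / ((r:ℝ) - 1) := by positivity
  refine ⟨fin, ?_, ?_⟩
  · have k := (bnd (X / (h P + b)) (by linarith)).1
    have hp : (2:ℝ) ≤ (X / (h P + b)) ^ ρ := by
      have := Real.rpow_le_rpow (by positivity) hT1 hρ.le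
      rwa [← Real.rpow_mul (by norm_num), one_div_mul_cancel hρ.ne', Real.rpow_one] at this
    have : 1 / ((r:ℝ) - 1) / 2 / (h P + b) ^ ρ * X ^ ρ =
        1 / ((r:ℝ) - 1) / 2 * (X / (h P + b)) ^ ρ := by
      rw [Real.div_rpow hX0.le hB.le]; ring
    rw [this]
    nlinarith
  · have k := (bnd (X / (h P - b)) (by linarith)).2
    have : D ^ ρ / ((r:ℝ) - 1) / (h P - b) ^ ρ * X ^ ρ =
        D ^ ρ / ((r:ℝ) - 1) * (X / (h P - b)) ^ ρ := by
      rw [Real.div_rpow hX0.le hA.le]; ring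
    rw [this]
    linarith
end

section
/- In the abstract polarized setting, assume additionally that d_1,…,d_r are integers (each at least 2) and that the tuple (d_1,…,d_r) is acyclic; let ρ be the unique positive real with d_1^{−ρ}+⋯+d_r^{−ρ} = 1, and suppose P ∈ V satisfies h(P) > 2·C_S. Then there exists a constant c > 0 such that #{ω a word in the free monoid on {1,…,r} : h(eval(ω)(P)) ≤ X} / X^ρ tends to c as the real number X tends to infinity. -/
open Filter

theorem exists_irrational_pair {r : ℕ} (hr : 2 ≤ r) (d : Fin r → ℕ) (hd : ∀ i, 2 ≤ d i)
    (hac : ¬ IsCyclicTuple r d) :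
    ∃ i j, Irrational (Real.log (d i) / Real.log (d j)) := by
  classical
  by_contra hcon
  push Not at hcon
  apply hac
  let z : Fin r := ⟨0, by omega⟩
  have hex : ∃ b : ℕ, 2 ≤ b ∧ ∃ k, 0 < k ∧ d z = b ^ k := ⟨d z, hd z, 1, by simp⟩
  obtain ⟨hb2, k, hk, hbk⟩ := Nat.find_spec hex
  set b := Nat.find hex with hb
  have key : ∀ i, ∃ n, 0 < n ∧ d i = b ^ n := by
    intro i
    have h1 := hcon i z
    rw [Irrational] at h1
    push Not at h1
    obtain ⟨q, hq⟩ := h1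
    have hlz : 0 < Real.log (d z) := Real.log_pos (by exact_mod_cast (hd z))
    have hli : 0 < Real.log (d i) := Real.log_pos (by exact_mod_cast (hd i))
    have hq0 : (0:ℝ) < q := by rw [hq]; positivity
    have hq0' : 0 < q := by exact_mod_cast hq0
    obtain ⟨n, hn⟩ := Int.eq_ofNat_of_zero_le (Rat.num_pos.2 hq0').le
    have hn0 : 0 < n := by have := Rat.num_pos.2 hq0'; omega
    have hm0 : 0 < q.den := q.den_pos
    have hqe : (q:ℝ) = (n:ℝ) / (q.den:ℝ) := by
      have := Rat.num_div_den q
      rw [hn] at this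
      rw [Rat.cast_def, hn]; simp
    have hpow : d i ^ q.den = d z ^ n := by
      have : (q.den:ℝ) * Real.log (d i) = n * Real.log (d z) := by
        rw [hqe] at hq
        have : (q.den:ℝ) ≠ 0 := by positivity
        field_simp at hq
        linarith
      rw [← Real.log_pow, ← Real.log_pow] at this
      have h2 := Real.log_injOn_pos (Set.mem_Ioi.2 ?_) (Set.mem_Ioi.2 ?_) this
      · exact_mod_cast h2
      · have := hd i; positivity
      · have := hd z; positivity
    rw [hbk, ← pow_mul] at hpow
    obtain ⟨c, hc1, hc2⟩ := Nat.exists_eq_pow_of_pow_eq_pow (Or.inl hm0.ne') hpow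
    set g := Nat.gcd q.den (k * n) with hg
    have hkn : 0 < k * n := by positivity
    have hgpos : 0 < g := Nat.gcd_pos_of_pos_left _ hm0
    have e1 : 0 < q.den / g := Nat.div_pos (Nat.le_of_dvd hm0 (Nat.gcd_dvd_left _ _)) hgpos
    have e2 : 0 < k * n / g := Nat.div_pos (Nat.le_of_dvd hkn (Nat.gcd_dvd_right _ _)) hgpos
    change d i = c ^ (k * n / g) at hc1
    change b = c ^ (q.den / g) at hc2
    have hc : 2 ≤ c := by
      by_contra hlt
      have : c = 0 ∨ c = 1 := by omega
      rcases this with h | h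
      · rw [h, zero_pow e1.ne'] at hc2; omega
      · rw [h, one_pow] at hc2; omega
    have hle : b ≤ c := Nat.find_min' hex ⟨hc, q.den / g * k, by positivity, by
      rw [hbk, hc2, pow_mul]⟩
    have hle2 : c ≤ b := by rw [hc2]; exact Nat.le_self_pow e1.ne' c
    have : b = c := le_antisymm hle hle2
    exact ⟨_, e2, by rw [this]; exact hc1⟩
  choose n hn using key
  exact ⟨b, by omega, n, hn⟩

/-- Additive weight of a word. -/
def wt {r : ℕ} (a : Fin r → ℝ) (ω : List (Fin r)) : ℝ := (ω.map a).sum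

theorem wt_nil {r : ℕ} (a : Fin r → ℝ) : wt a [] = 0 := by simp [wt]

theorem wt_cons {r : ℕ} (a : Fin r → ℝ) (i : Fin r) (ω : List (Fin r)) :
    wt a (i :: ω) = a i + wt a ω := by simp [wt]

theorem wt_combo {r : ℕ} (a : Fin r → ℝ) (i j : Fin r) (m n : ℕ) :
    ∃ ω, wt a ω = m * a i + n * a j :=
  ⟨List.replicate m i ++ List.replicate n j, by simp [wt]⟩

theorem dense_wt {r : ℕ} (a : Fin r → ℝ) (ha : ∀ i, 0 < a i) (i j : Fin r)
    (hirr : Irrational (a i / a j)) (ε : ℝ) (hε : 0 < ε) :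
    ∃ T : ℝ, 0 ≤ T ∧ ∀ v, T ≤ v → ∃ ω, v ≤ wt a ω ∧ wt a ω ≤ v + ε := by
  have hd := dense_addSubgroupClosure_pair_iff.2 hirr
  obtain ⟨s, hs1, hs2⟩ := hd.exists_between hε
  obtain ⟨m, n, hmn⟩ := AddSubgroup.mem_closure_pair.1 hs1
  simp only [zsmul_eq_mul] at hmn
  have hmz : (m:ℝ) = (m.toNat:ℝ) - ((-m).toNat:ℝ) := by
    have := Int.toNat_sub_toNat_neg m
    exact_mod_cast this.symm
  have hnz : (n:ℝ) = (n.toNat:ℝ) - ((-n).toNat:ℝ) := by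
    have := Int.toNat_sub_toNat_neg n
    exact_mod_cast this.symm
  generalize m.toNat = m1 at *
  generalize (-m).toNat = m2 at *
  generalize n.toNat = n1 at *
  generalize (-n).toNat = n2 at *
  rw [hmz, hnz] at hmn
  have hs0 : 0 < s := hs2.1
  have hai := ha i
  have haj := ha j
  obtain ⟨k, hk⟩ := exists_nat_ge (a i / s)
  rw [div_le_iff₀ hs0] at hk
  refine ⟨k * (m2 * a i + n2 * a j), by positivity, ?_⟩
  intro v hv
  set y := m2 * a i + n2 * a j with hy
  have hw : 0 ≤ (v - k * y) / a i := div_nonneg (by linarith) hai.le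
  have q1 := Nat.floor_le hw
  have q2 := Nat.lt_floor_add_one ((v - k * y) / a i)
  set q := ⌊(v - k * y) / a i⌋₊
  rw [le_div_iff₀ hai] at q1
  rw [div_lt_iff₀ hai] at q2
  have hrem : 0 ≤ (v - k * y - q * a i) / s := div_nonneg (by linarith) hs0.le
  have j1 := Nat.le_ceil ((v - k * y - q * a i) / s)
  have j2 := Nat.ceil_lt_add_one hrem
  have j3 : ⌈(v - k * y - q * a i) / s⌉₊ ≤ k := by
    apply Nat.ceil_le.2
    rw [div_le_iff₀ hs0]
    nlinarith
  set l := ⌈(v - k * y - q * a i) / s⌉₊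
  rw [div_le_iff₀ hs0] at j1
  have j2' : (l - 1 : ℝ) < (v - k * y - q * a i) / s := by linarith
  rw [lt_div_iff₀ hs0] at j2'
  obtain ⟨ω, hω⟩ := wt_combo a i j (q + l * m1 + (k - l) * m2) (l * n1 + (k - l) * n2)
  have : wt a ω = q * a i + k * y + l * s := by
    rw [hω, ← hmn, hy]
    push_cast [Nat.cast_sub j3]
    ring
  refine ⟨ω, ?_, ?_⟩
  · rw [this]; linarith
  · rw [this]; linarith [hs2.2]

theorem wt_finite {r : ℕ} (a : Fin r → ℝ) (ha : ∀ i, 0 < a i) (B : ℝ) :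
    {ω : List (Fin r) | wt a ω ≤ B}.Finite := by
  obtain ⟨m, hm, hma⟩ : ∃ m : ℝ, 0 < m ∧ ∀ i, m ≤ a i := by
    rcases isEmpty_or_nonempty (Fin r) with he | hne
    · exact ⟨1, one_pos, fun i => he.elim i⟩
    · obtain ⟨i, hi⟩ := Finite.exists_min a
      exact ⟨a i, ha i, hi⟩
  have hlen : ∀ ω : List (Fin r), ω.length * m ≤ wt a ω := by
    intro ω
    induction ω with
    | nil => simp [wt]
    | cons i ω ih => rw [wt_cons]; push_cast [List.length_cons]; linarith [hma i]
  obtain ⟨n, hn⟩ := exists_nat_ge (B / m)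
  rw [div_le_iff₀ hm] at hn
  refine (List.finite_length_le (Fin r) n).subset ?_
  intro ω hω
  have h1 := hlen ω
  have h2 : (ω.length : ℝ) * m ≤ n * m := by
    have : wt a ω ≤ B := hω
    linarith
  have h3 := le_of_mul_le_mul_right h2 hm
  exact_mod_cast h3

/-- Propagation of near-extremal values backwards along words. -/
theorem propagate {r : ℕ} (p a : Fin r → ℝ) (hp : ∀ i, 0 < p i) (hp1 : ∑ i, p i = 1)
    (g z : ℝ → ℝ) (L : ℝ)
    (hg : ∀ᶠ t in atTop, g t ≤ ∑ i, p i * g (t - a i) + z t)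
    (hz : ∀ η > 0, ∀ᶠ t in atTop, z t < η)
    (hL : ∀ η > 0, ∀ᶠ t in atTop, g t < L + η) (ω : List (Fin r)) :
    ∀ δ > 0, ∃ η > 0, ∀ᶠ t in atTop, L - η < g t → L - δ < g (t - wt a ω) := by
  have shift : ∀ (s : ℝ) (Q : ℝ → Prop), (∀ᶠ t in atTop, Q t) → ∀ᶠ t in atTop, Q (t - s) := by
    intro s Q hQ
    exact (tendsto_atTop_add_const_right atTop (-s) tendsto_id).eventually hQ
  induction ω with
  | nil =>
    intro δ hδ
    exact ⟨δ, hδ, Eventually.of_forall fun t ht => by simpa [wt] using ht⟩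
  | cons i ω ih =>
    intro δ hδ
    have hpi := hp i
    set e := p i * δ / 4 with he
    have he0 : 0 < e := by positivity
    obtain ⟨η, hη, hev⟩ := ih e he0
    refine ⟨η, hη, ?_⟩
    have hall : ∀ᶠ t in atTop, ∀ j, g (t - a j) < L + e :=
      eventually_all.2 fun j => shift (a j) _ (hL e he0)
    have one : ∀ᶠ t in atTop, L - e < g t → L - δ < g (t - a i) := by
      filter_upwards [hg, hz e he0, hall] with t h1 h2 h3 h4
      have h5 : ∑ j, p j * g (t - a j) ≤ p i * g (t - a i) + (1 - p i) * (L + e) := by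
        rw [← Finset.add_sum_erase _ _ (Finset.mem_univ i)]
        have h6 : ∑ j ∈ Finset.univ.erase i, p j * g (t - a j)
            ≤ ∑ j ∈ Finset.univ.erase i, p j * (L + e) :=
          Finset.sum_le_sum fun j _ => mul_le_mul_of_nonneg_left (h3 j).le (hp j).le
        have h7 : ∑ j ∈ Finset.univ.erase i, p j = 1 - p i := by
          rw [← hp1, ← Finset.add_sum_erase _ _ (Finset.mem_univ i)]; ring
        rw [← Finset.sum_mul, h7] at h6
        linarith
      have h8 : p i * (L - δ) < p i * g (t - a i) := by nlinarith
      exact lt_of_mul_lt_mul_left h8 hpi.le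
    filter_upwards [hev, shift (wt a ω) _ one] with t h1 h2 h3
    rw [wt_cons, show t - (a i + wt a ω) = t - wt a ω - a i by ring]
    exact h2 (h1 h3)

open MeasureTheory intervalIntegral in
theorem renewal {r : ℕ} (hr : 0 < r) (p a : Fin r → ℝ) (hp : ∀ i, 0 < p i)
    (hp1 : ∑ i, p i = 1) (ha : ∀ i, 0 < a i) (ρ : ℝ) (hρ : 0 < ρ)
    (hdense : ∀ ε > 0, ∃ T : ℝ, 0 ≤ T ∧ ∀ v, T ≤ v → ∃ ω, v ≤ wt a ω ∧ wt a ω ≤ v + ε)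
    (f : ℝ → ℝ) (f0 : ∀ t, 0 ≤ f t) (fneg : ∀ t < 0, f t = 0)
    (fmono : ∀ t s, 0 ≤ s → f t ≤ Real.exp (ρ * s) * f (t + s))
    (fint : ∀ u v, IntervalIntegrable f volume u v)
    (feq : ∀ t, 0 ≤ t → f t = ∑ i, p i * f (t - a i) + Real.exp (-ρ * t)) :
    Tendsto f atTop (nhds (1 / (ρ * ∑ i, p i * a i))) := by
  have hμ : 0 < ∑ i, p i * a i := by
    have : Nonempty (Fin r) := ⟨⟨0, hr⟩⟩
    exact Finset.sum_pos (fun i _ => mul_pos (hp i) (ha i)) Finset.univ_nonempty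
  set μ := ∑ i, p i * a i with hμdef
  -- conserved quantity
  have cons : ∀ t, 0 ≤ t → ∑ i, p i * ∫ s in (t - a i)..t, f s = (1 - Real.exp (-ρ * t)) / ρ := by
    intro t ht
    have h1 : ∀ i, ∫ s in (t - a i)..t, f s = (∫ s in (0:ℝ)..t, f s) - ∫ s in (0:ℝ)..t, f (s - a i) := by
      intro i
      rw [integral_comp_sub_right (fun s => f s) (a i)]
      have hz : ∫ s in (0 - a i)..0, f s = 0 := by
        rw [integral_of_le (by linarith [ha i]), integral_Ioc_eq_integral_Ioo]
        rw [setIntegral_congr_fun (g := fun _ => (0:ℝ)) measurableSet_Ioo (fun s hs => fneg s hs.2)]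
        simp
      have e1 := integral_add_adjacent_intervals (fint (0 - a i) 0) (fint 0 t)
      have e2 := integral_add_adjacent_intervals (fint (0 - a i) (t - a i)) (fint (t - a i) t)
      linarith
    have h2 : ∫ s in (0:ℝ)..t, f s
        = ∑ i, p i * (∫ s in (0:ℝ)..t, f (s - a i)) + ∫ s in (0:ℝ)..t, Real.exp (-ρ * s) := by
      have hii : ∀ i, IntervalIntegrable (fun s => p i * f (s - a i)) volume 0 t := by
        intro i
        have := (fint (0 - a i) (t - a i)).comp_sub_right (a i)
        simp only [sub_add_cancel] at this
        exact this.const_mul _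
      have hex : IntervalIntegrable (fun s => Real.exp (-ρ * s)) volume 0 t :=
        (by fun_prop : Continuous fun s => Real.exp (-ρ * s)).intervalIntegrable _ _
      calc ∫ s in (0:ℝ)..t, f s
          = ∫ s in (0:ℝ)..t, (∑ i, p i * f (s - a i) + Real.exp (-ρ * s)) := by
            apply integral_congr
            intro s hs
            rw [Set.uIcc_of_le ht] at hs
            exact feq s hs.1
        _ = _ := by
            rw [integral_add _ hex, integral_finsetSum (fun i _ => hii i)]
            · simp only [intervalIntegral.integral_const_mul]
            · have := IntervalIntegrable.sum Finset.univ (f := fun i s => p i * f (s - a i))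
                (μ := volume) (a := 0) (b := t) (fun i _ => hii i)
              have e : (∑ i, fun s => p i * f (s - a i)) = fun s => ∑ i, p i * f (s - a i) := by
                ext s; simp
              rwa [e] at this
    have h3 : ∫ s in (0:ℝ)..t, Real.exp (-ρ * s) = (1 - Real.exp (-ρ * t)) / ρ := by
      rw [integral_comp_mul_left (fun s => Real.exp s) (by linarith : -ρ ≠ 0), integral_exp]
      simp only [mul_zero, Real.exp_zero, smul_eq_mul]
      field_simp
      ring
    simp only [h1, mul_sub, Finset.sum_sub_distrib, ← Finset.sum_mul, hp1, one_mul]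
    rw [← h3]
    linarith
  have fle : ∀ t s, t ≤ s → f t ≤ Real.exp (ρ * (s - t)) * f s := by
    intro t s hts
    have := fmono t (s - t) (by linarith)
    simpa using this
  -- boundedness
  obtain ⟨K, hK⟩ : ∃ K, ∀ t, f t ≤ K := by
    let i : Fin r := ⟨0, hr⟩
    refine ⟨Real.exp (ρ * a i) / (ρ * p i * a i), ?_⟩
    intro t
    have hai := ha i
    have hpi := hp i
    rcases lt_or_ge t 0 with h | h
    · rw [fneg t h]; positivity
    have h1 := cons (t + a i) (by linarith)
    have h2 : p i * ∫ s in (t + a i - a i)..(t + a i), f s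
        ≤ ∑ j, p j * ∫ s in (t + a i - a j)..(t + a i), f s :=
      Finset.single_le_sum (f := fun j => p j * ∫ s in (t + a i - a j)..(t + a i), f s)
        (fun j _ => mul_nonneg (hp j).le
          (integral_nonneg (by linarith [ha j]) fun s _ => f0 s)) (Finset.mem_univ i)
    rw [h1, add_sub_cancel_right] at h2
    have h3 : ∫ s in t..(t + a i), (Real.exp (-(ρ * a i)) * f t) ≤ ∫ s in t..(t + a i), f s := by
      apply integral_mono_on (by linarith) (by simp) (fint _ _)
      intro s hs
      have h4 := fle t s hs.1
      rw [Real.exp_neg, inv_mul_le_iff₀ (Real.exp_pos _)]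
      refine h4.trans (mul_le_mul_of_nonneg_right ?_ (f0 s))
      apply Real.exp_le_exp.2
      apply mul_le_mul_of_nonneg_left _ hρ.le
      linarith [hs.2]
    rw [intervalIntegral.integral_const, smul_eq_mul, add_sub_cancel_left] at h3
    have h5 : (1 - Real.exp (-ρ * (t + a i))) / ρ ≤ 1 / ρ := by
      apply div_le_div_of_nonneg_right _ hρ.le
      linarith [Real.exp_pos (-ρ * (t + a i))]
    have h6 : p i * (a i * (Real.exp (-(ρ * a i)) * f t)) ≤ 1 / ρ :=
      (mul_le_mul_of_nonneg_left h3 hpi.le).trans (h2.trans h5)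
    rw [Real.exp_neg] at h6
    have hE := Real.exp_pos (ρ * a i)
    rw [le_div_iff₀ (by positivity)]
    rw [le_div_iff₀ hρ] at h6
    field_simp at h6
    rw [mul_comm (a i) ρ] at h6
    linarith
  have bddA : IsBoundedUnder (· ≤ ·) atTop f := isBoundedUnder_of ⟨K, hK⟩
  have bddB : IsBoundedUnder (· ≥ ·) atTop f := isBoundedUnder_of ⟨0, f0⟩
  have expz : Tendsto (fun t : ℝ => Real.exp (-ρ * t)) atTop (nhds 0) := by
    apply Real.tendsto_exp_atBot.comp
    exact tendsto_id.const_mul_atTop_of_neg (by linarith)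
  -- bound on limsup
  have upper : limsup f atTop ≤ 1 / (ρ * μ) := by
    set L := limsup f atTop with hLdef
    have hL : ∀ η > 0, ∀ᶠ t in atTop, f t < L + η := fun η hη =>
      eventually_lt_of_limsup_lt (by linarith) bddA
    have hL' : ∀ η > 0, ∃ᶠ t in atTop, L - η < f t := fun η hη =>
      frequently_lt_of_lt_limsup bddB.isCoboundedUnder_le (by linarith)
    have main : ∀ ε > 0, L - ε ≤ Real.exp (ρ * ε) * (1 / (ρ * μ)) := by
      intro ε hε
      obtain ⟨T, hT0, hT⟩ := hdense ε hε
      obtain ⟨A, hA⟩ : ∃ A, ∀ i, a i ≤ A := by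
        obtain ⟨A, hA⟩ := (Set.finite_range a).bddAbove
        exact ⟨A, fun i => hA ⟨i, rfl⟩⟩
      have hfin := wt_finite a ha (T + A + ε)
      have hprop := fun ω => propagate p a hp hp1 f (fun t => Real.exp (-ρ * t)) L
        ((eventually_ge_atTop 0).mono fun t ht => (feq t ht).le)
        (fun η hη => expz.eventually_lt_const hη) hL ω ε hε
      choose η hη hev using hprop
      have hmin : ∃ e > 0, ∀ ω ∈ {ω : List (Fin r) | wt a ω ≤ T + A + ε}, e ≤ η ω := by
        obtain ⟨ω, hω, hmin⟩ := Set.exists_min_image _ η hfin ⟨[], by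
          simp only [Set.mem_ofPred_eq, wt_nil]
          have := (ha ⟨0, hr⟩).trans_le (hA _)
          linarith⟩
        exact ⟨η ω, hη ω, hmin⟩
      obtain ⟨e, he, hemin⟩ := hmin
      have hev' := (hfin.eventually_all (l := atTop)).2 fun ω _ => hev ω
      obtain ⟨t, ht1, ht2, ht3⟩ := ((hL' e he).and_eventually
        (hev'.and (eventually_ge_atTop (T)))).exists
      have hwin : ∀ v, T ≤ v → v ≤ T + A → L - ε ≤ Real.exp (ρ * ε) * f (t - v) := by
        intro v hv1 hv2
        obtain ⟨ω, hω1, hω2⟩ := hT v hv1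
        have hm : ω ∈ {ω : List (Fin r) | wt a ω ≤ T + A + ε} := by
          simp only [Set.mem_ofPred_eq]; linarith
        have h1 := ht2 ω hm (by linarith [hemin ω hm])
        refine h1.le.trans ((fle (t - wt a ω) (t - v) (by linarith)).trans ?_)
        apply mul_le_mul_of_nonneg_right _ (f0 _)
        apply Real.exp_le_exp.2
        apply mul_le_mul_of_nonneg_left _ hρ.le
        linarith
      have hc := cons (t - T) (by linarith)
      have hE := Real.exp_pos (ρ * ε)
      have hle : ∑ i, p i * (a i * ((L - ε) / Real.exp (ρ * ε)))
          ≤ ∑ i, p i * ∫ s in (t - T - a i)..(t - T), f s := by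
        apply Finset.sum_le_sum
        intro i _
        apply mul_le_mul_of_nonneg_left _ (hp i).le
        have : ∫ s in (t - T - a i)..(t - T), ((L - ε) / Real.exp (ρ * ε))
            ≤ ∫ s in (t - T - a i)..(t - T), f s := by
          apply integral_mono_on (by linarith [ha i]) (by simp) (fint _ _)
          intro s hs
          rw [div_le_iff₀ hE]
          have := hwin (t - s) (by linarith [hs.2]) (by linarith [hs.1, hA i])
          rw [sub_sub_cancel] at this
          linarith
        rw [intervalIntegral.integral_const, smul_eq_mul] at this
        rw [show t - T - (t - T - a i) = a i by ring] at this
        exact this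
      rw [hc] at hle
      simp only [← mul_assoc, ← Finset.sum_mul] at hle
      rw [← hμdef] at hle
      have h5 : (1 - Real.exp (-ρ * (t - T))) / ρ ≤ 1 / ρ := by
        apply div_le_div_of_nonneg_right _ hρ.le
        linarith [Real.exp_pos (-ρ * (t - T))]
      have h6 := hle.trans h5
      rw [← mul_div_assoc, div_le_div_iff₀ hE hρ] at h6
      rw [mul_one_div, le_div_iff₀ (by positivity)]
      linarith
    have l1 : Tendsto (fun ε : ℝ => L - ε) (nhdsWithin 0 (Set.Ioi 0)) (nhds L) := by
      have : Tendsto (fun ε : ℝ => L - ε) (nhds 0) (nhds (L - 0)) :=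
        (by fun_prop : Continuous fun ε : ℝ => L - ε).tendsto 0
      rw [sub_zero] at this
      exact this.mono_left nhdsWithin_le_nhds
    have l2 : Tendsto (fun ε : ℝ => Real.exp (ρ * ε) * (1 / (ρ * μ)))
        (nhdsWithin 0 (Set.Ioi 0)) (nhds (1 / (ρ * μ))) := by
      have : Tendsto (fun ε : ℝ => Real.exp (ρ * ε) * (1 / (ρ * μ))) (nhds 0)
          (nhds (Real.exp (ρ * 0) * (1 / (ρ * μ)))) :=
        (by fun_prop : Continuous fun ε : ℝ => Real.exp (ρ * ε) * (1 / (ρ * μ))).tendsto 0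
      rw [mul_zero, Real.exp_zero, one_mul] at this
      exact this.mono_left nhdsWithin_le_nhds
    exact le_of_tendsto_of_tendsto l1 l2 (by
      filter_upwards [self_mem_nhdsWithin] with ε hε using main ε hε)
  -- bound on liminf
  have lower : 1 / (ρ * μ) ≤ liminf f atTop := by
    set L := liminf f atTop with hLdef
    have hL : ∀ η > 0, ∀ᶠ t in atTop, -f t < -L + η := fun η hη =>
      (eventually_lt_of_lt_liminf (b := L - η) (by linarith) bddB).mono fun t ht => by linarith
    have hL' : ∀ η > 0, ∃ᶠ t in atTop, -L - η < -f t := fun η hη =>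
      (frequently_lt_of_liminf_lt (b := L + η) bddA.isCoboundedUnder_ge (by linarith)).mono
        fun t ht => by linarith
    have main : ∀ ε > 0, (1 - ε) / (ρ * μ) ≤ Real.exp (ρ * ε) * (L + ε) := by
      intro ε hε
      obtain ⟨T, hT0, hT⟩ := hdense ε hε
      obtain ⟨A, hA⟩ : ∃ A, ∀ i, a i ≤ A := by
        obtain ⟨A, hA⟩ := (Set.finite_range a).bddAbove
        exact ⟨A, fun i => hA ⟨i, rfl⟩⟩
      have hfin := wt_finite a ha (T + ε + A)
      have hprop := fun ω => propagate p a hp hp1 (fun t => -f t) (fun t => 0) (-L)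
        ((eventually_ge_atTop 0).mono fun t ht => by
          have h1 := feq t ht
          have h2 := Real.exp_pos (-ρ * t)
          simp only [mul_neg, Finset.sum_neg_distrib]
          linarith)
        (fun η hη => Eventually.of_forall fun _ => hη) hL ω ε hε
      choose η hη hev using hprop
      have hmin : ∃ e > 0, ∀ ω ∈ {ω : List (Fin r) | wt a ω ≤ T + ε + A}, e ≤ η ω := by
        obtain ⟨ω, hω, hmin⟩ := Set.exists_min_image _ η hfin ⟨[], by
          simp only [Set.mem_ofPred_eq, wt_nil]
          have := (ha ⟨0, hr⟩).trans_le (hA _)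
          linarith⟩
        exact ⟨η ω, hη ω, hmin⟩
      obtain ⟨e, he, hemin⟩ := hmin
      have hev' := (hfin.eventually_all (l := atTop)).2 fun ω _ => hev ω
      have hexs : ∀ᶠ t in atTop, Real.exp (-ρ * (t - (T + ε))) < ε := by
        have := expz.comp (tendsto_atTop_add_const_right atTop (-(T + ε)) tendsto_id)
        exact this.eventually_lt_const hε
      obtain ⟨t, ht1, ht2, ht3, ht4⟩ := ((hL' e he).and_eventually
        (hev'.and ((eventually_ge_atTop (T + ε)).and hexs))).exists
      have hwin : ∀ v, T + ε ≤ v → v ≤ T + ε + A → f (t - v) ≤ Real.exp (ρ * ε) * (L + ε) := by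
        intro v hv1 hv2
        obtain ⟨ω, hω1, hω2⟩ := hT (v - ε) (by linarith)
        have hm : ω ∈ {ω : List (Fin r) | wt a ω ≤ T + ε + A} := by
          simp only [Set.mem_ofPred_eq]; linarith
        have h1 := ht2 ω hm (by linarith [hemin ω hm])
        have h1' : f (t - wt a ω) ≤ L + ε := by linarith
        refine (fle (t - v) (t - wt a ω) (by linarith)).trans ?_
        refine mul_le_mul ?_ h1' (f0 _) (Real.exp_pos _).le
        apply Real.exp_le_exp.2
        apply mul_le_mul_of_nonneg_left _ hρ.le
        linarith
      have hc := cons (t - (T + ε)) (by linarith)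
      have hle : ∑ i, p i * ∫ s in (t - (T + ε) - a i)..(t - (T + ε)), f s
          ≤ ∑ i, p i * (a i * (Real.exp (ρ * ε) * (L + ε))) := by
        apply Finset.sum_le_sum
        intro i _
        apply mul_le_mul_of_nonneg_left _ (hp i).le
        have : ∫ s in (t - (T + ε) - a i)..(t - (T + ε)), f s
            ≤ ∫ s in (t - (T + ε) - a i)..(t - (T + ε)), (Real.exp (ρ * ε) * (L + ε)) := by
          apply integral_mono_on (by linarith [ha i]) (fint _ _) (by simp)
          intro s hs
          have := hwin (t - s) (by linarith [hs.2]) (by linarith [hs.1, hA i])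
          rw [sub_sub_cancel] at this
          linarith
        rw [intervalIntegral.integral_const, smul_eq_mul] at this
        rw [show t - (T + ε) - (t - (T + ε) - a i) = a i by ring] at this
        exact this
      rw [hc] at hle
      simp only [← mul_assoc, ← Finset.sum_mul] at hle
      rw [← hμdef] at hle
      have h5 : (1 - ε) / ρ ≤ (1 - Real.exp (-ρ * (t - (T + ε)))) / ρ := by
        apply div_le_div_of_nonneg_right _ hρ.le
        linarith
      have h6 := h5.trans hle
      rw [div_le_iff₀ hρ] at h6
      rw [div_le_iff₀ (by positivity)]
      linarith
    have l1 : Tendsto (fun ε : ℝ => Real.exp (ρ * ε) * (L + ε))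
        (nhdsWithin 0 (Set.Ioi 0)) (nhds L) := by
      have : Tendsto (fun ε : ℝ => Real.exp (ρ * ε) * (L + ε)) (nhds 0)
          (nhds (Real.exp (ρ * 0) * (L + 0))) :=
        (by fun_prop : Continuous fun ε : ℝ => Real.exp (ρ * ε) * (L + ε)).tendsto 0
      rw [mul_zero, Real.exp_zero, one_mul, add_zero] at this
      exact this.mono_left nhdsWithin_le_nhds
    have l2 : Tendsto (fun ε : ℝ => (1 - ε) / (ρ * μ))
        (nhdsWithin 0 (Set.Ioi 0)) (nhds (1 / (ρ * μ))) := by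
      have : Tendsto (fun ε : ℝ => (1 - ε) / (ρ * μ)) (nhds 0) (nhds ((1 - 0) / (ρ * μ))) :=
        (by fun_prop : Continuous fun ε : ℝ => (1 - ε) / (ρ * μ)).tendsto 0
      rw [sub_zero] at this
      exact this.mono_left nhdsWithin_le_nhds
    exact le_of_tendsto_of_tendsto l2 l1 (by
      filter_upwards [self_mem_nhdsWithin] with ε hε using main ε hε)
  exact tendsto_of_le_liminf_of_limsup_le lower upper bddA bddB

theorem ncard_cons_split {r : ℕ} (S : Set (List (Fin r))) (hS : S.Finite) [Decidable ([] ∈ S)] :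
    S.ncard = (if [] ∈ S then 1 else 0) + ∑ i, {ω | i :: ω ∈ S}.ncard := by
  classical
  rw [Set.ncard_eq_toFinset_card S hS,
    Finset.card_eq_sum_card_fiberwise (f := List.head?) (t := Finset.univ) (by simp),
    Fintype.sum_option]
  congr 1
  · split_ifs with h
    · rw [Finset.card_eq_one]
      refine ⟨[], ?_⟩
      ext ω
      simp only [Finset.mem_filter, Set.Finite.mem_toFinset, List.head?_eq_none_iff,
        Finset.mem_singleton]
      exact ⟨fun h => h.2, fun h' => ⟨h' ▸ h, h'⟩⟩
    · rw [Finset.card_eq_zero]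
      ext ω
      simp only [Finset.mem_filter, Set.Finite.mem_toFinset, List.head?_eq_none_iff,
        Finset.notMem_empty, iff_false, not_and]
      rintro h1 rfl
      exact h h1
  · refine Finset.sum_congr rfl fun i _ => ?_
    rw [← Set.ncard_coe_finset, ← Set.ncard_image_of_injective {ω | i :: ω ∈ S}
      (List.cons_injective (a := i))]
    congr 1
    ext ω
    cases ω with
    | nil => simp
    | cons j ω =>
      simp only [Finset.coe_filter, Set.Finite.mem_toFinset, List.head?_cons, Option.some.injEq,
        Set.mem_ofPred_eq, Set.mem_image, List.cons.injEq]
      constructor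
      · rintro ⟨h1, rfl⟩; exact ⟨ω, h1, rfl, rfl⟩
      · rintro ⟨ω', h1, rfl, rfl⟩; exact ⟨h1, rfl⟩

theorem ncard_reverse {r : ℕ} (S : Set (List (Fin r))) :
    {ω | List.reverse ω ∈ S}.ncard = S.ncard := by
  rw [← Set.ncard_image_of_injective {ω | List.reverse ω ∈ S} List.reverse_injective]
  congr 1
  ext ω
  simp only [Set.mem_image, Set.mem_ofPred_eq]
  exact ⟨fun ⟨x, h1, h2⟩ => h2 ▸ h1, fun h => ⟨ω.reverse, by simpa using h, by simp⟩⟩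

theorem ncard_snoc_split {r : ℕ} (S : Set (List (Fin r))) (hS : S.Finite) [Decidable ([] ∈ S)] :
    S.ncard = (if [] ∈ S then 1 else 0) + ∑ i, {ω | ω ++ [i] ∈ S}.ncard := by
  classical
  have hfin : {ω | List.reverse ω ∈ S}.Finite :=
    hS.preimage (f := List.reverse) List.reverse_injective.injOn
  rw [← ncard_reverse S, ncard_cons_split _ hfin]
  simp only [Set.mem_ofPred_eq, List.reverse_nil, List.reverse_cons]
  have e : ∑ i, {ω | List.reverse ω ++ [i] ∈ S}.ncard = ∑ i, {ω | ω ++ [i] ∈ S}.ncard :=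
    Finset.sum_congr rfl fun i _ => ncard_reverse {ω | ω ++ [i] ∈ S}
  rw [e]
  congr

/-- Number of words of weight at most `t`. -/
noncomputable def cnt {r : ℕ} (a : Fin r → ℝ) (t : ℝ) : ℝ := ({ω | wt a ω ≤ t}.ncard : ℝ)

theorem wt_nonneg {r : ℕ} (a : Fin r → ℝ) (ha : ∀ i, 0 < a i) (ω : List (Fin r)) :
    0 ≤ wt a ω := by
  induction ω with
  | nil => simp [wt]
  | cons i ω ih => rw [wt_cons]; linarith [ha i]

theorem cnt_mono {r : ℕ} (a : Fin r → ℝ) (ha : ∀ i, 0 < a i) : Monotone (cnt a) := by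
  intro s t hst
  unfold cnt
  exact_mod_cast Set.ncard_le_ncard (fun ω (hω : wt a ω ≤ s) => hω.trans hst) (wt_finite a ha t)

theorem cnt_neg {r : ℕ} (a : Fin r → ℝ) (ha : ∀ i, 0 < a i) (t : ℝ) (ht : t < 0) :
    cnt a t = 0 := by
  unfold cnt
  have : {ω | wt a ω ≤ t} = ∅ := by
    ext ω
    simp only [Set.mem_ofPred_eq, Set.mem_empty_iff_false, iff_false, not_le]
    linarith [wt_nonneg a ha ω]
  rw [this]; simp

theorem cnt_eq {r : ℕ} (a : Fin r → ℝ) (ha : ∀ i, 0 < a i) (t : ℝ) (ht : 0 ≤ t) :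
    cnt a t = 1 + ∑ i, cnt a (t - a i) := by
  classical
  unfold cnt
  rw [ncard_cons_split _ (wt_finite a ha t), if_pos (by simpa [wt] using ht)]
  push_cast
  congr 1
  refine Finset.sum_congr rfl fun i _ => ?_
  congr 2
  ext ω
  simp only [Set.mem_ofPred_eq, wt_cons]
  constructor <;> intro h <;> linarith

theorem cnt_asymp {r : ℕ} (hr : 2 ≤ r) (d : Fin r → ℕ) (hd : ∀ i, 2 ≤ d i)
    (hac : ¬ IsCyclicTuple r d) (ρ : ℝ) (hρ : 0 < ρ) (hsum : ∑ i, (d i : ℝ) ^ (-ρ) = 1) :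
    ∃ c : ℝ, 0 < c ∧ Tendsto (fun Y : ℝ =>
      cnt (fun i => Real.log (d i)) (Real.log Y) / Y ^ ρ) atTop (nhds c) := by
  set a : Fin r → ℝ := fun i => Real.log (d i) with hadef
  have ha : ∀ i, 0 < a i := fun i => Real.log_pos (by exact_mod_cast (hd i))
  have hd0 : ∀ i, (0:ℝ) < d i := fun i => by have := hd i; positivity
  have hp : ∀ i, (0:ℝ) < (d i : ℝ) ^ (-ρ) := fun i => Real.rpow_pos_of_pos (hd0 i) _
  obtain ⟨i, j, hij⟩ := exists_irrational_pair hr d hd hac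
  have hren := renewal (by omega) (fun i => (d i : ℝ) ^ (-ρ)) a hp hsum ha ρ hρ
    (fun ε hε => dense_wt a ha i j hij ε hε)
    (fun t => Real.exp (-ρ * t) * cnt a t)
    (fun t => mul_nonneg (Real.exp_pos _).le (by unfold cnt; positivity))
    (fun t ht => by rw [cnt_neg a ha t ht, mul_zero])
    (fun t s hs => by
      rw [← mul_assoc, ← Real.exp_add, show ρ * s + -ρ * (t + s) = -ρ * t by ring]
      exact mul_le_mul_of_nonneg_left (cnt_mono a ha (by linarith)) (Real.exp_pos _).le)
    (fun u v => ((cnt_mono a ha).intervalIntegrable).continuousOn_mul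
      (by fun_prop : Continuous fun t => Real.exp (-ρ * t)).continuousOn)
    (fun t ht => by
      rw [cnt_eq a ha t ht, mul_add, mul_one, Finset.mul_sum, add_comm]
      congr 1
      refine Finset.sum_congr rfl fun i _ => ?_
      rw [← mul_assoc, Real.rpow_def_of_pos (hd0 i), ← Real.exp_add]
      congr 2
      simp only [hadef]; ring)
  refine ⟨_, ?_, (hren.comp Real.tendsto_log_atTop).congr' ?_⟩
  · have : 0 < ∑ i, (d i : ℝ) ^ (-ρ) * a i :=
      have : Nonempty (Fin r) := ⟨i⟩
      Finset.sum_pos (fun i _ => mul_pos (hp i) (ha i)) Finset.univ_nonempty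
    positivity
  · filter_upwards [eventually_gt_atTop 0] with Y hY
    simp only [Function.comp]
    rw [Real.rpow_def_of_pos hY, div_eq_mul_inv, ← Real.exp_neg, mul_comm]
    congr 2; ring

theorem cnt_shift {r : ℕ} (a : Fin r → ℝ) (ρ c : ℝ)
    (hc : Tendsto (fun Y : ℝ => cnt a (Real.log Y) / Y ^ ρ) atTop (nhds c))
    (s k : ℝ) (hs : 0 < s) :
    Tendsto (fun X : ℝ => cnt a (Real.log ((X + k) / s)) / X ^ ρ) atTop (nhds (c * s ^ (-ρ))) := by
  have h1 : Tendsto (fun X : ℝ => (X + k) / s) atTop atTop :=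
    (tendsto_atTop_add_const_right atTop k tendsto_id).atTop_div_const hs
  have h2 : Tendsto (fun X : ℝ => (X + k) / X) atTop (nhds 1) := by
    have : Tendsto (fun X : ℝ => 1 + k / X) atTop (nhds (1 + 0)) :=
      tendsto_const_nhds.add (tendsto_id.const_div_atTop k)
    rw [add_zero] at this
    refine this.congr' ?_
    filter_upwards [eventually_gt_atTop 0] with X hX
    field_simp
  have h3 : Tendsto (fun X : ℝ => ((X + k) / X) ^ ρ) atTop (nhds 1) := by
    have := h2.rpow_const (p := ρ) (Or.inl one_ne_zero)
    rwa [Real.one_rpow] at this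
  have h4 := ((hc.comp h1).mul h3).mul_const (s ^ (-ρ))
  rw [mul_one] at h4
  refine h4.congr' ?_
  filter_upwards [eventually_gt_atTop 0, eventually_gt_atTop (-k)] with X hX hXk
  have hXk' : 0 < X + k := by linarith
  simp only [Function.comp]
  rw [Real.div_rpow hXk'.le hs.le, Real.div_rpow hXk'.le hX.le, Real.rpow_neg hs.le]
  have e1 := Real.rpow_pos_of_pos hXk' ρ
  have e2 := Real.rpow_pos_of_pos hX ρ
  have e3 := Real.rpow_pos_of_pos hs ρ
  field_simp

/-- Sums of shifted heights over words of length `n`. -/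
noncomputable def lvl {V : Type*} {r : ℕ} (φ : Fin r → V → V) (h : V → ℝ) (ρ k : ℝ) : ℕ → V → ℝ
  | 0, Q => (h Q + k) ^ (-ρ)
  | n + 1, Q => ∑ i, lvl φ h ρ k n (φ i Q)

theorem evalWord_snoc {V : Type*} {r : ℕ} (φ : Fin r → V → V) (ω : List (Fin r)) (i : Fin r)
    (x : V) : evalWord φ (ω ++ [i]) x = evalWord φ ω (φ i x) := by
  induction ω with
  | nil => rfl
  | cons j ω ih => simp only [List.cons_append, evalWord, ih]

theorem main_aux {V : Type*} (r : ℕ) (hr : 2 ≤ r) (φ : Fin r → V → V)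
    (h : V → ℝ) (d : Fin r → ℕ) (hd : ∀ i, 2 ≤ d i)
    (hacyclic : ¬ IsCyclicTuple r d) (C : ℝ) (hC : 0 ≤ C)
    (hpol : ∀ i x, |h (φ i x) - (d i : ℝ) * h x| ≤ C)
    (ρ : ℝ) (hρ : 0 < ρ) (hsum : ∑ i, (d i : ℝ) ^ (-ρ) = 1)
    (P : V) (hP : C < h P) :
    ∃ c : ℝ, 0 < c ∧
      Tendsto (fun X : ℝ => ({ω : List (Fin r) | h (evalWord φ ω P) ≤ X}.ncard : ℝ) / X ^ ρ)
        atTop (nhds c) := by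
  classical
  obtain ⟨c, hc0, hc⟩ := cnt_asymp hr d hd hacyclic ρ hρ hsum
  set a : Fin r → ℝ := fun i => Real.log (d i) with hadef
  have ha : ∀ i, 0 < a i := fun i => Real.log_pos (by exact_mod_cast (hd i))
  have hd2 : ∀ i, (2:ℝ) ≤ d i := fun i => by exact_mod_cast hd i
  have hd0 : ∀ i, (0:ℝ) < d i := fun i => by linarith [hd2 i]
  have hexpa : ∀ i, Real.exp (a i) = d i := fun i => Real.exp_log (hd0 i)
  have stepL : ∀ i x, (d i : ℝ) * (h x - C) ≤ h (φ i x) - C := by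
    intro i x
    have := (abs_le.1 (hpol i x)).1
    nlinarith [hd2 i]
  have stepU : ∀ i x, h (φ i x) + C ≤ (d i : ℝ) * (h x + C) := by
    intro i x
    have := (abs_le.1 (hpol i x)).2
    nlinarith [hd2 i]
  have wordL : ∀ ω x, Real.exp (wt a ω) * (h x - C) ≤ h (evalWord φ ω x) - C := by
    intro ω x
    induction ω with
    | nil => simp [wt, evalWord]
    | cons i ω ih =>
      rw [wt_cons, Real.exp_add, hexpa, evalWord, mul_assoc]
      exact (mul_le_mul_of_nonneg_left ih (hd0 i).le).trans (stepL _ _)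
  have wordU : ∀ ω x, h (evalWord φ ω x) + C ≤ Real.exp (wt a ω) * (h x + C) := by
    intro ω x
    induction ω with
    | nil => simp [wt, evalWord]
    | cons i ω ih =>
      rw [wt_cons, Real.exp_add, hexpa, evalWord, mul_assoc]
      exact (stepU _ _).trans (mul_le_mul_of_nonneg_left ih (hd0 i).le)
  have good : ∀ i x, C < h x → C < h (φ i x) := by
    intro i x hx
    have := stepL i x
    nlinarith [hd2 i]
  have hsub : ∀ Q, C < h Q → ∀ X, C < X → {ω : List (Fin r) | h (evalWord φ ω Q) ≤ X}
      ⊆ {ω | wt a ω ≤ Real.log ((X + -C) / (h Q + -C))} := by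
    intro Q hQ X hX ω hω
    have hω' : h (evalWord φ ω Q) ≤ X := hω
    have h1 : 0 < h Q + -C := by linarith
    have h2 : 0 < X + -C := by linarith
    simp only [Set.mem_ofPred_eq]
    rw [Real.le_log_iff_exp_le (by positivity), le_div_iff₀ h1]
    have := wordL ω Q
    rw [← sub_eq_add_neg, ← sub_eq_add_neg]
    linarith
  have hsup : ∀ Q, C < h Q → ∀ X, C < X → {ω | wt a ω ≤ Real.log ((X + C) / (h Q + C))}
      ⊆ {ω : List (Fin r) | h (evalWord φ ω Q) ≤ X} := by
    intro Q hQ X hX ω hω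
    have h1 : 0 < h Q + C := by linarith
    have h2 : 0 < X + C := by linarith
    simp only [Set.mem_ofPred_eq] at hω ⊢
    rw [Real.le_log_iff_exp_le (by positivity), le_div_iff₀ h1] at hω
    have := wordU ω Q
    linarith
  have hfin : ∀ Q, C < h Q → ∀ X, C < X → {ω : List (Fin r) | h (evalWord φ ω Q) ≤ X}.Finite :=
    fun Q hQ X hX => (wt_finite a ha _).subset (hsub Q hQ X hX)
  let N : V → ℝ → ℝ := fun Q X => ({ω : List (Fin r) | h (evalWord φ ω Q) ≤ X}.ncard : ℝ)
  have hN : ∀ Q, C < h Q → ∀ X, C < X →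
      ∑ i, N (φ i Q) X ≤ N Q X ∧ N Q X ≤ 1 + ∑ i, N (φ i Q) X := by
    intro Q hQ X hX
    have key := ncard_snoc_split _ (hfin Q hQ X hX)
    simp only [Set.mem_ofPred_eq, evalWord_snoc] at key
    have key' : N Q X = ((if h (evalWord φ [] Q) ≤ X then 1 else 0 : ℕ) : ℝ)
        + ∑ i, N (φ i Q) X := by
      simp only [N]; rw [key]; push_cast; rfl
    rw [key']
    split_ifs <;> constructor <;> simp
  have r0 : (0:ℝ) < r := by exact_mod_cast (by omega : 0 < r)
  have low : ∀ n Q, C < h Q → ∀ δ > 0, ∀ᶠ X in atTop,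
      c * lvl φ h ρ C n Q - δ ≤ N Q X / X ^ ρ := by
    intro n
    induction n with
    | zero =>
      intro Q hQ δ hδ
      have h1 := cnt_shift a ρ c hc (h Q + C) C (by linarith)
      filter_upwards [h1.eventually_const_lt (show c * lvl φ h ρ C 0 Q - δ < _ by
        simp only [lvl]; linarith), eventually_gt_atTop C] with X h2 h3
      refine h2.le.trans (div_le_div_of_nonneg_right ?_ (Real.rpow_nonneg (by linarith) _))
      simp only [N, cnt]
      exact_mod_cast Set.ncard_le_ncard (hsup Q hQ X h3) (hfin Q hQ X h3)
    | succ n ih =>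
      intro Q hQ δ hδ
      have h1 : ∀ᶠ X in atTop, ∀ i, c * lvl φ h ρ C n (φ i Q) - δ / r ≤ N (φ i Q) X / X ^ ρ :=
        eventually_all.2 fun i => ih (φ i Q) (good i Q hQ) (δ / r) (by positivity)
      filter_upwards [h1, eventually_gt_atTop C] with X h2 h3
      have h4 := Finset.sum_le_sum fun i (_ : i ∈ Finset.univ) => h2 i
      rw [Finset.sum_sub_distrib, ← Finset.mul_sum] at h4
      simp only [Finset.sum_const, Finset.card_univ, Fintype.card_fin, nsmul_eq_mul] at h4
      rw [mul_div_cancel₀ _ r0.ne', ← Finset.sum_div] at h4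
      exact h4.trans (div_le_div_of_nonneg_right (hN Q hQ X h3).1
        (Real.rpow_nonneg (by linarith) _))
  have upp : ∀ n Q, C < h Q → ∀ δ > 0, ∀ᶠ X in atTop,
      N Q X / X ^ ρ ≤ c * lvl φ h ρ (-C) n Q + δ := by
    intro n
    induction n with
    | zero =>
      intro Q hQ δ hδ
      have h1 := cnt_shift a ρ c hc (h Q + -C) (-C) (by linarith)
      filter_upwards [h1.eventually_lt_const (show _ < c * lvl φ h ρ (-C) 0 Q + δ by
        simp only [lvl]; linarith), eventually_gt_atTop C] with X h2 h3
      refine le_trans (div_le_div_of_nonneg_right ?_ (Real.rpow_nonneg (by linarith) _)) h2.le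
      simp only [N, cnt]
      exact_mod_cast Set.ncard_le_ncard (hsub Q hQ X h3) (wt_finite a ha _)
    | succ n ih =>
      intro Q hQ δ hδ
      have h1 : ∀ᶠ X in atTop, ∀ i,
          N (φ i Q) X / X ^ ρ ≤ c * lvl φ h ρ (-C) n (φ i Q) + δ / 2 / r :=
        eventually_all.2 fun i => ih (φ i Q) (good i Q hQ) (δ / 2 / r) (by positivity)
      have h0 : ∀ᶠ X : ℝ in atTop, 1 / X ^ ρ < δ / 2 :=
        ((tendsto_rpow_atTop hρ).const_div_atTop 1).eventually_lt_const (by positivity)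
      filter_upwards [h1, h0, eventually_gt_atTop C] with X h2 h5 h3
      have h4 := Finset.sum_le_sum fun i (_ : i ∈ Finset.univ) => h2 i
      rw [Finset.sum_add_distrib, ← Finset.mul_sum, ← Finset.sum_div] at h4
      simp only [Finset.sum_const, Finset.card_univ, Fintype.card_fin, nsmul_eq_mul] at h4
      rw [mul_div_cancel₀ _ r0.ne'] at h4
      have h6 := div_le_div_of_nonneg_right (hN Q hQ X h3).2
        (Real.rpow_nonneg (by linarith : 0 ≤ X) ρ)
      rw [add_div] at h6
      simp only [lvl]
      linarith
  -- monotonicity of level sums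
  have Amono : ∀ n Q, C < h Q → lvl φ h ρ C n Q ≤ lvl φ h ρ C (n + 1) Q := by
    intro n
    induction n with
    | zero =>
      intro Q hQ
      simp only [lvl]
      calc (h Q + C) ^ (-ρ) = ∑ i, (d i : ℝ) ^ (-ρ) * (h Q + C) ^ (-ρ) := by
            rw [← Finset.sum_mul, hsum, one_mul]
        _ ≤ _ := by
            refine Finset.sum_le_sum fun i _ => ?_
            rw [← Real.mul_rpow (hd0 i).le (by linarith)]
            exact Real.rpow_le_rpow_of_nonpos (by linarith [good i Q hQ]) (stepU i Q)
              (by linarith)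
    | succ n ih =>
      intro Q hQ
      exact Finset.sum_le_sum fun i _ => ih (φ i Q) (good i Q hQ)
  have Bmono : ∀ n Q, C < h Q → lvl φ h ρ (-C) (n + 1) Q ≤ lvl φ h ρ (-C) n Q := by
    intro n
    induction n with
    | zero =>
      intro Q hQ
      simp only [lvl]
      calc _ ≤ ∑ i, (d i : ℝ) ^ (-ρ) * (h Q + -C) ^ (-ρ) := by
            refine Finset.sum_le_sum fun i _ => ?_
            rw [← Real.mul_rpow (hd0 i).le (by linarith)]
            exact Real.rpow_le_rpow_of_nonpos (mul_pos (hd0 i) (by linarith))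
              (by simpa [sub_eq_add_neg] using stepL i Q) (by linarith)
        _ = _ := by rw [← Finset.sum_mul, hsum, one_mul]
    | succ n ih =>
      intro Q hQ
      exact Finset.sum_le_sum fun i _ => ih (φ i Q) (good i Q hQ)
  have AB : ∀ n Q, C < h Q → lvl φ h ρ C n Q ≤ lvl φ h ρ (-C) n Q := by
    intro n
    induction n with
    | zero =>
      intro Q hQ
      exact Real.rpow_le_rpow_of_nonpos (by linarith) (by linarith) (by linarith)
    | succ n ih =>
      intro Q hQ
      exact Finset.sum_le_sum fun i _ => ih (φ i Q) (good i Q hQ)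
  have BA : ∀ n Q s, 0 < s → s ≤ h Q - C →
      (2 ^ n * s / (2 ^ n * s + 2 * C)) ^ ρ * lvl φ h ρ (-C) n Q ≤ lvl φ h ρ C n Q := by
    intro n
    induction n with
    | zero =>
      intro Q s hs hQ
      simp only [lvl, pow_zero, one_mul]
      have h1 : 0 < h Q + -C := by linarith
      have h2 : 0 < h Q + C := by linarith
      have h3 : (s / (s + 2 * C)) ^ ρ ≤ ((h Q + -C) / (h Q + C)) ^ ρ := by
        apply Real.rpow_le_rpow (by positivity) _ hρ.le
        rw [div_le_div_iff₀ (by positivity) h2]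
        nlinarith
      refine (mul_le_mul_of_nonneg_right h3 (Real.rpow_nonneg h1.le _)).trans (le_of_eq ?_)
      rw [Real.div_rpow h1.le h2.le, Real.rpow_neg h1.le, Real.rpow_neg h2.le]
      have e1 := Real.rpow_pos_of_pos h1 ρ
      have e2 := Real.rpow_pos_of_pos h2 ρ
      field_simp
    | succ n ih =>
      intro Q s hs hQ
      simp only [lvl]
      rw [Finset.mul_sum]
      refine Finset.sum_le_sum fun i _ => ?_
      have := ih (φ i Q) (2 * s) (by positivity) (by
        have := stepL i Q
        nlinarith [hd2 i])
      rwa [show (2:ℝ) ^ n * (2 * s) = 2 ^ (n + 1) * s by ring] at this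
  have hB0 : ∀ n, lvl φ h ρ (-C) n P ≤ lvl φ h ρ (-C) 0 P := by
    intro n
    induction n with
    | zero => exact le_rfl
    | succ n ih => exact (Bmono n P hP).trans ih
  have hAm : Monotone fun n => lvl φ h ρ C n P := monotone_nat_of_le_succ fun n => Amono n P hP
  have hAb : BddAbove (Set.range fun n => lvl φ h ρ C n P) :=
    ⟨lvl φ h ρ (-C) 0 P, by rintro _ ⟨n, rfl⟩; exact (AB n P hP).trans (hB0 n)⟩
  have hAlim := tendsto_atTop_ciSup hAm hAb
  set A := ⨆ n, lvl φ h ρ C n P with hA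
  have hApos : 0 < A := by
    have h1 : lvl φ h ρ C 0 P ≤ A := le_ciSup hAb 0
    have h2 : 0 < lvl φ h ρ C 0 P := Real.rpow_pos_of_pos (by linarith) _
    linarith
  have hθ : Tendsto (fun n : ℕ => ((2:ℝ) ^ n * (h P - C) / (2 ^ n * (h P - C) + 2 * C)) ^ ρ)
      atTop (nhds 1) := by
    have hs : 0 < h P - C := by linarith
    have h1 : Tendsto (fun n : ℕ => (2:ℝ) ^ n * (h P - C)) atTop atTop :=
      (tendsto_pow_atTop_atTop_of_one_lt (by norm_num)).atTop_mul_const hs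
    have h2 : Tendsto (fun x : ℝ => x / (x + 2 * C)) atTop (nhds 1) := by
      have h3 : Tendsto (fun x : ℝ => 1 - 2 * C / (x + 2 * C)) atTop (nhds (1 - 0)) :=
        tendsto_const_nhds.sub
          ((tendsto_atTop_add_const_right atTop (2 * C) tendsto_id).const_div_atTop (2 * C))
      rw [sub_zero] at h3
      refine h3.congr' ?_
      filter_upwards [eventually_gt_atTop 0] with x hx
      have : x + 2 * C ≠ 0 := by positivity
      field_simp
      ring
    have := (h2.comp h1).rpow_const (p := ρ) (Or.inl one_ne_zero)
    rwa [Real.one_rpow] at this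
  have hBlim : Tendsto (fun n => lvl φ h ρ (-C) n P) atTop (nhds A) := by
    have hup : Tendsto (fun n : ℕ => lvl φ h ρ C n P +
        (1 - ((2:ℝ) ^ n * (h P - C) / (2 ^ n * (h P - C) + 2 * C)) ^ ρ) * lvl φ h ρ (-C) 0 P)
        atTop (nhds (A + (1 - 1) * lvl φ h ρ (-C) 0 P)) :=
      hAlim.add ((tendsto_const_nhds.sub hθ).mul_const _)
    rw [sub_self, zero_mul, add_zero] at hup
    refine tendsto_of_tendsto_of_tendsto_of_le_of_le hAlim hup (fun n => AB n P hP) fun n => ?_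
    have h1 := BA n P (h P - C) (by linarith) le_rfl
    have hs : 0 < h P - C := by linarith
    have h2 : ((2:ℝ) ^ n * (h P - C) / (2 ^ n * (h P - C) + 2 * C)) ^ ρ ≤ 1 := by
      apply Real.rpow_le_one (by positivity) _ hρ.le
      rw [div_le_one (by positivity)]
      linarith
    have h3 := mul_le_mul_of_nonneg_left (hB0 n) (sub_nonneg.2 h2)
    simp only
    linarith
  refine ⟨c * A, by positivity, ?_⟩
  have hAlim' := hAlim.const_mul c
  have hBlim' := hBlim.const_mul c
  rw [Metric.tendsto_nhds]
  intro ε hε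
  obtain ⟨n, hn1, hn2⟩ := ((hAlim'.eventually_const_lt (show c * A - ε / 2 < c * A by linarith)).and
    (hBlim'.eventually_lt_const (show c * A < c * A + ε / 2 by linarith))).exists
  filter_upwards [low n P hP (ε / 2) (by positivity), upp n P hP (ε / 2) (by positivity)]
    with X h1 h2
  rw [Real.dist_eq, abs_lt]
  simp only [N] at h1 h2
  constructor <;> linarith

/-- in the abstract polarized setting with integer degrees forming an
acyclic tuple, if `h P > 2 C_S` then the number of words `ω` with `h(eval ω P) ≤ X`
is asymptotic to `c · X ^ ρ` for some `c > 0`. -/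
theorem stmt_16 {V : Type*} (r : ℕ) (hr : 2 ≤ r) (φ : Fin r → V → V)
    (h : V → ℝ) (hh : ∀ x, 0 ≤ h x)
    (d : Fin r → ℕ) (hd : ∀ i, 2 ≤ d i)
    (hacyclic : ¬ IsCyclicTuple r d)
    (C : Fin r → ℝ) (hC : ∀ i, 0 ≤ C i)
    (hpol : ∀ i x, |h (φ i x) - (d i : ℝ) * h x| ≤ C i)
    (CS : ℝ) (hCS : IsGreatest (Set.range C) CS)
    (ρ : ℝ) (hρ : 0 < ρ) (hsum : ∑ i, (d i : ℝ) ^ (-ρ) = 1)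
    (P : V) (hP : 2 * CS < h P) :
    ∃ c : ℝ, 0 < c ∧
      Tendsto (fun X : ℝ =>
          (Nat.card {ω : List (Fin r) // h (evalWord φ ω P) ≤ X} : ℝ) / X ^ ρ)
        atTop (nhds c) := by
  obtain ⟨⟨i0, hi0⟩, hub⟩ := hCS
  have hCS0 : 0 ≤ CS := hi0 ▸ hC i0
  exact main_aux r hr φ h d hd hacyclic CS hCS0
    (fun i x => (hpol i x).trans (hub ⟨i, rfl⟩)) ρ hρ hsum P (by linarith)
end

section
/- In the abstract polarized setting, suppose the Northcott property holds at P ∈ V and that Orb_S(P) is infinite, and let B > 0 be a real number. Then there exist a finite subset F ⊆ Orb_S(P) and points Q_1,…,Q_n ∈ Orb_S(P) such that h(Q_i) > B for each i and Orb_S(P) = F ∪ Orb_S(Q_1) ∪ ⋯ ∪ Orb_S(Q_n). -/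
theorem orbS_step {V : Type*} {r : ℕ} (φ : Fin r → V → V) (P y : V) (i : Fin r)
    (hy : y = P ∨ y ∈ orbS φ P) : φ i y ∈ orbS φ P := by
  rcases hy with rfl | ⟨ω, _, rfl⟩
  · exact ⟨[i], by simp, rfl⟩
  · exact ⟨i :: ω, by simp, rfl⟩

theorem orbS_sub {V : Type*} {r : ℕ} (φ : Fin r → V → V) (P Q : V)
    (hQ : Q ∈ orbS φ P) : orbS φ Q ⊆ orbS φ P := by
  rintro x ⟨ω, _, rfl⟩
  induction ω with
  | nil => exact hQ
  | cons i ω ih =>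
    apply orbS_step φ P _ i
    right
    by_cases hω : ω = []
    · subst hω
      exact hQ
    · exact ih hω

/-- in the abstract polarized setting, an infinite orbit satisfying the
Northcott property decomposes, up to a finite set, into orbits of points of height
greater than any prescribed `B > 0`. -/
theorem stmt_17 {V : Type*} (r : ℕ) (hr : 2 ≤ r) (φ : Fin r → V → V)
    (h : V → ℝ) (hh : ∀ x, 0 ≤ h x)
    (d : Fin r → ℝ) (hd : ∀ i, 2 ≤ d i)
    (C : Fin r → ℝ) (hC : ∀ i, 0 ≤ C i)
    (hpol : ∀ i x, |h (φ i x) - d i * h x| ≤ C i)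
    (P : V)
    (hNorth : ∀ B : ℝ, {Q : V | Q ∈ orbS φ P ∧ h Q ≤ B}.Finite)
    (hinf : (orbS φ P).Infinite)
    (B : ℝ) (hB : 0 < B) :
    ∃ F : Set V, F.Finite ∧ F ⊆ orbS φ P ∧
      ∃ (n : ℕ) (Q : Fin n → V),
        (∀ i, Q i ∈ orbS φ P ∧ B < h (Q i)) ∧
        orbS φ P = F ∪ ⋃ i, orbS φ (Q i) := by
  set L : Set V := {Q : V | Q ∈ orbS φ P ∧ h Q ≤ B} with hL
  have hLf : L.Finite := hNorth B
  set E : Set V := ⋃ i, φ i '' (insert P L) with hE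
  have hEf : E.Finite := Set.finite_iUnion fun i => (hLf.insert P).image _
  set G : Set V := {x | x ∈ E ∧ B < h x} with hG
  have hGf : G.Finite := hEf.subset fun x hx => hx.1
  have hEO : E ⊆ orbS φ P := by
    intro x hx
    obtain ⟨i, y, hy, rfl⟩ := Set.mem_iUnion.1 hx
    exact orbS_step φ P y i (hy.imp id fun h => h.1)
  have hGO : G ⊆ orbS φ P := fun x hx => hEO hx.1
  have hEF : E ⊆ L ∪ G := by
    intro x hx
    rcases le_or_gt (h x) B with h1 | h1
    · exact Or.inl ⟨hEO hx, h1⟩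
    · exact Or.inr ⟨hx, h1⟩
  have hFO : L ∪ G ⊆ orbS φ P := Set.union_subset (fun x hx => hx.1) hGO
  obtain ⟨n, Q, hQ⟩ : ∃ (n : ℕ) (Q : Fin n → V), Set.range Q = G := by
    obtain ⟨n, Q, hQ⟩ := hGf.fin_param
    exact ⟨n, Q, hQ.2⟩
  have hQG : ∀ i, Q i ∈ G := fun i => hQ ▸ Set.mem_range_self i
  refine ⟨L ∪ G, hLf.union hGf, hFO, n, Q, fun i => ⟨hGO (hQG i), (hQG i).2⟩, ?_⟩
  apply Set.Subset.antisymm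
  · rintro x ⟨ω, hω, rfl⟩
    induction ω with
    | nil => exact absurd rfl hω
    | cons i ω ih =>
      change φ i (evalWord φ ω P) ∈ _
      by_cases h0 : ω = []
      · subst h0
        exact Or.inl (hEF (Set.mem_iUnion.2 ⟨i, P, Or.inl rfl, rfl⟩))
      · rcases ih h0 with (hl | hg) | ho
        · exact Or.inl (hEF (Set.mem_iUnion.2 ⟨i, _, Or.inr hl, rfl⟩))
        · rw [← hQ] at hg
          obtain ⟨j, hj⟩ := hg
          exact Or.inr (Set.mem_iUnion.2 ⟨j, orbS_step φ _ _ i (Or.inl hj.symm)⟩)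
        · obtain ⟨j, hj⟩ := Set.mem_iUnion.1 ho
          exact Or.inr (Set.mem_iUnion.2 ⟨j, orbS_step φ _ _ i (Or.inr hj)⟩)
  · exact Set.union_subset hFO (Set.iUnion_subset fun i => orbS_sub φ P _ (hGO (hQG i)))
end

section
/- In the abstract polarized setting, let ρ be the unique positive real with d_1^{−ρ}+⋯+d_r^{−ρ} = 1, let P ∈ V, and suppose the Northcott property holds at P. Then there exist a constant c > 0 and a real X_0 such that for all X ≥ X_0 the set {Q ∈ Orb_S(P) : h(Q) ≤ X} is finite of cardinality at most c·X^ρ. -/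
/-- in the abstract polarized setting, if the Northcott property holds
at `P`, then the number of orbit points of height at most `X` is `O(X ^ ρ)`. -/
theorem stmt_18 {V : Type*} (r : ℕ) (hr : 2 ≤ r) (φ : Fin r → V → V)
    (h : V → ℝ) (hh : ∀ x, 0 ≤ h x)
    (d : Fin r → ℝ) (hd : ∀ i, 2 ≤ d i)
    (C : Fin r → ℝ) (hC : ∀ i, 0 ≤ C i)
    (hpol : ∀ i x, |h (φ i x) - d i * h x| ≤ C i)
    (ρ : ℝ) (hρ : 0 < ρ) (hsum : ∑ i, d i ^ (-ρ) = 1)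
    (P : V)
    (hNorth : ∀ B : ℝ, {Q : V | Q ∈ orbS φ P ∧ h Q ≤ B}.Finite) :
    ∃ c : ℝ, 0 < c ∧ ∃ X₀ : ℝ, ∀ X ≥ X₀,
      {Q : V | Q ∈ orbS φ P ∧ h Q ≤ X}.Finite ∧
      (Nat.card {Q : V // Q ∈ orbS φ P ∧ h Q ≤ X} : ℝ) ≤ c * X ^ ρ := by
  classical
  set K : ℝ := ∑ i, C i with hK
  set D : ℝ := 1 + ∑ i, d i with hD
  have hd0 : ∀ i, 0 < d i := fun i => by linarith [hd i]
  have hKi : ∀ i, C i ≤ K := fun i =>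
    Finset.single_le_sum (f := C) (fun j _ => hC j) (Finset.mem_univ i)
  have hDi : ∀ i, d i ≤ D := fun i => by
    have := Finset.single_le_sum (f := d) (fun j _ => (hd0 j).le) (Finset.mem_univ i)
    linarith
  have hK0 : 0 ≤ K := Finset.sum_nonneg fun i _ => hC i
  have hD1 : 1 ≤ D := by
    have : 0 ≤ ∑ i, d i := Finset.sum_nonneg fun i _ => (hd0 i).le
    linarith
  let S : ℝ → Set V := fun X => {Q | (∃ ω, evalWord φ ω P = Q) ∧ h Q ≤ X}
  have hSfin : ∀ X, (S X).Finite := by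
    intro X
    refine ((hNorth X).insert P).subset ?_
    rintro Q ⟨⟨ω, hω⟩, hQ⟩
    by_cases h0 : ω = []
    · subst h0
      exact Or.inl hω.symm
    · exact Or.inr ⟨⟨ω, h0, hω⟩, hQ⟩
  have hSmono : ∀ X Y, X ≤ Y → S X ⊆ S Y := fun X Y hXY Q hQ => ⟨hQ.1, hQ.2.trans hXY⟩
  have hrec : ∀ Y : ℝ, S (Y + K) ⊆ {P} ∪ ⋃ i, φ i '' S (Y / d i + K) := by
    rintro Y Q ⟨⟨ω, hω⟩, hQ⟩
    cases ω with
    | nil => exact Or.inl hω.symm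
    | cons i w =>
      right
      refine Set.mem_iUnion.2 ⟨i, evalWord φ w P, ⟨⟨w, rfl⟩, ?_⟩, hω⟩
      have h1 := (abs_le.1 (hpol i (evalWord φ w P))).1
      have h2 : h (φ i (evalWord φ w P)) ≤ Y + K := by
        have : φ i (evalWord φ w P) = Q := hω
        rw [this]; exact hQ
      have h3 := hKi i
      have h4 : d i * (Y / d i) = Y := mul_div_cancel₀ Y (hd0 i).ne'
      have h5 : 2 * K ≤ d i * K := mul_le_mul_of_nonneg_right (hd i) hK0
      refine le_of_mul_le_mul_left ?_ (hd0 i)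
      rw [mul_add, h4]
      linarith
  have hcard : ∀ Y : ℝ, ((S (Y + K)).ncard : ℝ) ≤ 1 + ∑ i, ((S (Y / d i + K)).ncard : ℝ) := by
    intro Y
    have hfU : (⋃ i, φ i '' S (Y / d i + K)).Finite :=
      Set.finite_iUnion fun i => (hSfin _).image _
    have h1 := Set.ncard_le_ncard (hrec Y) ((Set.finite_singleton P).union hfU)
    have h2 := Set.ncard_union_le {P} (⋃ i, φ i '' S (Y / d i + K))
    rw [Set.ncard_singleton] at h2
    have h3 : (⋃ i, φ i '' S (Y / d i + K)).ncard ≤ ∑ i, (φ i '' S (Y / d i + K)).ncard :=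
      Set.ncard_iUnion_le_of_fintype _
    have h4 : ∑ i, (φ i '' S (Y / d i + K)).ncard ≤ ∑ i, (S (Y / d i + K)).ncard :=
      Finset.sum_le_sum fun i _ => Set.ncard_image_le (hSfin _)
    have : (S (Y + K)).ncard ≤ 1 + ∑ i, (S (Y / d i + K)).ncard := by omega
    exact_mod_cast this
  set A : ℝ := ((S (D + K)).ncard : ℝ) + 1 with hA
  have hA0 : 0 < A := by positivity
  have hmain : ∀ n : ℕ, ∀ Y : ℝ, 1 ≤ Y → Y ≤ D * 2 ^ n →
      ((S (Y + K)).ncard : ℝ) ≤ A * Y ^ ρ - 1 := by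
    have hbase : ∀ Y : ℝ, 1 ≤ Y → Y ≤ D → ((S (Y + K)).ncard : ℝ) ≤ A * Y ^ ρ - 1 := by
      intro Y hY hYD
      have h1 : ((S (Y + K)).ncard : ℝ) ≤ ((S (D + K)).ncard : ℝ) := by
        exact_mod_cast Set.ncard_le_ncard (hSmono _ _ (by linarith)) (hSfin _)
      have h2 : 1 ≤ Y ^ ρ := Real.one_le_rpow hY hρ.le
      nlinarith
    intro n
    induction n with
    | zero => 
      intro Y hY hYD
      exact hbase Y hY (by simpa using hYD)
    | succ n ih =>
      intro Y hY hYD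
      by_cases hc : Y ≤ D
      · exact hbase Y hY hc
      push Not at hc
      have hstep : ∀ i, ((S (Y / d i + K)).ncard : ℝ) ≤ A * Y ^ ρ * d i ^ (-ρ) - 1 := by
        intro i
        have h1 : 1 ≤ Y / d i := by
          rw [le_div_iff₀ (hd0 i)]; linarith [hDi i]
        have h2 : Y / d i ≤ D * 2 ^ n := by
          rw [div_le_iff₀ (hd0 i)]
          have : D * 2 ^ n * 2 ≤ D * 2 ^ n * d i :=
            mul_le_mul_of_nonneg_left (hd i) (by positivity)
          rw [pow_succ] at hYD
          linarith
        have h3 := ih _ h1 h2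
        rw [Real.div_rpow (by linarith) (hd0 i).le] at h3
        rw [Real.rpow_neg (hd0 i).le]
        calc _ ≤ _ := h3
          _ = _ := by ring
      have h1 := hcard Y
      have h2 : ∑ i, ((S (Y / d i + K)).ncard : ℝ) ≤ ∑ i, (A * Y ^ ρ * d i ^ (-ρ) - 1) :=
        Finset.sum_le_sum fun i _ => hstep i
      rw [Finset.sum_sub_distrib, ← Finset.mul_sum, hsum] at h2
      simp at h2
      have h3 : (2 : ℝ) ≤ r := by exact_mod_cast hr
      linarith
  refine ⟨A, hA0, 1, fun X hX => ⟨hNorth X, ?_⟩⟩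
  have hX' : (1 : ℝ) ≤ X := hX
  obtain ⟨n, hn⟩ := pow_unbounded_of_one_lt X (one_lt_two : (1 : ℝ) < 2)
  have h1 := hmain n X hX' (by
    have : 1 * (2 : ℝ) ^ n ≤ D * 2 ^ n := mul_le_mul_of_nonneg_right hD1 (by positivity)
    linarith)
  have h2 : {Q : V | Q ∈ orbS φ P ∧ h Q ≤ X}.ncard ≤ (S (X + K)).ncard := by
    refine Set.ncard_le_ncard ?_ (hSfin _)
    rintro Q ⟨⟨ω, _, hω⟩, hQ⟩
    exact ⟨⟨ω, hω⟩, by linarith⟩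
  have h3 : (Nat.card {Q : V // Q ∈ orbS φ P ∧ h Q ≤ X} : ℝ) ≤ ((S (X + K)).ncard : ℝ) := by
    exact_mod_cast h2
  linarith
end

section
/- In the abstract polarized setting, let P ∈ V and suppose: (i) the Northcott property holds at P; (ii) the map ω ↦ eval(ω) is injective on nonempty words (freeness); (iii) the cancellation property holds at P; and (iv) Orb_S(P) is infinite. Then there exist a real B > 0 and non-preperiodic points Q_1,…,Q_t ∈ Orb_S(P) with h(Q_i) > B for each i, such that the ratio #{Q ∈ Orb_S(P) : h(Q) ≤ X} / (∑_{i=1}^{t} #{ω a nonempty word : h(eval(ω)(Q_i)) ≤ X}) tends to 1 as the real number X tends to infinity. -/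
open Filter

/-- `P` is preperiodic: some nonempty word fixes some point of the forward orbit
(of shape `eval v P`). -/
def Preper {V : Type*} {r : ℕ} (φ : Fin r → V → V) (P : V) : Prop :=
  ∃ u v : List (Fin r), u ≠ [] ∧ evalWord φ u (evalWord φ v P) = evalWord φ v P

/-- in the abstract polarized setting, under Northcott, freeness and the
cancellation property at `P`, with infinite orbit, the number of orbit points of
height at most `X` is asymptotically the sum over finitely many non-preperiodic
points `Q i` of high height of the number of nonempty words `ω` with
`h(eval ω (Q i)) ≤ X`. -/
theorem stmt_19 {V : Type*} (r : ℕ) (hr : 2 ≤ r) (φ : Fin r → V → V)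
    (h : V → ℝ) (hh : ∀ x, 0 ≤ h x)
    (d : Fin r → ℝ) (hd : ∀ i, 2 ≤ d i)
    (C : Fin r → ℝ) (hC : ∀ i, 0 ≤ C i)
    (hpol : ∀ i x, |h (φ i x) - d i * h x| ≤ C i)
    (P : V)
    (hNorth : ∀ B : ℝ, {Q : V | Q ∈ orbS φ P ∧ h Q ≤ B}.Finite)
    (hfree : ∀ u v : List (Fin r), u ≠ [] → v ≠ [] →
      evalWord φ u = evalWord φ v → u = v)
    (hcancel : ∃ B : ℝ, 0 < B ∧ ∀ (i j : Fin r) (u v : List (Fin r)) (Q₁ Q₂ : V),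
      Q₁ ∈ orbS φ P → Q₂ ∈ orbS φ P → B < h Q₁ → B < h Q₂ →
      evalWord φ (i :: u) Q₁ = evalWord φ (j :: v) Q₂ →
      i = j ∧ evalWord φ u Q₁ = evalWord φ v Q₂)
    (hinf : (orbS φ P).Infinite) :
    ∃ B : ℝ, 0 < B ∧ ∃ (t : ℕ) (Q : Fin t → V),
      (∀ i, Q i ∈ orbS φ P ∧ B < h (Q i) ∧ ¬ Preper φ (Q i)) ∧
      Tendsto (fun X : ℝ =>
          (Nat.card {q : V // q ∈ orbS φ P ∧ h q ≤ X} : ℝ) /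
            ∑ i, (Nat.card {ω : List (Fin r) // ω ≠ [] ∧
              h (evalWord φ ω (Q i)) ≤ X} : ℝ))
        atTop (nhds 1) := by
  obtain ⟨B0, hB0, hcan⟩ := hcancel
  obtain ⟨K, hK0, hK⟩ : ∃ K : ℝ, 0 ≤ K ∧ ∀ i, C i ≤ K :=
    ⟨∑ i, C i, Finset.sum_nonneg fun i _ => hC i,
      fun i => Finset.single_le_sum (fun j _ => hC j) (Finset.mem_univ i)⟩
  obtain ⟨D, hD0, hD⟩ : ∃ D : ℝ, 0 ≤ D ∧ ∀ i, d i ≤ D :=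
    ⟨∑ i, d i, Finset.sum_nonneg fun i _ => by linarith [hd i],
      fun i => Finset.single_le_sum (fun j _ => by linarith [hd j]) (Finset.mem_univ i)⟩
  obtain ⟨B, hB, hBB0, hBK⟩ : ∃ B : ℝ, 0 < B ∧ B0 ≤ B ∧ K + 1 ≤ B :=
    ⟨B0 + K + 1, by linarith, by linarith, by linarith⟩
  have hstep : ∀ i x, B < h x → h x + 1 ≤ h (φ i x) := by
    intro i x hx
    have h1 := (abs_le.1 (hpol i x)).1
    have h2 := hK i
    have h3 : 2 * h x ≤ d i * h x := mul_le_mul_of_nonneg_right (hd i) (hh x)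
    linarith
  have hword : ∀ (ω : List (Fin r)) x, B < h x → h x + ω.length ≤ h (evalWord φ ω x) := by
    intro ω x hx
    induction ω with
    | nil => simp [evalWord]
    | cons i ω ih =>
      have : (0 : ℝ) ≤ (ω.length : ℝ) := by positivity
      have h1 := hstep i (evalWord φ ω x) (by linarith)
      simp only [evalWord, List.length_cons]
      push_cast
      linarith
  have hwordB : ∀ (ω : List (Fin r)) x, B < h x → B < h (evalWord φ ω x) := by
    intro ω x hx
    have h1 := hword ω x hx
    have : (0 : ℝ) ≤ (ω.length : ℝ) := by positivity
    linarith
  have happ : ∀ (u v : List (Fin r)) x,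
      evalWord φ (u ++ v) x = evalWord φ u (evalWord φ v x) := by
    intro u v x
    induction u with
    | nil => rfl
    | cons i u ih => simp only [List.cons_append, evalWord, ih]
  have horb : ∀ (ω : List (Fin r)) x, x ∈ orbS φ P → evalWord φ ω x ∈ orbS φ P := by
    rintro ω x ⟨v, hv, rfl⟩
    exact ⟨ω ++ v, by simp [hv], happ ω v P⟩
  have hnp : ∀ x, B < h x → ¬ Preper φ x := by
    rintro x hx ⟨u, v, hu, huv⟩
    have h1 := hword u _ (hwordB v x hx)
    rw [huv] at h1
    have : (0 : ℝ) < (u.length : ℝ) := by exact_mod_cast List.length_pos_iff.2 hu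
    linarith
  let E : Set V := {q | (q ∈ orbS φ P ∧ B < h q) ∧
    ∀ (i : Fin r) (x : V), x ∈ orbS φ P → B < h x → q ≠ φ i x}
  let M : ℝ := D * (B + h P) + K
  have hEM : ∀ q ∈ E, h q ≤ M := by
    rintro q ⟨⟨⟨ω, hω, rfl⟩, hq⟩, hmin⟩
    cases ω with
    | nil => exact absurd rfl hω
    | cons i ω =>
      have hle : h (evalWord φ ω P) ≤ B + h P := by
        by_cases hω' : ω = []
        · subst hω'
          simp only [evalWord]
          linarith
        · by_contra hlt
          have := hh P
          exact hmin i (evalWord φ ω P) ⟨ω, hω', rfl⟩ (by linarith) rfl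
      have h1 := (abs_le.1 (hpol i (evalWord φ ω P))).2
      have h2 := hK i
      have h3 : d i * h (evalWord φ ω P) ≤ D * (B + h P) :=
        mul_le_mul (hD i) hle (hh _) hD0
      simp only [evalWord, M]
      linarith
  have hEfin : E.Finite := (hNorth M).subset fun q hq => ⟨hq.1.1, hEM q hq⟩
  -- existence of the decomposition
  have hex : ∀ (n : ℕ) q, q ∈ orbS φ P → B < h q → h q ≤ n →
      ∃ e ∈ E, ∃ ω, evalWord φ ω e = q := by
    intro n
    induction n with
    | zero =>
      intro q _ h1 h2
      simp only [Nat.cast_zero] at h2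
      linarith
    | succ n ih =>
      intro q hq h1 h2
      by_cases hqE : q ∈ E
      · exact ⟨q, hqE, [], rfl⟩
      · have : ∃ (i : Fin r) (x : V), x ∈ orbS φ P ∧ B < h x ∧ q = φ i x := by
          by_contra hno
          push Not at hno
          exact hqE ⟨⟨hq, h1⟩, hno⟩
        obtain ⟨i, x, hx, hxB, rfl⟩ := this
        have h3 := hstep i x hxB
        push_cast at h2
        obtain ⟨e, he, ω, rfl⟩ := ih x hx hxB (by linarith)
        exact ⟨e, he, i :: ω, rfl⟩
  -- uniqueness of the decomposition
  have huniq : ∀ (u v : List (Fin r)) (e f : V), e ∈ E → f ∈ E →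
      evalWord φ u e = evalWord φ v f → u = v ∧ e = f := by
    intro u
    induction u with
    | nil =>
      intro v e f he hf hef
      cases v with
      | nil => exact ⟨rfl, hef⟩
      | cons j v =>
        exact absurd hef (he.2 j (evalWord φ v f) (horb v f hf.1.1) (hwordB v f hf.1.2))
    | cons i u ih =>
      intro v e f he hf hef
      cases v with
      | nil =>
        exact absurd hef.symm (hf.2 i (evalWord φ u e) (horb u e he.1.1) (hwordB u e he.1.2))
      | cons j v =>
        obtain ⟨rfl, h2⟩ := hcan i j u v e f he.1.1 hf.1.1 (by linarith [he.1.2])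
          (by linarith [hf.1.2]) hef
        obtain ⟨rfl, h3⟩ := ih v e f he hf h2
        exact ⟨rfl, h3⟩
  let F : Set V := {q | q ∈ orbS φ P ∧ (h q ≤ B ∨ q ∈ E)}
  have hFfin : F.Finite := by
    refine ((hNorth B).union hEfin).subset ?_
    rintro q ⟨h1, h2 | h2⟩
    · exact Or.inl ⟨h1, h2⟩
    · exact Or.inr h2
  have : Finite E := hEfin.to_subtype
  have : Finite F := hFfin.to_subtype
  let eq : E ≃ Fin (Nat.card E) := Finite.equivFin E
  let Q : Fin (Nat.card E) → V := fun i => (eq.symm i : V)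
  have hQE : ∀ i, Q i ∈ E := fun i => (eq.symm i).2
  have hQinj : Function.Injective Q := Subtype.val_injective.comp eq.symm.injective
  refine ⟨B, hB, Nat.card E, Q,
    fun i => ⟨(hQE i).1.1, (hQE i).1.2, hnp _ (hQE i).1.2⟩, ?_⟩
  have horbfin : ∀ X : ℝ, Finite {q : V // q ∈ orbS φ P ∧ h q ≤ X} := fun X => (hNorth X).to_subtype
  have hwfin : ∀ (X : ℝ) (i), Finite {ω : List (Fin r) // ω ≠ [] ∧ h (evalWord φ ω (Q i)) ≤ X} := by
    intro X i
    have := horbfin X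
    refine Finite.of_injective (β := {q : V // q ∈ orbS φ P ∧ h q ≤ X})
      (fun ω => ⟨evalWord φ ω.1 (Q i), horb _ _ (hQE i).1.1, ω.2.2⟩) ?_
    intro u v huv
    exact Subtype.ext (huniq _ _ _ _ (hQE i) (hQE i) (congrArg Subtype.val huv)).1
  have hcount : ∀ X : ℝ, max B M ≤ X →
      (Nat.card {q : V // q ∈ orbS φ P ∧ h q ≤ X} : ℝ) = Nat.card F +
        ∑ i, (Nat.card {ω : List (Fin r) // ω ≠ [] ∧ h (evalWord φ ω (Q i)) ≤ X} : ℝ) := by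
    intro X hX
    have := hwfin X
    let f : F ⊕ (Σ i, {ω : List (Fin r) // ω ≠ [] ∧ h (evalWord φ ω (Q i)) ≤ X}) →
        {q : V // q ∈ orbS φ P ∧ h q ≤ X} := Sum.elim
      (fun q => ⟨q.1, q.2.1, q.2.2.elim (fun h1 => h1.trans ((le_max_left _ _).trans hX))
        (fun h1 => (hEM _ h1).trans ((le_max_right _ _).trans hX))⟩)
      (fun p => ⟨evalWord φ p.2.1 (Q p.1), horb _ _ (hQE p.1).1.1, p.2.2.2⟩)
    have hnotF : ∀ (ω : List (Fin r)) i, ω ≠ [] → evalWord φ ω (Q i) ∉ F := by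
      rintro ω i hω ⟨_, h2 | h2⟩
      · linarith [hwordB ω _ (hQE i).1.2]
      · exact hω (huniq ω [] (Q i) _ (hQE i) h2 rfl).1
    have hf : Function.Bijective f := by
      constructor
      · rintro (x | ⟨i, u, hu⟩) (y | ⟨j, v, hv⟩) hxy
        · have h1 : (x : V) = (y : V) := by
            have h2 := congrArg Subtype.val hxy
            exact h2
          exact congrArg Sum.inl (Subtype.ext h1)
        · have h1 : (x : V) = evalWord φ v (Q j) := congrArg Subtype.val hxy
          exact absurd (h1 ▸ x.2) (hnotF v j hv.1)
        · have h1 : evalWord φ u (Q i) = (y : V) := Subtype.ext_iff.1 hxy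
          exact absurd (h1 ▸ y.2) (hnotF u i hu.1)
        · have h1 : evalWord φ u (Q i) = evalWord φ v (Q j) := congrArg Subtype.val hxy
          obtain ⟨rfl, h2⟩ := huniq _ _ _ _ (hQE i) (hQE j) h1
          obtain rfl := hQinj h2
          rfl
      · rintro ⟨q, hq, hqX⟩
        by_cases hqF : q ∈ F
        · exact ⟨Sum.inl ⟨q, hqF⟩, rfl⟩
        · have hqB : B < h q := by
            by_contra hlt
            exact hqF ⟨hq, Or.inl (not_lt.1 hlt)⟩
          obtain ⟨n, hn⟩ := exists_nat_ge (h q)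
          obtain ⟨e, he, ω, rfl⟩ := hex n q hq hqB hn
          have hω : ω ≠ [] := by
            rintro rfl
            exact hqF ⟨hq, Or.inr he⟩
          have hQe : Q (eq ⟨e, he⟩) = e :=
            congrArg Subtype.val (eq.symm_apply_apply ⟨e, he⟩)
          refine ⟨Sum.inr ⟨eq ⟨e, he⟩, ω, hω, by rw [hQe]; exact hqX⟩, Subtype.ext ?_⟩
          change evalWord φ ω (Q (eq ⟨e, he⟩)) = _
          rw [hQe]
    rw [← Nat.card_congr (Equiv.ofBijective f hf), Nat.card_sum, Nat.card_sigma]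
    push_cast
    rfl
  have hA : Tendsto (fun X : ℝ => (Nat.card {q : V // q ∈ orbS φ P ∧ h q ≤ X} : ℝ))
      atTop atTop := by
    refine tendsto_natCast_atTop_atTop.comp (tendsto_atTop.2 fun n => ?_)
    obtain ⟨T, hT, hTn⟩ := hinf.exists_subset_card_eq n
    filter_upwards [eventually_ge_atTop (∑ q ∈ T, h q)] with X hX
    have := horbfin X
    rw [← hTn, ← Nat.card_eq_finsetCard T]
    refine Nat.card_le_card_of_injective (α := T)
      (fun q => ⟨q.1, hT q.2, (Finset.single_le_sum (fun x _ => hh x) q.2).trans hX⟩) ?_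
    intro a b hab
    have h1 : (a : V) = (b : V) := by
      have h2 := congrArg Subtype.val hab
      exact h2
    exact Subtype.ext h1
  have hS : Tendsto (fun X : ℝ =>
      ∑ i, (Nat.card {ω : List (Fin r) // ω ≠ [] ∧ h (evalWord φ ω (Q i)) ≤ X} : ℝ))
      atTop atTop := by
    refine (tendsto_atTop_add_const_right atTop (-(Nat.card F : ℝ)) hA).congr' ?_
    filter_upwards [eventually_ge_atTop (max B M)] with X hX
    rw [hcount X hX]
    ring
  have hlim : Tendsto (fun X : ℝ => (Nat.card F : ℝ) /
      (∑ i, (Nat.card {ω : List (Fin r) // ω ≠ [] ∧ h (evalWord φ ω (Q i)) ≤ X} : ℝ)) + 1)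
      atTop (nhds 1) := by
    simpa using (hS.const_div_atTop (Nat.card F : ℝ)).add_const 1
  refine hlim.congr' ?_
  filter_upwards [eventually_ge_atTop (max B M), hS.eventually_gt_atTop 0] with X hX hpos
  rw [hcount X hX, add_div, div_self hpos.ne']
end
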